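/- There exist universal constants c₁, c₂, X > 0 such that for all p > p_c, all n ≥ L(p), and all x ≥ X: ℙ_p(|C^max_{B_n}| ≥ x n² θ(p)) ≤ c₁ e^{−c₂ x n²/L(p)²}, where C^max_{B_n} denotes a black cluster of maximal volume among the black connected components of the subgraph induced on B_n. -/

import Mathlib

open MeasureTheory ProbabilityTheory Filter

noncomputable section

namespace FrozenPercolation

/-- Sites of the triangular lattice, coordinatized by `ℤ × ℤ`. -/
abbrev Site : Type := ℤ × ℤ

/-- The embedding `(x, y) ↦ x + y·e^{iπ/3}` of the sites into `ℂ`. -/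
def embed (v : Site) : ℂ :=
  (v.1 : ℂ) + (v.2 : ℂ) * Complex.exp (Complex.I * (Real.pi / 3))

/-- The triangular lattice: two sites are adjacent iff their embeddings are at
Euclidean distance `1`. -/
def Tri : SimpleGraph Site where
  Adj u v := dist (embed u) (embed v) = 1
  symm.symm u v h := by
    show dist (embed v) (embed u) = 1
    rwa [dist_comm]
  loopless.irrefl u h := by
    have : dist (embed u) (embed u) = 1 := h
    rw [dist_self] at this; norm_num at this

/-- The subgraph of `G` induced by the vertices of `S` (viewed as a graph on all sites). -/
def restrictGraph (G : SimpleGraph Site) (S : Set Site) : SimpleGraph Site where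
  Adj u v := G.Adj u v ∧ u ∈ S ∧ v ∈ S
  symm.symm u v h := ⟨G.adj_symm h.1, h.2.2, h.2.1⟩
  loopless.irrefl u h := G.loopless.irrefl u h.1

/-- In the standard coupling by i.i.d. uniform labels, `v` is `p`-black iff its
label is at most `p`. -/
def Black (p : ℝ) (ω : Site → ℝ) (v : Site) : Prop := ω v ≤ p

/-- The graph on the `p`-black sites. -/
def blackGraph (p : ℝ) (ω : Site → ℝ) : SimpleGraph Site :=
  restrictGraph Tri {v | Black p ω v}

/-- `u ⟷ v`: `u` and `v` are joined by a path of `p`-black sites. -/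
def Conn (p : ℝ) (ω : Site → ℝ) (u v : Site) : Prop :=
  Black p ω u ∧ Black p ω v ∧ (blackGraph p ω).Reachable u v

/-- `u` and `v` are joined by a `p`-black path staying inside `S`. -/
def ConnIn (p : ℝ) (ω : Site → ℝ) (S : Set Site) (u v : Site) : Prop :=
  u ∈ S ∧ v ∈ S ∧ Black p ω u ∧ Black p ω v ∧
    (restrictGraph (blackGraph p ω) S).Reachable u v

/-- The `p`-black cluster of `v`. -/
def cluster (p : ℝ) (ω : Site → ℝ) (v : Site) : Set Site := {u | Conn p ω v u}

/-- `v ⟷ ∞` : `v` lies in an infinite `p`-black cluster. -/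
def ConnInf (p : ℝ) (ω : Site → ℝ) (v : Site) : Prop :=
  Black p ω v ∧ (cluster p ω v).Infinite

/-- The infinite `p`-black cluster. -/
def Cinf (p : ℝ) (ω : Site → ℝ) : Set Site := {v | ConnInf p ω v}

/-- Inner (vertex) boundary of `S`. -/
def innerBdry (S : Set Site) : Set Site := {v | v ∈ S ∧ ∃ u, u ∉ S ∧ Tri.Adj v u}

/-- Outer (vertex) boundary of `S`. -/
def outBdry (S : Set Site) : Set Site := {v | v ∉ S ∧ ∃ u, u ∈ S ∧ Tri.Adj v u}

/-- The box `B_r` : sites embedded in `[-r, r]²`. -/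
def box (r : ℝ) : Set Site := {v | |(embed v).re| ≤ r ∧ |(embed v).im| ≤ r}

/-- The box `B_r(z)`. -/
def boxAt (r : ℝ) (z : ℂ) : Set Site :=
  {v | |(embed v - z).re| ≤ r ∧ |(embed v - z).im| ≤ r}

/-- The probability (as a real number) of an event under `μ`. -/
def prob (μ : Measure (Site → ℝ)) (E : Set (Site → ℝ)) : ℝ := (μ E).toReal

/-- `μ` is the standard coupling of all the percolation parameters: under `μ` the
labels `(ω v)_{v ∈ Site}` are i.i.d., uniformly distributed on `[0, 1]`. -/
def IsUniformCoupling (μ : Measure (Site → ℝ)) : Prop :=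
  IsProbabilityMeasure μ ∧
  iIndepFun (m := fun _ : Site => (inferInstance : MeasurableSpace ℝ)) (fun v ω => ω v) μ ∧
  ∀ v : Site, μ.map (fun ω => ω v) = volume.restrict (Set.Icc (0 : ℝ) 1)

/-- The critical point of site percolation on the triangular lattice. -/
def pc : ℝ := 1 / 2

/-- `θ(p)`: the density of the infinite `p`-black cluster. -/
def theta (μ : Measure (Site → ℝ)) (p : ℝ) : ℝ := prob μ {ω | ConnInf p ω 0}

/-- Sites embedded in the rectangle `[x₁, x₂] × [y₁, y₂]`. -/
def rectSites (x₁ x₂ y₁ y₂ : ℝ) : Set Site :=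
  {v | (embed v).re ∈ Set.Icc x₁ x₂ ∧ (embed v).im ∈ Set.Icc y₁ y₂}

/-- Horizontal `p`-black crossing of the rectangle `[x₁, x₂] × [y₁, y₂]`
(a `p`-black path in the rectangle joining its two vertical sides). -/
def HCross (p : ℝ) (ω : Site → ℝ) (x₁ x₂ y₁ y₂ : ℝ) : Prop :=
  ∃ u v, ConnIn p ω (rectSites x₁ x₂ y₁ y₂) u v ∧
    (embed u).re ≤ x₁ + 1 ∧ x₂ - 1 ≤ (embed v).re

/-- The characteristic length, as a natural number. -/
def Lnat (μ : Measure (Site → ℝ)) (p : ℝ) : ℕ :=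
  if p < pc then sSup {n : ℕ | (1 : ℝ) / 100 ≤ prob μ {ω | HCross p ω 0 n 0 (2 * n)}}
  else sSup {n : ℕ | (1 : ℝ) / 100 ≤ prob μ {ω | HCross (1 - p) ω 0 n 0 (2 * n)}}

/-- The characteristic length `L(p)`. -/
def charL (μ : Measure (Site → ℝ)) (p : ℝ) : ℝ := (Lnat μ p : ℝ)

/-- `v` is adjacent to the set `S`. -/
def AdjSet (v : Site) (S : Set Site) : Prop := ∃ w ∈ S, Tri.Adj v w

/-- One-arm event: a `p`-black path in `B_n`, from `B_m` (or a neighbour of it)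
to the inner boundary of `B_n`. -/
def ArmEvent (p m n : ℝ) : Set (Site → ℝ) :=
  {ω | ∃ u v, ConnIn p ω (box n) u v ∧ (u ∈ box m ∨ AdjSet u (box m)) ∧
        v ∈ innerBdry (box n)}

/-- `π₁(m, n)`: the critical one-arm probability from scale `m` to scale `n`. -/
def pi1 (μ : Measure (Site → ℝ)) (m n : ℝ) : ℝ := prob μ (ArmEvent pc m n)

/-- `π₁(n) = π₁(0, n)`: the critical one-arm probability from the origin to `∂B_n`. -/
def pi1n (μ : Measure (Site → ℝ)) (n : ℝ) : ℝ := pi1 μ 0 n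

/-- The set removed when defining the hole of the origin: the infinite cluster
together with its outer boundary. -/
def holeCoRegion (p : ℝ) (ω : Site → ℝ) : Set Site := Cinf p ω ∪ outBdry (Cinf p ω)

/-- The hole `H(p)` of the origin in the infinite `p`-black cluster. -/
def hole (p : ℝ) (ω : Site → ℝ) : Set Site :=
  {u | (0 : Site) ∉ holeCoRegion p ω ∧ u ∉ holeCoRegion p ω ∧
       (restrictGraph Tri (holeCoRegion p ω)ᶜ).Reachable 0 u}

/-- `S` induces a connected subgraph of the triangular lattice. -/
def ConnectedOn (S : Set Site) : Prop :=
  ∀ u ∈ S, ∀ v ∈ S, (restrictGraph Tri S).Reachable u v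

/-- A finite simply connected domain: both `Λ` and its complement induce
connected subgraphs. -/
def SCDomain (Λ : Set Site) : Prop :=
  Λ.Finite ∧ ConnectedOn Λ ∧ ConnectedOn Λᶜ

/-- `𝒞_Λ(p)`: the `p`-black vertices joined to the inner boundary of `Λ`
by `p`-black paths inside `Λ`. -/
def domCluster (p : ℝ) (ω : Site → ℝ) (Λ : Set Site) : Set Site :=
  {v | ∃ w, w ∈ innerBdry Λ ∧ ConnIn p ω Λ v w}

/-- The set removed when defining `H^{(Λ)}(p)`. -/
def removedIn (p : ℝ) (ω : Site → ℝ) (Λ : Set Site) : Set Site :=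
  innerBdry Λ ∪ domCluster p ω Λ ∪ outBdry (domCluster p ω Λ)

/-- `H^{(Λ)}(p)`: the hole of the origin seen from the domain `Λ`. -/
def holeIn (p : ℝ) (ω : Site → ℝ) (Λ : Set Site) : Set Site :=
  {u | (0 : Site) ∉ removedIn p ω Λ ∧ u ∉ removedIn p ω Λ ∧
       (restrictGraph Tri (removedIn p ω Λ)ᶜ).Reachable 0 u}

/-- The `p`-black cluster of `v` inside `S`. -/
def clusterIn (p : ℝ) (ω : Site → ℝ) (S : Set Site) (v : Site) : Set Site :=
  {u | ConnIn p ω S v u}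

/-- The volume of a largest `p`-black cluster of `S`. -/
def maxClusterVol (p : ℝ) (ω : Site → ℝ) (S : Set Site) : ℕ :=
  sSup {k : ℕ | ∃ v ∈ S, k = (clusterIn p ω S v).ncard}

/-- The volume of a largest `p`-black cluster of `S` contained in the infinite
cluster. -/
def maxClusterVolInf (p : ℝ) (ω : Site → ℝ) (S : Set Site) : ℕ :=
  sSup {k : ℕ | ∃ v ∈ S, ConnInf p ω v ∧ k = (clusterIn p ω S v).ncard}

/-- The volume of a largest `p`-black cluster of `S` not contained in the infinite
cluster. -/
def maxClusterVolFin (p : ℝ) (ω : Site → ℝ) (S : Set Site) : ℕ :=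
  sSup {k : ℕ | ∃ v ∈ S, Black p ω v ∧ ¬ ConnInf p ω v ∧ k = (clusterIn p ω S v).ncard}

/-- `𝒱_n`: the number of sites of `B_n` joined to `∂B_{2n}` by a `p`-black path. -/
def VolConn (p n : ℝ) (ω : Site → ℝ) : ℕ :=
  ({v | v ∈ box n ∧ ∃ w, w ∈ innerBdry (box (2 * n)) ∧ Conn p ω v w}).ncard

set_option linter.all false

/-! ### Part 1: lattice paths and the game of Y -/

/-- Explicit adjacency of the triangular lattice. -/
def adj (u v : Site) : Prop :=
  (v.1 = u.1 + 1 ∧ v.2 = u.2) ∨ (v.1 = u.1 - 1 ∧ v.2 = u.2) ∨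
  (v.1 = u.1 ∧ v.2 = u.2 + 1) ∨ (v.1 = u.1 ∧ v.2 = u.2 - 1) ∨
  (v.1 = u.1 + 1 ∧ v.2 = u.2 - 1) ∨ (v.1 = u.1 - 1 ∧ v.2 = u.2 + 1)

theorem adj.symm {u v : Site} (h : adj u v) : adj v u := by
  unfold adj at *; omega

/-- `u` and `v` are joined by a path inside `S`. -/
def Cn (S : Set Site) (u v : Site) : Prop :=
  u ∈ S ∧ Relation.ReflTransGen (fun a b => adj a b ∧ b ∈ S) u v

theorem Cn.refl {S : Set Site} {u : Site} (h : u ∈ S) : Cn S u u := ⟨h, .refl⟩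

theorem Cn.left {S : Set Site} {u v : Site} (h : Cn S u v) : u ∈ S := h.1

theorem Cn.right {S : Set Site} {u v : Site} (h : Cn S u v) : v ∈ S := by
  rcases h with ⟨h1, h2⟩
  cases h2 with
  | refl => exact h1
  | tail _ h => exact h.2

theorem Cn.trans {S : Set Site} {u v w : Site} (h : Cn S u v) (h' : Cn S v w) : Cn S u w :=
  ⟨h.1, h.2.trans h'.2⟩

theorem Cn.edge {S : Set Site} {u v : Site} (h : adj u v) (hu : u ∈ S) (hv : v ∈ S) :
    Cn S u v := ⟨hu, .single ⟨h, hv⟩⟩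

theorem Cn.tail {S : Set Site} {u v w : Site} (h : Cn S u v) (h' : adj v w) (hw : w ∈ S) :
    Cn S u w := h.trans (.edge h' h.right hw)

theorem Cn.head {S : Set Site} {u v w : Site} (h' : adj u v) (hu : u ∈ S) (h : Cn S v w) :
    Cn S u w := (Cn.edge h' hu h.left).trans h

/-- Induction principle for paths. -/
theorem Cn.ind {S : Set Site} {u : Site} {Q : Site → Prop} (h0 : u ∈ S → Q u)
    (h1 : ∀ a b, Cn S u a → Q a → adj a b → b ∈ S → Q b) {v : Site} (h : Cn S u v) : Q v := by
  rcases h with ⟨hu, h⟩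
  induction h with
  | refl => exact h0 hu
  | tail hab hbc ih => exact h1 _ _ ⟨hu, hab⟩ ih hbc.1 hbc.2

theorem Cn.symm {S : Set Site} {u v : Site} (h : Cn S u v) : Cn S v u :=
  Cn.ind (Q := fun v => Cn S v u) (fun h => .refl h)
    (fun _ _ _ ih hab hb => .head hab.symm hb ih) h

theorem Cn.mono {S T : Set Site} (hST : S ⊆ T) {u v : Site} (h : Cn S u v) : Cn T u v :=
  Cn.ind (Q := fun v => Cn T u v) (fun h => .refl (hST h))
    (fun _ _ _ ih hab hb => .tail ih hab (hST hb)) h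

/-- The path may be restricted to the points connected to its start. -/
theorem Cn.self {S : Set Site} {u v : Site} (h : Cn S u v) : Cn {w | Cn S u w} u v :=
  Cn.ind (Q := fun v => Cn {w | Cn S u w} u v) (fun h => .refl (.refl h))
    (fun _ _ ha ih hab hb => .tail ih hab (ha.tail hab hb)) h

theorem Cn.first_exit {S : Set Site} (T : Set Site) {u v : Site} (h : Cn S u v) (hu : u ∈ T)
    (hv : v ∉ T) :
    ∃ a b, Cn (S ∩ T) u a ∧ adj a b ∧ b ∈ S ∧ b ∉ T ∧ Cn S b v := by
  have key : ∀ v, Cn S u v → Cn (S ∩ T) u v ∨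
      ∃ a b, Cn (S ∩ T) u a ∧ adj a b ∧ b ∈ S ∧ b ∉ T ∧ Cn S b v := by
    intro v hv
    refine Cn.ind (Q := fun v => Cn (S ∩ T) u v ∨
      ∃ a b, Cn (S ∩ T) u a ∧ adj a b ∧ b ∈ S ∧ b ∉ T ∧ Cn S b v) ?_ ?_ hv
    · intro h; exact Or.inl (.refl ⟨h, hu⟩)
    · rintro a b ha (ih | ⟨c, d, h1, h2, h3, h4, h5⟩) hab hb
      · by_cases hbT : b ∈ T
        · exact Or.inl (ih.tail hab ⟨hb, hbT⟩)
        · exact Or.inr ⟨a, b, ih, hab, hb, hbT, .refl hb⟩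
      · exact Or.inr ⟨c, d, h1, h2, h3, h4, h5.tail hab hb⟩
  rcases key v h with h' | h'
  · exact absurd h'.right.2 hv
  · exact h'

theorem Cn.last_exit {S : Set Site} (T : Set Site) {u v : Site} (h : Cn S u v) (hu : u ∈ T)
    (hv : v ∉ T) :
    ∃ a b, Cn S u a ∧ a ∈ T ∧ adj a b ∧ Cn (S \ T) b v := by
  obtain ⟨a, b, h1, h2, h3, h4, h5⟩ := h.symm.first_exit Tᶜ hv (by simpa using hu)
  exact ⟨b, a, h5.symm, by simpa using h4, h2.symm, h1.symm⟩

/-- Extraction of the part of a path between two levels of a Lipschitz function. -/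
theorem Cn.seg {S : Set Site} {u v : Site} (h : Cn S u v) (f : Site → ℤ) (K lo hi : ℤ)
    (hK : ∀ a b, adj a b → f b ≤ f a + K) (hK0 : 1 ≤ K)
    (hlo : f u ≤ lo) (hhi : hi ≤ f v) (hlh : lo < hi) :
    ∃ a b, f a ≤ lo ∧ hi ≤ f b ∧ Cn S u a ∧
      Cn (S ∩ {w | lo - K + 1 ≤ f w ∧ f w ≤ hi + K - 1}) a b := by
  obtain ⟨a', b, h1, h2, h3, h4, -⟩ := h.first_exit {w | f w < hi}
    (by simp only [Set.mem_ofPred_eq]; omega) (by simp only [Set.mem_ofPred_eq]; omega)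
  have ha' : f a' < hi := h1.right.2
  have hb : hi ≤ f b := by simpa using h4
  have hb' := hK _ _ h2
  have h5 : Cn (S ∩ {w | f w ≤ hi + K - 1}) u b := by
    refine Cn.tail (h1.mono ?_) h2 ⟨h3, by simp only [Set.mem_ofPred_eq]; omega⟩
    rintro w ⟨hw, hw'⟩
    simp only [Set.mem_ofPred_eq] at hw'
    exact ⟨hw, by simp only [Set.mem_ofPred_eq]; omega⟩
  obtain ⟨a, c, h6, h7, h8, h9⟩ := h5.last_exit {w | f w ≤ lo} hlo
    (by simp only [Set.mem_ofPred_eq]; omega)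
  have hc : lo < f c := by simpa using h9.left.2
  have hc' := hK _ _ h8
  refine ⟨a, b, h7, hb, h6.mono Set.inter_subset_left, Cn.head h8 ⟨h6.right.1, ?_, ?_⟩ (h9.mono ?_)⟩
  · omega
  · exact h6.right.2
  · rintro w ⟨⟨hw, hw'⟩, hw''⟩
    simp only [Set.mem_ofPred_eq] at hw' hw''
    exact ⟨hw, by omega, hw'⟩

theorem Cn.map {S T : Set Site} (τ : Site → Site) (hτ : ∀ a b, adj a b → adj (τ a) (τ b))
    (hS : ∀ a ∈ S, τ a ∈ T) {u v : Site} (h : Cn S u v) : Cn T (τ u) (τ v) :=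
  Cn.ind (Q := fun v => Cn T (τ u) (τ v)) (fun h => .refl (hS _ h))
    (fun _ _ _ ih hab hb => .tail ih (hτ _ _ hab) (hS _ hb)) h

/-- The triangular board of the game of Y. -/
def TT (n : ℤ) : Set Site := {v | 0 ≤ v.1 ∧ 0 ≤ v.2 ∧ v.1 + v.2 ≤ n}

/-- `B` wins the game of Y on the board `TT n`. -/
def Ywin (n : ℤ) (B : Set Site) : Prop :=
  ∃ a b c : Site, a.1 = 0 ∧ b.2 = 0 ∧ c.1 + c.2 = n ∧ Cn (B ∩ TT n) a b ∧ Cn (B ∩ TT n) a c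

theorem Ywin.mono {n : ℤ} {B B' : Set Site} (h : B ∩ TT n ⊆ B') (hB : Ywin n B) : Ywin n B' := by
  obtain ⟨a, b, c, h1, h2, h3, h4, h5⟩ := hB
  have : B ∩ TT n ⊆ B' ∩ TT n := fun v hv => ⟨h hv, hv.2⟩
  exact ⟨a, b, c, h1, h2, h3, h4.mono this, h5.mono this⟩

/-- The majority reduction. -/
def red (B : Set Site) : Set Site :=
  {v | (v ∈ B ∧ (v.1 + 1, v.2) ∈ B) ∨ (v ∈ B ∧ (v.1, v.2 + 1) ∈ B) ∨
    ((v.1 + 1, v.2) ∈ B ∧ (v.1, v.2 + 1) ∈ B)}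

theorem red_compl (B : Set Site) : red Bᶜ = (red B)ᶜ := by
  ext v; simp only [red, Set.mem_ofPred_eq, Set.mem_compl_iff]; tauto

/-- `a` is a corner of the upward triangle at `v`. -/
def cor (v a : Site) : Prop := a = v ∨ a = (v.1 + 1, v.2) ∨ a = (v.1, v.2 + 1)

theorem cor_adj {v a b : Site} (ha : cor v a) (hb : cor v b) : a = b ∨ adj a b := by
  obtain ⟨v1, v2⟩ := v
  obtain ⟨a1, a2⟩ := a
  obtain ⟨b1, b2⟩ := b
  simp only [cor, Prod.mk.injEq, adj] at *
  omega

theorem cor_TT {n : ℤ} {v a : Site} (hv : v ∈ TT (n - 1)) (ha : cor v a) : a ∈ TT n := by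
  obtain ⟨v1, v2⟩ := v
  obtain ⟨a1, a2⟩ := a
  simp only [cor, Prod.mk.injEq, TT, Set.mem_ofPred_eq] at *
  omega

theorem cor_conn {n : ℤ} {B : Set Site} {v a b : Site} (hv : v ∈ TT (n - 1))
    (ha : cor v a) (hb : cor v b) (haB : a ∈ B) (hbB : b ∈ B) : Cn (B ∩ TT n) a b := by
  rcases cor_adj ha hb with rfl | h
  · exact .refl ⟨haB, cor_TT hv ha⟩
  · exact .edge h ⟨haB, cor_TT hv ha⟩ ⟨hbB, cor_TT hv hb⟩

/-- Two adjacent reduced cells of the same colour are linked. -/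
theorem red_link {B : Set Site} {v w : Site} (hv : v ∈ red B) (hw : w ∈ red B) (h : adj v w) :
    ∃ a b, cor v a ∧ cor w b ∧ a ∈ B ∧ b ∈ B ∧ (a = b ∨ adj a b) := by
  have main : ∀ v w : Site, v ∈ red B → w ∈ red B →
      ((w.1 = v.1 + 1 ∧ w.2 = v.2) ∨ (w.1 = v.1 ∧ w.2 = v.2 + 1) ∨
        (w.1 = v.1 + 1 ∧ w.2 = v.2 - 1)) →
      ∃ a b, cor v a ∧ cor w b ∧ a ∈ B ∧ b ∈ B ∧ (a = b ∨ adj a b) := by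
    rintro ⟨v1, v2⟩ ⟨w1, w2⟩ hv hw h
    simp only at h
    have hc : ∃ x : Site, cor (v1, v2) x ∧ cor (w1, w2) x ∧
        ∃ y z : Site, cor (v1, v2) y ∧ cor (w1, w2) z ∧ adj y z ∧
          (x ∉ B → y ∈ B ∧ z ∈ B) := by
      rcases h with ⟨rfl, rfl⟩ | ⟨rfl, rfl⟩ | ⟨rfl, rfl⟩
      · refine ⟨(v1 + 1, w2), by simp [cor], by simp [cor], (v1, w2 + 1), (v1 + 1, w2 + 1),
          by simp [cor], by simp [cor], by simp [adj], ?_⟩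
        simp only [red, Set.mem_ofPred_eq] at hv hw
        tauto
      · refine ⟨(w1, v2 + 1), by simp [cor], by simp [cor], (w1 + 1, v2), (w1 + 1, v2 + 1),
          by simp [cor], by simp [cor], by simp [adj], ?_⟩
        simp only [red, Set.mem_ofPred_eq] at hv hw
        tauto
      · refine ⟨(v1 + 1, v2), by simp [cor], by simp [cor], (v1, v2), (v1 + 1, v2 - 1),
          by simp [cor], by simp [cor], by simp [adj], ?_⟩
        simp only [red, Set.mem_ofPred_eq, sub_add_cancel] at hv hw
        tauto
    obtain ⟨x, hx1, hx2, y, z, hy, hz, hyz, hB⟩ := hc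
    by_cases hx : x ∈ B
    · exact ⟨x, x, hx1, hx2, hx, hx, Or.inl rfl⟩
    · exact ⟨y, z, hy, hz, (hB hx).1, (hB hx).2, Or.inr hyz⟩
  have hor : ((w.1 = v.1 + 1 ∧ w.2 = v.2) ∨ (w.1 = v.1 ∧ w.2 = v.2 + 1) ∨
        (w.1 = v.1 + 1 ∧ w.2 = v.2 - 1)) ∨ ((v.1 = w.1 + 1 ∧ v.2 = w.2) ∨
        (v.1 = w.1 ∧ v.2 = w.2 + 1) ∨ (v.1 = w.1 + 1 ∧ v.2 = w.2 - 1)) := by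
    unfold adj at h; omega
  rcases hor with h' | h'
  · exact main v w hv hw h'
  · obtain ⟨a, b, h1, h2, h3, h4, h5⟩ := main w v hw hv h'
    refine ⟨b, a, h2, h1, h4, h3, ?_⟩
    rcases h5 with rfl | h5
    · exact Or.inl rfl
    · exact Or.inr h5.symm

theorem red_path {n : ℤ} {B : Set Site} {v w : Site} (h : Cn (red B ∩ TT (n - 1)) v w) :
    ∀ a b, cor v a → a ∈ B → cor w b → b ∈ B → Cn (B ∩ TT n) a b := by
  refine Cn.ind (Q := fun w => ∀ a b, cor v a → a ∈ B → cor w b → b ∈ B → Cn (B ∩ TT n) a b)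
    ?_ ?_ h
  · intro hv a b ha haB hb hbB
    exact cor_conn hv.2 ha hb haB hbB
  · intro x y hx ih hxy hy a b ha haB hb hbB
    obtain ⟨c, d, hc, hd, hcB, hdB, hcd⟩ := red_link hx.right.1 hy.1 hxy
    have h1 := ih a c ha haB hc hcB
    have h2 := cor_conn hy.2 hd hb hdB hbB
    rcases hcd with rfl | hcd
    · exact h1.trans h2
    · exact (h1.tail hcd h2.left).trans h2

theorem Ywin_of_red {n : ℤ} {B : Set Site} (h : Ywin (n - 1) (red B)) : Ywin n B := by
  obtain ⟨⟨a1, a2⟩, ⟨b1, b2⟩, ⟨c1, c2⟩, ha, hb, hc, hab, hac⟩ := h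
  simp only at ha hb hc
  have e1 : ∃ a, cor (a1, a2) a ∧ a ∈ B ∧ a.1 = 0 := by
    have := hab.left.1
    simp only [red, Set.mem_ofPred_eq] at this
    have : (a1, a2) ∈ B ∨ (a1, a2 + 1) ∈ B := by tauto
    rcases this with h | h
    · exact ⟨_, by simp [cor], h, ha⟩
    · exact ⟨_, by simp [cor], h, ha⟩
  have e2 : ∃ a, cor (b1, b2) a ∧ a ∈ B ∧ a.2 = 0 := by
    have := hab.right.1
    simp only [red, Set.mem_ofPred_eq] at this
    have : (b1, b2) ∈ B ∨ (b1 + 1, b2) ∈ B := by tauto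
    rcases this with h | h
    · exact ⟨_, by simp [cor], h, hb⟩
    · exact ⟨_, by simp [cor], h, hb⟩
  have e3 : ∃ a, cor (c1, c2) a ∧ a ∈ B ∧ a.1 + a.2 = n := by
    have := hac.right.1
    simp only [red, Set.mem_ofPred_eq] at this
    have : (c1, c2 + 1) ∈ B ∨ (c1 + 1, c2) ∈ B := by tauto
    rcases this with h | h
    · exact ⟨_, by simp [cor], h, by simp only; omega⟩
    · exact ⟨_, by simp [cor], h, by simp only; omega⟩
  obtain ⟨a, h1, h2, h3⟩ := e1
  obtain ⟨b, h4, h5, h6⟩ := e2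
  obtain ⟨c, h7, h8, h9⟩ := e3
  exact ⟨a, b, c, h3, h6, h9, red_path hab a b h1 h2 h4 h5, red_path hac a c h1 h2 h7 h8⟩

/-- The cell associated with an edge of the board. -/
theorem edge_cell {n : ℤ} {B : Set Site} {a b : Site} (h : adj a b) (ha : a ∈ B ∩ TT n)
    (hb : b ∈ B ∩ TT n) : ∃ v, v ∈ red B ∩ TT (n - 1) ∧ cor v a ∧ cor v b := by
  obtain ⟨a1, a2⟩ := a
  obtain ⟨b1, b2⟩ := b
  obtain ⟨haB, ha⟩ := ha
  obtain ⟨hbB, hb⟩ := hb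
  simp only [TT, Set.mem_ofPred_eq, adj] at ha hb h
  rcases h with ⟨rfl, rfl⟩ | ⟨rfl, rfl⟩ | ⟨rfl, rfl⟩ | ⟨rfl, rfl⟩ | ⟨rfl, rfl⟩ | ⟨rfl, rfl⟩
  · refine ⟨(a1, b2), ⟨by simp [red, haB, hbB], ?_⟩, by simp [cor], by simp [cor]⟩
    simp only [TT, Set.mem_ofPred_eq]; omega
  · refine ⟨(a1 - 1, b2), ⟨by simp [red, haB, hbB], ?_⟩, by simp [cor], by simp [cor]⟩
    simp only [TT, Set.mem_ofPred_eq]; omega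
  · refine ⟨(b1, a2), ⟨by simp [red, haB, hbB], ?_⟩, by simp [cor], by simp [cor]⟩
    simp only [TT, Set.mem_ofPred_eq]; omega
  · refine ⟨(b1, a2 - 1), ⟨by simp [red, haB, hbB], ?_⟩, by simp [cor], by simp [cor]⟩
    simp only [TT, Set.mem_ofPred_eq]; omega
  · refine ⟨(a1, a2 - 1), ⟨by simp [red, haB, hbB], ?_⟩, by simp [cor], by simp [cor]⟩
    simp only [TT, Set.mem_ofPred_eq]; omega
  · refine ⟨(a1 - 1, a2), ⟨by simp [red, haB, hbB], ?_⟩, by simp [cor], by simp [cor]⟩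
    simp only [TT, Set.mem_ofPred_eq]; omega

theorem cell_adj {v w a : Site} (hv : cor v a) (hw : cor w a) : v = w ∨ adj v w := by
  obtain ⟨v1, v2⟩ := v
  obtain ⟨w1, w2⟩ := w
  obtain ⟨a1, a2⟩ := a
  simp only [cor, Prod.mk.injEq, adj] at *
  omega

theorem path_red {n : ℤ} {B : Set Site} {a b v : Site} (h : Cn (B ∩ TT n) a b)
    (hv : v ∈ red B ∩ TT (n - 1)) (hva : cor v a) :
    ∃ w, Cn (red B ∩ TT (n - 1)) v w ∧ cor w b := by
  refine Cn.ind (Q := fun b => ∃ w, Cn (red B ∩ TT (n - 1)) v w ∧ cor w b) ?_ ?_ h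
  · intro _; exact ⟨v, .refl hv, hva⟩
  · rintro c d hc ⟨w, hw, hwc⟩ hcd hd
    obtain ⟨x, hx, hxc, hxd⟩ := edge_cell hcd hc.right hd
    rcases cell_adj hwc hxc with rfl | h'
    · exact ⟨w, hw, hxd⟩
    · exact ⟨x, hw.tail h' hx, hxd⟩

theorem red_of_Ywin {n : ℤ} (hn : 1 ≤ n) {B : Set Site} (h : Ywin n B) :
    Ywin (n - 1) (red B) := by
  obtain ⟨a, b, c, ha, hb, hc, hab, hac⟩ := h
  -- `a` has a neighbour on the winning chain
  have : ∃ a', adj a a' ∧ a' ∈ B ∩ TT n := by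
    have hne : a ≠ b ∨ a ≠ c := by
      by_contra hh
      push Not at hh
      obtain ⟨h1, h2⟩ := hh
      rw [← h1] at hb; rw [← h2] at hc; omega
    have aux : ∀ x, a ≠ x → Cn (B ∩ TT n) a x → ∃ a', adj a a' ∧ a' ∈ B ∩ TT n := by
      intro x hx h
      obtain ⟨p, q, h1, h2, h3, -⟩ := h.first_exit {a} rfl (by simpa using hx.symm)
      have := h1.right.2
      simp only [Set.mem_singleton_iff] at this
      exact ⟨q, this ▸ h2, h3⟩
    rcases hne with h | h
    · exact aux _ h hab
    · exact aux _ h hac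
  obtain ⟨a', haa', ha'⟩ := this
  obtain ⟨v, hv, hva, -⟩ := edge_cell haa' hab.left ha'
  obtain ⟨w, hw, hwb⟩ := path_red hab hv hva
  obtain ⟨x, hx, hxc⟩ := path_red hac hv hva
  refine ⟨v, w, x, ?_, ?_, ?_, hw, hx⟩
  · have := hv.2
    obtain ⟨a1, a2⟩ := a
    obtain ⟨v1, v2⟩ := v
    simp only [cor, Prod.mk.injEq, TT, Set.mem_ofPred_eq] at *
    omega
  · have := hw.right.2
    obtain ⟨a1, a2⟩ := b
    obtain ⟨v1, v2⟩ := w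
    simp only [cor, Prod.mk.injEq, TT, Set.mem_ofPred_eq] at *
    omega
  · have := hx.right.2
    obtain ⟨a1, a2⟩ := c
    obtain ⟨v1, v2⟩ := x
    simp only [cor, Prod.mk.injEq, TT, Set.mem_ofPred_eq] at *
    omega

/-- The game of Y has exactly one winner. -/
theorem Y_exists (n : ℕ) (B : Set Site) : Ywin n B ∨ Ywin n Bᶜ := by
  induction n generalizing B with
  | zero =>
    have h0 : ((0, 0) : Site) ∈ TT 0 := by simp [TT]
    by_cases h : ((0, 0) : Site) ∈ B
    · exact Or.inl ⟨(0, 0), (0, 0), (0, 0), rfl, rfl, by simp, .refl ⟨h, h0⟩, .refl ⟨h, h0⟩⟩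
    · exact Or.inr ⟨(0, 0), (0, 0), (0, 0), rfl, rfl, by simp, .refl ⟨h, h0⟩, .refl ⟨h, h0⟩⟩
  | succ n ih =>
    have e : (((n + 1 : ℕ) : ℤ)) - 1 = (n : ℤ) := by push_cast; ring
    rcases ih (red B) with h | h
    · left; apply Ywin_of_red; rwa [e]
    · right; apply Ywin_of_red; rwa [e, red_compl]

theorem Y_unique (n : ℕ) (B : Set Site) (h1 : Ywin n B) (h2 : Ywin n Bᶜ) : False := by
  induction n generalizing B with
  | zero =>
    obtain ⟨a, b, c, ha, hb, hc, hab, hac⟩ := h1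
    obtain ⟨a', b', c', ha', hb', hc', hab', hac'⟩ := h2
    have e1 : a = (0, 0) := by
      have := hab.left.2
      obtain ⟨a1, a2⟩ := a
      simp only [TT, Set.mem_ofPred_eq, Nat.cast_zero, Prod.mk.injEq] at *
      omega
    have e2 : a' = (0, 0) := by
      have := hab'.left.2
      obtain ⟨a1, a2⟩ := a'
      simp only [TT, Set.mem_ofPred_eq, Nat.cast_zero, Prod.mk.injEq] at *
      omega
    have h3 := hab.left.1
    have h4 := hab'.left.1
    rw [e1] at h3; rw [e2] at h4
    exact h4 h3
  | succ n ih =>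
    have e : (((n + 1 : ℕ) : ℤ)) - 1 = (n : ℤ) := by push_cast; ring
    have h3 := red_of_Ywin (by push_cast; omega) h1
    have h4 := red_of_Ywin (by push_cast; omega) h2
    rw [e] at h3 h4
    rw [red_compl] at h4
    exact ih _ h3 h4

/-- Two disjoint sets cannot both win. -/
theorem Y_disjoint {n : ℤ} (hn : 0 ≤ n) {B W : Set Site} (h1 : Ywin n B) (h2 : Ywin n W)
    (h : ∀ v ∈ TT n, v ∈ B → v ∈ W → False) : False := by
  obtain ⟨m, rfl⟩ := Int.eq_ofNat_of_zero_le hn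
  exact Y_unique m B h1 (h2.mono fun v hv hvB => h v hv.2 hvB hv.1)

/-! ### Part 2: probability toolkit -/

/-- The set of `p`-black sites. -/
def bl (p : ℝ) (ω : Site → ℝ) : Set Site := {v | ω v ≤ p}

/-- Probability of an event of site configurations. -/
def Pr (μ : Measure (Site → ℝ)) (p : ℝ) (E : Set (Set Site)) : ℝ := μ.real {ω | bl p ω ∈ E}

/-- `E` depends only on the sites of `A`. -/
def Loc (A : Set Site) (E : Set (Set Site)) : Prop :=
  ∀ S S' : Set Site, S ∩ A = S' ∩ A → S ∈ E → S' ∈ E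

theorem Loc.mono {A B : Set Site} {E : Set (Set Site)} (h : Loc A E) (hAB : A ⊆ B) : Loc B E := by
  intro S S' hS hE
  refine h S S' ?_ hE
  have := congrArg (· ∩ A) hS
  simpa [Set.inter_assoc, Set.inter_eq_self_of_subset_right hAB] using this

theorem Loc.compl {A : Set Site} {E : Set (Set Site)} (h : Loc A E) : Loc A Eᶜ := by
  intro S S' hS hE hE'
  exact hE (h S' S hS.symm hE')

theorem Loc.inter {A : Set Site} {E F : Set (Set Site)} (h : Loc A E) (h' : Loc A F) :
    Loc A (E ∩ F) := fun S S' hS hE => ⟨h S S' hS hE.1, h' S S' hS hE.2⟩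

theorem Loc.union {A : Set Site} {E F : Set (Set Site)} (h : Loc A E) (h' : Loc A F) :
    Loc A (E ∪ F) := fun S S' hS hE => hE.imp (h S S' hS) (h' S S' hS)

theorem Loc.of_inter {A D : Set Site} (hD : D ⊆ A) (Q : Set Site → Prop) :
    Loc A {S | Q (S ∩ D)} := by
  refine Loc.mono (A := D) ?_ hD
  intro S S' hS hE
  rw [Set.mem_ofPred_eq] at *
  rwa [← hS]

theorem Loc.of_diff {A D : Set Site} (hD : D ⊆ A) (Q : Set Site → Prop) :
    Loc A {S | Q (D \ S)} := by
  refine Loc.mono (A := D) ?_ hD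
  intro S S' hS hE
  rw [Set.mem_ofPred_eq] at *
  have : D \ S = D \ S' := by
    rw [← Set.sdiff_inter_self_eq_sdiff, hS, Set.sdiff_inter_self_eq_sdiff]
  rwa [← this]

theorem Pr_nonneg (μ : Measure (Site → ℝ)) (p : ℝ) (E : Set (Set Site)) : 0 ≤ Pr μ p E :=
  measureReal_nonneg

theorem Pr_le_one {μ : Measure (Site → ℝ)} (hμ : IsUniformCoupling μ)
    (p : ℝ) (E : Set (Set Site)) : Pr μ p E ≤ 1 := by
  have := hμ.1
  exact measureReal_le_one

theorem Pr_mono {μ : Measure (Site → ℝ)} (hμ : IsUniformCoupling μ)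
    {p : ℝ} {E F : Set (Set Site)} (h : E ⊆ F) : Pr μ p E ≤ Pr μ p F := by
  have := hμ.1
  exact measureReal_mono (fun ω hω => h hω)

theorem Pr_mono_p {μ : Measure (Site → ℝ)} (hμ : IsUniformCoupling μ)
    {p q : ℝ} (hpq : p ≤ q) {E : Set (Set Site)} (hE : IsUpperSet E) :
    Pr μ p E ≤ Pr μ q E := by
  have := hμ.1
  exact measureReal_mono (fun ω hω => hE (fun v (hv : ω v ≤ p) => hv.trans hpq) hω)

theorem Pr_union_le {μ : Measure (Site → ℝ)} (hμ : IsUniformCoupling μ)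
    (p : ℝ) (E F : Set (Set Site)) : Pr μ p (E ∪ F) ≤ Pr μ p E + Pr μ p F := by
  have := hμ.1
  exact measureReal_union_le {ω | bl p ω ∈ E} {ω | bl p ω ∈ F}

theorem Pr_biUnion_le {μ : Measure (Site → ℝ)} (hμ : IsUniformCoupling μ)
    {ι : Type*} (p : ℝ) (s : Finset ι) (E : ι → Set (Set Site)) :
    Pr μ p {S | ∃ i ∈ s, S ∈ E i} ≤ ∑ i ∈ s, Pr μ p (E i) := by
  have := hμ.1
  have := measureReal_biUnion_finset_le (μ := μ) s (fun i => {ω | bl p ω ∈ E i})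
  refine le_trans (le_of_eq ?_) this
  unfold Pr; congr 1; ext ω; simp

theorem Pr_univ {μ : Measure (Site → ℝ)} (hμ : IsUniformCoupling μ)
    (p : ℝ) : Pr μ p Set.univ = 1 := by
  have := hμ.1
  simp [Pr]

/-- The restriction of the configuration to a finite set. -/
def cfg (A : Finset Site) (p : ℝ) (ω : Site → ℝ) : A → Bool := fun i => decide (ω i ≤ p)

/-- Embedding of finite configurations. -/
def emb (A : Finset Site) (b : A → Bool) : Set Site := {v | ∃ h : v ∈ A, b ⟨v, h⟩ = true}

theorem cfg_iff {A : Finset Site} {E : Set (Set Site)} (h : Loc A E) (p : ℝ) (ω : Site → ℝ) :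
    bl p ω ∈ E ↔ emb A (cfg A p ω) ∈ E := by
  have : bl p ω ∩ A = emb A (cfg A p ω) ∩ A := by
    ext v; simp only [bl, emb, cfg, Set.mem_inter_iff, Set.mem_ofPred_eq, Finset.mem_coe,
      decide_eq_true_eq, exists_prop]; tauto
  exact ⟨h _ _ this, h _ _ this.symm⟩

theorem cfg_meas (A : Finset Site) (p : ℝ) : Measurable (cfg A p) := by
  refine measurable_pi_lambda _ (fun i => ?_)
  refine measurable_to_bool ?_
  have : (fun ω : Site → ℝ => cfg A p ω i) ⁻¹' {true} = {ω | ω i ≤ p} := by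
    ext ω; simp [cfg]
  rw [this]
  exact measurableSet_le (measurable_pi_apply _) measurable_const

theorem Loc.meas {A : Finset Site} {E : Set (Set Site)} (h : Loc A E) (p : ℝ) :
    MeasurableSet {ω | bl p ω ∈ E} := by
  have : {ω | bl p ω ∈ E} = cfg A p ⁻¹' {b | emb A b ∈ E} := by
    ext ω; exact cfg_iff h p ω
  rw [this]
  exact cfg_meas A p (Set.Finite.measurableSet (Set.toFinite _))

theorem Pr_compl {μ : Measure (Site → ℝ)} (hμ : IsUniformCoupling μ)
    {A : Finset Site} {E : Set (Set Site)} (h : Loc A E) (p : ℝ) :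
    Pr μ p Eᶜ = 1 - Pr μ p E := by
  have := hμ.1
  exact probReal_compl_eq_one_sub (h.meas p)

/-- Weight of a finite configuration. -/
def wt (A : Finset Site) (p : ℝ) (b : A → Bool) : ℝ := ∏ i, if b i then p else 1 - p

theorem mu_site {μ : Measure (Site → ℝ)} (hμ : IsUniformCoupling μ)
    {p : ℝ} (hp : 0 ≤ p) (hp1 : p ≤ 1) (v : Site) :
    μ.real {ω | ω v ≤ p} = p := by
  have h := hμ.2.2 v
  have h1 : μ {ω | ω v ≤ p} = μ.map (fun ω => ω v) (Set.Iic p) := by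
    rw [Measure.map_apply (measurable_pi_apply v) measurableSet_Iic]; rfl
  rw [measureReal_def, h1, h, Measure.restrict_apply measurableSet_Iic]
  have : Set.Iic p ∩ Set.Icc (0:ℝ) 1 = Set.Icc 0 p := by
    ext x; simp only [Set.mem_inter_iff, Set.mem_Iic, Set.mem_Icc]
    constructor
    · rintro ⟨h1, h2, h3⟩; exact ⟨h2, h1⟩
    · rintro ⟨h1, h2⟩; exact ⟨h2, h1, h2.trans hp1⟩
  rw [this, Real.volume_Icc, sub_zero, ENNReal.toReal_ofReal hp]

theorem mu_cfg {μ : Measure (Site → ℝ)} (hμ : IsUniformCoupling μ)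
    {p : ℝ} (hp : 0 ≤ p) (hp1 : p ≤ 1) (A : Finset Site) (b : A → Bool) :
    μ.real (cfg A p ⁻¹' {b}) = wt A p b := by
  classical
  have := hμ.1
  have h := hμ.2.1.measure_inter_preimage_eq_mul A
    (sets := fun v => if h : v ∈ A then (if b ⟨v, h⟩ then Set.Iic p else (Set.Iic p)ᶜ) else Set.univ)
    (by
      intro i hi
      simp only [hi, dif_pos]
      split_ifs
      · exact measurableSet_Iic
      · exact measurableSet_Iic.compl)
  have h1 : cfg A p ⁻¹' {b} = ⋂ i ∈ A, (fun ω : Site → ℝ => ω i) ⁻¹'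
      (if h : i ∈ A then (if b ⟨i, h⟩ then Set.Iic p else (Set.Iic p)ᶜ) else Set.univ) := by
    ext ω
    simp only [Set.mem_preimage, Set.mem_singleton_iff, Set.mem_iInter, funext_iff]
    constructor
    · intro H i hi
      have := H ⟨i, hi⟩
      rw [dif_pos hi]
      simp only [cfg] at this
      rw [← this]
      by_cases hh : ω i ≤ p <;> simp [hh]
      exact not_le.mp hh
    · rintro H ⟨i, hi⟩
      have := H i hi
      rw [dif_pos hi] at this
      simp only [cfg]
      by_cases hh : b ⟨i, hi⟩ = true
      · rw [if_pos hh] at this; rw [hh]; simpa using this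
      · rw [if_neg hh] at this
        simp only [Bool.not_eq_true] at hh; rw [hh]; simpa using this
  rw [measureReal_def, h1, h, ENNReal.toReal_prod, wt, ← Finset.prod_attach]
  rw [Finset.univ_eq_attach]
  refine Finset.prod_congr rfl ?_
  rintro ⟨i, hi⟩ -
  simp only [dif_pos hi]
  by_cases hh : b ⟨i, hi⟩ = true
  · rw [if_pos hh, if_pos hh]; exact mu_site hμ hp hp1 i
  · rw [if_neg hh, if_neg hh]
    have h3 : MeasurableSet {ω : Site → ℝ | ω i ≤ p} :=
      measurableSet_le (measurable_pi_apply _) measurable_const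
    have := probReal_compl_eq_one_sub (μ := μ) h3
    rw [mu_site hμ hp hp1 i] at this
    exact this

open Classical in
theorem Pr_eq_sum {μ : Measure (Site → ℝ)} (hμ : IsUniformCoupling μ)
    {p : ℝ} (hp : 0 ≤ p) (hp1 : p ≤ 1) {A : Finset Site} {E : Set (Set Site)}
    (h : Loc A E) :
    Pr μ p E = ∑ b : A → Bool, wt A p b * (if emb A b ∈ E then 1 else 0) := by
  have := hμ.1
  have h1 : {ω | bl p ω ∈ E} = cfg A p ⁻¹' ↑(Finset.univ.filter (fun b => emb A b ∈ E)) := by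
    ext ω; simp only [Set.mem_ofPred_eq, cfg_iff h p ω, Set.mem_preimage, Finset.mem_coe, Finset.mem_filter, Finset.mem_univ, true_and]
  unfold Pr
  rw [h1, ← sum_measureReal_preimage_singleton _
    (fun y _ => cfg_meas A p (Set.Finite.measurableSet (Set.toFinite _)))]
  rw [Finset.sum_filter]
  refine Finset.sum_congr rfl (fun b _ => ?_)
  split_ifs
  · rw [mu_cfg hμ hp hp1, mul_one]
  · simp

theorem Pr_indep {μ : Measure (Site → ℝ)} (hμ : IsUniformCoupling μ)
    {p : ℝ} {A B : Finset Site} (hAB : Disjoint A B)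
    {E F : Set (Set Site)} (hE : Loc A E) (hF : Loc B F) :
    Pr μ p (E ∩ F) = Pr μ p E * Pr μ p F := by
  have h := hμ.2.1.indepFun_finset A B hAB (fun i => measurable_pi_apply i)
  have hm : ∀ C : Finset Site, Measurable (fun (g : C → ℝ) (i : C) => decide (g i ≤ p)) := by
    intro C
    refine measurable_pi_lambda _ (fun i => measurable_to_bool ?_)
    have : (fun ω : C → ℝ => decide (ω i ≤ p)) ⁻¹' {true} = {ω | ω i ≤ p} := by
      ext ω; simp
    rw [this]
    exact measurableSet_le (measurable_pi_apply _) measurable_const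
  have h2 := (h.comp (hm A) (hm B)).measure_inter_preimage_eq_mul {b | emb A b ∈ E}
    {b | emb B b ∈ F} (Set.Finite.measurableSet (Set.toFinite _))
    (Set.Finite.measurableSet (Set.toFinite _))
  have e1 : {ω | bl p ω ∈ E} = cfg A p ⁻¹' {b | emb A b ∈ E} := by
    ext ω; exact cfg_iff hE p ω
  have e2 : {ω | bl p ω ∈ F} = cfg B p ⁻¹' {b | emb B b ∈ F} := by
    ext ω; exact cfg_iff hF p ω
  have e3 : {ω | bl p ω ∈ E ∩ F} = {ω | bl p ω ∈ E} ∩ {ω | bl p ω ∈ F} := rfl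
  unfold Pr
  rw [e3, e1, e2, measureReal_def, measureReal_def, measureReal_def, ← ENNReal.toReal_mul]
  exact congrArg ENNReal.toReal h2

theorem wt_nonneg {p : ℝ} (hp : 0 ≤ p) (hp1 : p ≤ 1) (A : Finset Site) (b : A → Bool) :
    0 ≤ wt A p b := by
  refine Finset.prod_nonneg (fun i _ => ?_)
  split_ifs <;> linarith

theorem Pr_fkg {μ : Measure (Site → ℝ)} (hμ : IsUniformCoupling μ)
    {p : ℝ} (hp : 0 ≤ p) (hp1 : p ≤ 1) {A : Finset Site}
    {E F : Set (Set Site)} (hE : Loc A E) (hF : Loc A F) (uE : IsUpperSet E) (uF : IsUpperSet F) :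
    Pr μ p E * Pr μ p F ≤ Pr μ p (E ∩ F) := by
  classical
  have mono : ∀ G : Set (Set Site), IsUpperSet G →
      Monotone (fun b : A → Bool => if emb A b ∈ G then (1:ℝ) else 0) := by
    intro G hG b c hbc
    dsimp only
    by_cases hb : emb A b ∈ G
    · have : emb A c ∈ G := by
        refine hG ?_ hb
        rintro v ⟨hv, hv'⟩
        refine ⟨hv, ?_⟩
        have := hbc ⟨v, hv⟩
        rw [hv'] at this
        exact top_le_iff.mp this
      simp [hb, this]
    · rw [if_neg hb]; split_ifs <;> norm_num
  have h := fkg (μ := wt A p) (f := fun b => if emb A b ∈ E then (1:ℝ) else 0)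
    (g := fun b => if emb A b ∈ F then (1:ℝ) else 0) (fun b => wt_nonneg hp hp1 A b)
    (fun b => by dsimp only [Pi.zero_apply]; split_ifs <;> norm_num)
    (fun b => by dsimp only [Pi.zero_apply]; split_ifs <;> norm_num)
    (mono E uE) (mono F uF) (by
      intro a b
      unfold wt
      rw [← Finset.prod_mul_distrib, ← Finset.prod_mul_distrib]
      refine le_of_eq (Finset.prod_congr rfl (fun i _ => ?_))
      simp only [Pi.inf_apply, Pi.sup_apply]
      have key : ∀ x y : Bool, ((if x = true then p else 1 - p) * if y = true then p else 1 - p) =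
          (if (x ⊓ y) = true then p else 1 - p) * if (x ⊔ y) = true then p else 1 - p := by
        intro x y; cases x <;> cases y <;> simp [mul_comm]
      exact key (a i) (b i))
  rw [← Pr_eq_sum hμ hp hp1 hE, ← Pr_eq_sum hμ hp hp1 hF] at h
  have h1 : ∑ b : A → Bool, wt A p b = 1 := by
    have := Pr_eq_sum (E := Set.univ) hμ hp hp1 (A := A) (fun _ _ _ _ => trivial)
    rw [Pr_univ hμ] at this
    simpa using this.symm
  rw [h1, one_mul] at h
  refine h.trans (le_of_eq ?_)
  rw [Pr_eq_sum hμ hp hp1 (hE.inter hF)]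
  refine Finset.sum_congr rfl (fun b _ => ?_)
  congr 1
  by_cases h1 : emb A b ∈ E <;> by_cases h2 : emb A b ∈ F <;> simp [h1, h2]

theorem Pr_flip {μ : Measure (Site → ℝ)} (hμ : IsUniformCoupling μ)
    {p : ℝ} (hp : 0 ≤ p) (hp1 : p ≤ 1) {A : Finset Site}
    {E : Set (Set Site)} (hE : Loc A E) : Pr μ p {S | Sᶜ ∈ E} = Pr μ (1 - p) E := by
  classical
  have hE' : Loc A {S | Sᶜ ∈ E} := by
    intro S S' hS h
    refine hE _ _ ?_ h
    ext v
    have := Set.ext_iff.mp hS v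
    simp only [Set.mem_inter_iff, Set.mem_compl_iff] at *
    tauto
  rw [Pr_eq_sum hμ hp hp1 hE', Pr_eq_sum hμ (by linarith) (by linarith) hE]
  refine Fintype.sum_equiv (Equiv.arrowCongr (Equiv.refl _) Equiv.boolNot) _ _ (fun b => ?_)
  congr 1
  · unfold wt
    refine Finset.prod_congr rfl (fun i _ => ?_)
    simp only [Equiv.arrowCongr_apply, Function.comp, Equiv.refl_symm, Equiv.refl_apply, Equiv.boolNot_apply]
    cases b i <;> simp
  · have : ((emb A b)ᶜ ∈ E) ↔ emb A ((Equiv.arrowCongr (Equiv.refl _) Equiv.boolNot) b) ∈ E := by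
      have : (emb A b)ᶜ ∩ A = emb A ((Equiv.arrowCongr (Equiv.refl _) Equiv.boolNot) b) ∩ A := by
        ext v
        simp only [emb, Set.mem_inter_iff, Set.mem_compl_iff, Set.mem_ofPred_eq, Finset.mem_coe,
          Equiv.arrowCongr_apply, Function.comp, Equiv.refl_symm, Equiv.refl_apply, Equiv.boolNot_apply]
        constructor
        · rintro ⟨h1, h2⟩; refine ⟨⟨h2, ?_⟩, h2⟩
          by_contra h3; exact h1 ⟨h2, by simpa using h3⟩
        · rintro ⟨⟨h1, h2⟩, h3⟩
          refine ⟨?_, h3⟩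
          rintro ⟨h4, h5⟩
          simp [h5] at h2
      exact ⟨hE _ _ this, hE _ _ this.symm⟩
    simp only [Set.mem_ofPred_eq]
    by_cases h5 : (emb A b)ᶜ ∈ E
    · rw [if_pos h5, if_pos (this.mp h5)]
    · rw [if_neg h5, if_neg (fun h => h5 (this.mpr h))]

theorem Pr_equiv {μ : Measure (Site → ℝ)} (hμ : IsUniformCoupling μ)
    {p : ℝ} (hp : 0 ≤ p) (hp1 : p ≤ 1) (τ : Site ≃ Site) {A : Finset Site}
    {E : Set (Set Site)} (hE : Loc A E) : Pr μ p {S | τ ⁻¹' S ∈ E} = Pr μ p E := by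
  have := hμ.1
  have hm : Measurable (fun (ω : Site → ℝ) (v : Site) => ω (τ v)) :=
    measurable_pi_lambda _ (fun v => measurable_pi_apply _)
  have hμ' : IsUniformCoupling (μ.map (fun ω v => ω (τ v))) := by
    refine ⟨Measure.isProbabilityMeasure_map hm.aemeasurable, ?_, ?_⟩
    · have := hμ.2.1.precomp τ.injective
      rw [iIndepFun_iff_measure_inter_preimage_eq_mul] at this ⊢
      intro S sets H
      have h1 : ∀ i ∈ S, MeasurableSet ((fun ω : Site → ℝ => ω i) ⁻¹' sets i) :=
        fun i hi => measurable_pi_apply i (H i hi)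
      rw [Measure.map_apply hm (Finset.measurableSet_biInter S h1)]
      have h2 := this S H
      refine Eq.trans ?_ (h2.trans ?_)
      · congr 1; ext ω; simp
      · refine Finset.prod_congr rfl (fun i hi => ?_)
        rw [Measure.map_apply hm (h1 i hi)]; rfl
    · intro v
      rw [Measure.map_map (measurable_pi_apply v) hm]
      exact hμ.2.2 (τ v)
  have h1 := Pr_eq_sum hμ' hp hp1 hE
  rw [← Pr_eq_sum hμ hp hp1 hE] at h1
  rw [← h1]
  unfold Pr
  rw [measureReal_def, measureReal_def, Measure.map_apply hm (hE.meas p)]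
  rfl

/-! ### Part 3: planar duality in rectangles -/

theorem adj_le {a b : Site} (h : adj a b) :
    b.1 ≤ a.1 + 1 ∧ a.1 ≤ b.1 + 1 ∧ b.2 ≤ a.2 + 1 ∧ a.2 ≤ b.2 + 1 := by
  unfold adj at h; omega

theorem Cn.row {S : Set Site} {x x' y : ℤ} (hx : x ≤ x') (h : ∀ t, x ≤ t → t ≤ x' → (t, y) ∈ S) :
    Cn S (x, y) (x', y) := by
  obtain ⟨n, rfl⟩ : ∃ n : ℕ, x' = x + n := ⟨(x' - x).toNat, by omega⟩
  induction n with
  | zero => simpa using Cn.refl (h x le_rfl (by simp))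
  | succ n ih =>
    refine Cn.tail (ih (by omega) (fun t h1 h2 => h t h1 (by push_cast; omega))) ?_
      (h _ hx le_rfl)
    left; constructor <;> simp; ring

theorem Cn.col {S : Set Site} {x y y' : ℤ} (hy : y ≤ y') (h : ∀ t, y ≤ t → t ≤ y' → (x, t) ∈ S) :
    Cn S (x, y) (x, y') := by
  obtain ⟨n, rfl⟩ : ∃ n : ℕ, y' = y + n := ⟨(y' - y).toNat, by omega⟩
  induction n with
  | zero => simpa using Cn.refl (h y le_rfl (by simp))
  | succ n ih =>
    refine Cn.tail (ih (by omega) (fun t h1 h2 => h t h1 (by push_cast; omega))) ?_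
      (h _ hy le_rfl)
    right; right; left; constructor <;> simp; ring

theorem adj_add {a b : Site} (t : Site) (h : adj a b) : adj (a + t) (b + t) := by
  unfold adj at *; simp only [Prod.fst_add, Prod.snd_add]; omega

/-- Translated board. -/
def TB (α β γ : ℤ) : Set Site := {v | α ≤ v.1 ∧ β ≤ v.2 ∧ v.1 + v.2 ≤ γ}

/-- Y-win on a translated board. -/
def YB (α β γ : ℤ) (B : Set Site) : Prop :=
  ∃ a b c : Site, a.1 = α ∧ b.2 = β ∧ c.1 + c.2 = γ ∧ Cn (B ∩ TB α β γ) a b ∧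
    Cn (B ∩ TB α β γ) a c

theorem YB_iff (α β γ : ℤ) (B : Set Site) :
    YB α β γ B ↔ Ywin (γ - α - β) {v | v + (α, β) ∈ B} := by
  constructor
  · rintro ⟨a, b, c, ha, hb, hc, h1, h2⟩
    refine ⟨a + (-α, -β), b + (-α, -β), c + (-α, -β), ?_, ?_, ?_, ?_, ?_⟩
    · simp only [Prod.fst_add]; omega
    · simp only [Prod.snd_add]; omega
    · simp only [Prod.snd_add, Prod.fst_add]; omega
    all_goals
      refine Cn.map (fun v => v + (-α, -β)) (fun a b h => adj_add _ h) ?_ (by assumption)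
      rintro v ⟨hv, hv1, hv2, hv3⟩
      refine ⟨?_, ?_, ?_, ?_⟩
      · have : v + (-α, -β) + (α, β) = v := by ext <;> simp
        simpa only [Set.mem_ofPred_eq, this] using hv
      all_goals simp only [Prod.snd_add, Prod.fst_add]; omega
  · rintro ⟨a, b, c, ha, hb, hc, h1, h2⟩
    refine ⟨a + (α, β), b + (α, β), c + (α, β), ?_, ?_, ?_, ?_, ?_⟩
    · simp only [Prod.fst_add]; omega
    · simp only [Prod.snd_add]; omega
    · simp only [Prod.snd_add, Prod.fst_add]; omega
    all_goals
      refine Cn.map (fun v => v + (α, β)) (fun a b h => adj_add _ h) ?_ (by assumption)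
      rintro v ⟨hv, hv1, hv2, hv3⟩
      refine ⟨hv, ?_, ?_, ?_⟩
      all_goals simp only [Prod.snd_add, Prod.fst_add]; omega

theorem YB_exists {α β γ : ℤ} (h : α + β ≤ γ) (B : Set Site) : YB α β γ B ∨ YB α β γ Bᶜ := by
  rw [YB_iff, YB_iff]
  have := Y_exists (γ - α - β).toNat {v | v + (α, β) ∈ B}
  rwa [Int.toNat_of_nonneg (by omega)] at this

theorem YB_disjoint {α β γ : ℤ} (h : α + β ≤ γ) {B W : Set Site} (h1 : YB α β γ B)
    (h2 : YB α β γ W) (hd : ∀ v, v ∈ B → v ∈ W → False) : False := by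
  rw [YB_iff] at h1 h2
  exact Y_disjoint (by omega) h1 h2 (fun v _ hB hW => hd _ hB hW)

/-- The rectangle `a ≤ X ≤ b`, `lo ≤ y ≤ hi` where `X = 2x + y`. -/
def Rc (a b lo hi : ℤ) : Set Site :=
  {v | a ≤ 2 * v.1 + v.2 ∧ 2 * v.1 + v.2 ≤ b ∧ lo ≤ v.2 ∧ v.2 ≤ hi}

theorem exists_big (a b c d : ℤ) : ∃ q : ℤ, a + 10 ≤ q ∧ b + 10 ≤ q ∧ c + 10 ≤ q ∧ d + 10 ≤ q ∧
    -a + 10 ≤ q ∧ -b + 10 ≤ q ∧ -c + 10 ≤ q ∧ -d + 10 ≤ q := by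
  refine ⟨|a| + |b| + |c| + |d| + 10, ?_⟩
  have := abs_nonneg a; have := abs_nonneg b; have := abs_nonneg c; have := abs_nonneg d
  have := le_abs_self a; have := le_abs_self b; have := le_abs_self c; have := le_abs_self d
  have := neg_abs_le a; have := neg_abs_le b; have := neg_abs_le c; have := neg_abs_le d
  omega

theorem rect_dual {a b lo hi : ℤ} (hab : a + 1 ≤ b) (hl : lo ≤ hi) (B : Set Site) :
    (∃ u v : Site, u.2 = lo ∧ v.2 = hi ∧ Cn (Rc a b lo hi ∩ B) u v) ∨
    (∃ u v : Site, 2 * u.1 + u.2 ≤ a + 1 ∧ b - 1 ≤ 2 * v.1 + v.2 ∧ Cn (Rc a b lo hi \ B) u v) := by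
  obtain ⟨q, q1, q2, q3, q4, q5, q6, q7, q8⟩ := exists_big a b lo hi
  rcases YB_exists (α := -q) (β := lo) (γ := q) (by omega) ((Rc a b lo hi ∩ B) ∪ {v | hi < v.2})
    with ⟨A, b', c, hA, hb, hc, h1, h2⟩ | ⟨A, b', c, hA, hb, hc, h1, h2⟩
  · left
    have hA' : A ∈ {v : Site | hi < v.2} := by
      rcases h1.left.1 with h | h
      · have := h.1; simp only [Rc, Set.mem_ofPred_eq] at this; exfalso; omega
      · exact h
    obtain ⟨s, t, h3, h4, h5, h6⟩ := h1.last_exit {v | hi < v.2} hA'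
      (by simp only [Set.mem_ofPred_eq]; omega)
    have ht := h6.left.2
    have hs := adj_le h5
    simp only [Set.mem_ofPred_eq] at h4 ht
    refine ⟨b', t, hb, by omega, (h6.symm).mono ?_⟩
    rintro v ⟨⟨hv | hv, -⟩, hv'⟩
    · exact hv
    · exact absurd hv hv'
  · right
    have hA' := h2.left; have hc' := h2.right
    simp only [Set.mem_inter_iff, Set.mem_compl_iff, Set.mem_union, TB, Set.mem_ofPred_eq, not_or,
      not_lt] at hA' hc'
    obtain ⟨s, t, h3, h4, h5, h6⟩ := h2.last_exit {v | 2 * v.1 + v.2 < a}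
      (by simp only [Set.mem_ofPred_eq]; omega) (by simp only [Set.mem_ofPred_eq]; omega)
    have ht := h6.left.2
    simp only [Set.mem_ofPred_eq] at h4 ht
    unfold adj at h5
    obtain ⟨s', t', h7, h8, h9, h10, h11⟩ := h6.first_exit {v | 2 * v.1 + v.2 ≤ b}
      (by simp only [Set.mem_ofPred_eq]; omega) (by simp only [Set.mem_ofPred_eq]; omega)
    simp only [Set.mem_ofPred_eq] at h10
    unfold adj at h8
    refine ⟨t, s', by omega, by omega, h7.mono ?_⟩
    rintro v ⟨⟨⟨hv1, hv2⟩, hv3⟩, hv4⟩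
    simp only [Set.mem_compl_iff, Set.mem_union, TB, Set.mem_ofPred_eq, not_or, not_lt,
      Set.mem_inter_iff, not_and] at hv1 hv2 hv3 hv4
    have hR : v ∈ Rc a b lo hi := ⟨by omega, by omega, by omega, by omega⟩
    exact ⟨hR, hv1.1 hR⟩

theorem rect_excl {a b lo hi : ℤ} {B W : Set Site}
    {u v u' v' : Site} (hB : Cn B u v) (hW : Cn W u' v')
    (hBs : B ⊆ Rc a b lo hi) (hWs : W ⊆ Rc a b lo hi)
    (hu : u.2 = lo) (hv : v.2 = hi) (hu' : 2 * u'.1 + u'.2 ≤ a + 1) (hv' : b - 1 ≤ 2 * v'.1 + v'.2) :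
    ∃ w, w ∈ B ∧ w ∈ W := by
  by_contra hne
  obtain ⟨q, q1, q2, q3, q4, q5, q6, q7, q8⟩ := exists_big a b lo hi
  have B1 : ∀ w ∈ B, a ≤ 2 * w.1 + w.2 ∧ 2 * w.1 + w.2 ≤ b ∧ lo ≤ w.2 ∧ w.2 ≤ hi := fun w hw => hBs hw
  have W1 : ∀ w ∈ W, a ≤ 2 * w.1 + w.2 ∧ 2 * w.1 + w.2 ≤ b ∧ lo ≤ w.2 ∧ w.2 ≤ hi := fun w hw => hWs hw
  have u1 := B1 u hB.left
  have v1 := B1 v hB.right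
  have u2 := W1 u' hW.left
  have v2 := W1 v' hW.right
  have BT : B ⊆ (B ∪ {v | hi < v.2}) ∩ TB (-q) lo q := by
    intro w hw
    have := B1 w hw
    exact ⟨Or.inl hw, by omega, by omega, by omega⟩
  have WT : W ⊆ (W ∪ {v | v.2 ≤ hi ∧ (2 * v.1 + v.2 < a ∨ b < 2 * v.1 + v.2)}) ∩ TB (-q) lo q := by
    intro w hw
    have := W1 w hw
    exact ⟨Or.inl hw, by omega, by omega, by omega⟩
  have rowB : ∀ x x' : ℤ, x ≤ x' → -q ≤ x → x' ≤ q - hi - 1 →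
      Cn ((B ∪ {v | hi < v.2}) ∩ TB (-q) lo q) (x, hi + 1) (x', hi + 1) := by
    intro x x' h1 h2 h3
    refine Cn.row h1 (fun t h4 h5 => ⟨Or.inr ?_, ?_, ?_, ?_⟩)
    · simp only [Set.mem_ofPred_eq]; omega
    all_goals dsimp only; omega
  refine YB_disjoint (α := -q) (β := lo) (γ := q) (by omega)
    (B := B ∪ {v | hi < v.2}) (W := W ∪ {v | v.2 ≤ hi ∧ (2 * v.1 + v.2 < a ∨ b < 2 * v.1 + v.2)})
    ?_ ?_ ?_
  · refine ⟨(-q, hi + 1), u, (q - hi - 1, hi + 1), rfl, hu, by dsimp only; omega, ?_,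
      rowB _ _ (by omega) (by omega) (by omega)⟩
    refine (rowB (-q) v.1 (by omega) (by omega) (by omega)).trans (Cn.head ?_ ?_ (hB.symm.mono BT))
    · unfold adj; dsimp only; omega
    · refine ⟨Or.inr ?_, ?_, ?_, ?_⟩
      · simp only [Set.mem_ofPred_eq]; omega
      all_goals dsimp only; omega
  · have inW : ∀ x y : ℤ, (y ≤ hi ∧ (2 * x + y < a ∨ b < 2 * x + y)) → -q ≤ x →
        lo ≤ y → x + y ≤ q →
        (x, y) ∈ (W ∪ {v | v.2 ≤ hi ∧ (2 * v.1 + v.2 < a ∨ b < 2 * v.1 + v.2)}) ∩ TB (-q) lo q :=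
      fun x y h1 h2 h3 h4 => ⟨Or.inr h1, h2, h3, h4⟩
    refine ⟨(-q, u'.2), (-q, lo), (q - v'.2, v'.2), rfl, rfl, by dsimp only; omega, ?_, ?_⟩
    · exact (Cn.col (by omega) (fun t h1 h2 => inW _ _ (by omega) (by omega) (by omega)
        (by omega))).symm
    · refine (Cn.row (x' := u'.1 - 1) (by omega) (fun t h1 h2 => inW _ _ (by omega) (by omega)
        (by omega) (by omega))).trans
        (Cn.head (v := u') ?_ (inW _ _ (by omega) (by omega) (by omega) (by omega))
        ((hW.mono WT).trans (Cn.head (v := (v'.1 + 1, v'.2)) ?_ (WT hW.right)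
        (Cn.row (by omega) (fun t h1 h2 => inW _ _ (by omega) (by omega) (by omega) (by omega))))))
      · unfold adj; dsimp only; omega
      · unfold adj; dsimp only; omega
  · rintro w (h1 | h1) (h2 | h2)
    · exact hne ⟨w, h1, h2⟩
    · have := B1 w h1; simp only [Set.mem_ofPred_eq] at h2; omega
    · have := W1 w h2; simp only [Set.mem_ofPred_eq] at h1; omega
    · simp only [Set.mem_ofPred_eq] at h1 h2; omega

/-- Black part of the outside of the rectangle in the four-arc duality. -/
def BO (w h : ℤ) : Set Site :=
  {v | h < v.2 ∨ (2 * v.1 + v.2 < 0 ∧ 0 ≤ v.2) ∨ (w < 2 * v.1 + v.2 ∧ v.2 ≤ 0)}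

/-- White part of the outside of the rectangle in the four-arc duality. -/
def WO (w h : ℤ) : Set Site :=
  {v | (2 * v.1 + v.2 < 0 ∧ v.2 < 0) ∨ (v.2 < -h ∧ 2 * v.1 + v.2 ≤ w) ∨
    (w < 2 * v.1 + v.2 ∧ 0 < v.2 ∧ v.2 ≤ h)}

theorem rect_dual4 {k h : ℤ} (hk : 1 ≤ k) (hh : 1 ≤ h) (B : Set Site) :
    (∃ u v : Site, (u.2 = h ∨ (2 * u.1 + u.2 ≤ 1 ∧ 0 ≤ u.2)) ∧ 2 * k - 1 ≤ 2 * v.1 + v.2 ∧ v.2 ≤ 0 ∧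
      Cn (Rc 0 (2 * k) (-h) h ∩ B) u v) ∨
    (∃ u v : Site, (u.2 = -h ∨ (2 * u.1 + u.2 ≤ 1 ∧ u.2 ≤ 0)) ∧ 2 * k - 1 ≤ 2 * v.1 + v.2 ∧ 0 ≤ v.2 ∧
      Cn (Rc 0 (2 * k) (-h) h \ B) u v) := by
  obtain ⟨q, q1, q2, -, -, q5, q6, -, -⟩ := exists_big (2 * k) h 0 0
  rcases YB_exists (α := -q) (β := -h - 1) (γ := q) (by omega)
    ((Rc 0 (2 * k) (-h) h ∩ B) ∪ BO (2 * k) h)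
    with ⟨A, b', c, hA, hb, hc, h1, h2⟩ | ⟨A, b', c, hA, hb, hc, h1, h2⟩
  · left
    have hA' := h1.left
    have hb' := h1.right
    simp only [Set.mem_inter_iff, Set.mem_union, TB, Rc, BO, Set.mem_ofPred_eq] at hA' hb'
    obtain ⟨s, t, h3, h4, h5, h6⟩ := h1.last_exit
      {v | h < v.2 ∨ (2 * v.1 + v.2 < 0 ∧ 0 ≤ v.2)}
      (by simp only [Set.mem_ofPred_eq]; omega) (by simp only [Set.mem_ofPred_eq]; omega)
    have ht := h6.left
    simp only [Set.mem_inter_iff, Set.mem_union, TB, Rc, BO, Set.mem_ofPred_eq, Set.mem_diff] at h4 ht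
    unfold adj at h5
    obtain ⟨s', t', h7, h8, h9, h10, h11⟩ := h6.first_exit {v | ¬ (2 * k < 2 * v.1 + v.2 ∧ v.2 ≤ 0)}
      (by simp only [Set.mem_ofPred_eq]; omega) (by simp only [Set.mem_ofPred_eq]; omega)
    have hs' := h7.right
    simp only [Set.mem_inter_iff, Set.mem_union, TB, Rc, BO, Set.mem_ofPred_eq, Set.mem_diff, not_not] at h10 hs'
    unfold adj at h8
    refine ⟨t, s', by omega, by omega, by omega, h7.mono ?_⟩
    rintro v ⟨⟨⟨hv1 | hv1, hv2⟩, hv3⟩, hv4⟩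
    · exact hv1
    · simp only [BO, Set.mem_ofPred_eq] at hv1 hv3 hv4; omega
  · right
    have hA' := h2.left
    have hc' := h2.right
    simp only [Set.mem_inter_iff, Set.mem_union, TB, Rc, BO, Set.mem_ofPred_eq, Set.mem_compl_iff] at hA' hc'
    obtain ⟨s, t, h3, h4, h5, h6⟩ := h2.last_exit
      {v | (v.2 < 0 ∧ 2 * v.1 + v.2 < 0) ∨ (v.2 < -h ∧ 2 * v.1 + v.2 ≤ 2 * k)}
      (by simp only [Set.mem_ofPred_eq]; omega) (by simp only [Set.mem_ofPred_eq]; omega)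
    have ht := h6.left
    simp only [Set.mem_inter_iff, Set.mem_union, TB, Rc, BO, Set.mem_ofPred_eq, Set.mem_diff, Set.mem_compl_iff] at h4 ht
    unfold adj at h5
    obtain ⟨s', t', h7, h8, h9, h10, h11⟩ := h6.first_exit {v | ¬ (2 * k < 2 * v.1 + v.2 ∧ 0 < v.2)}
      (by simp only [Set.mem_ofPred_eq]; omega) (by simp only [Set.mem_ofPred_eq]; omega)
    have hs' := h7.right
    simp only [Set.mem_inter_iff, Set.mem_union, TB, Rc, BO, Set.mem_ofPred_eq, Set.mem_diff, not_not, Set.mem_compl_iff] at h10 hs'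
    unfold adj at h8
    refine ⟨t, s', by omega, by omega, by omega, h7.mono ?_⟩
    rintro v ⟨⟨⟨hv1, hv2⟩, hv3⟩, hv4⟩
    simp only [Set.mem_union, BO, Set.mem_compl_iff, Set.mem_inter_iff, Set.mem_ofPred_eq, not_or] at hv1 hv3 hv4
    have hR : v ∈ Rc 0 (2 * k) (-h) h := ⟨by omega, by omega, by omega, by omega⟩
    exact ⟨hR, fun hB => hv1.1 ⟨hR, hB⟩⟩

theorem rect_excl4 {k h : ℤ} (hk : 1 ≤ k) (hh : 1 ≤ h) {B W : Set Site}
    {u v u' v' : Site} (hB : Cn B u v) (hW : Cn W u' v')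
    (hBs : B ⊆ Rc 0 (2 * k) (-h) h) (hWs : W ⊆ Rc 0 (2 * k) (-h) h)
    (hu : u.2 = h) (hv : 2 * k - 1 ≤ 2 * v.1 + v.2) (hv2 : v.2 ≤ 0)
    (hu' : u'.2 = -h) (hv' : 2 * k - 1 ≤ 2 * v'.1 + v'.2) (hv2' : 0 ≤ v'.2) :
    ∃ w, w ∈ B ∧ w ∈ W := by
  by_contra hne
  obtain ⟨q, q1, q2, -, -, q5, q6, -, -⟩ := exists_big (2 * k) h 0 0
  have B1 : ∀ w ∈ B, 0 ≤ 2 * w.1 + w.2 ∧ 2 * w.1 + w.2 ≤ 2 * k ∧ -h ≤ w.2 ∧ w.2 ≤ h := fun w hw => hBs hw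
  have W1 : ∀ w ∈ W, 0 ≤ 2 * w.1 + w.2 ∧ 2 * w.1 + w.2 ≤ 2 * k ∧ -h ≤ w.2 ∧ w.2 ≤ h := fun w hw => hWs hw
  have u1 := B1 u hB.left
  have v1 := B1 v hB.right
  have u2 := W1 u' hW.left
  have v2 := W1 v' hW.right
  have BT : B ⊆ (B ∪ BO (2 * k) h) ∩ TB (-q) (-h - 1) q := by
    intro w hw
    have := B1 w hw
    exact ⟨Or.inl hw, by omega, by omega, by omega⟩
  have WT : W ⊆ (W ∪ WO (2 * k) h) ∩ TB (-q) (-h - 1) q := by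
    intro w hw
    have := W1 w hw
    exact ⟨Or.inl hw, by omega, by omega, by omega⟩
  have inB : ∀ x y : ℤ, (h < y ∨ (2 * x + y < 0 ∧ 0 ≤ y) ∨ (2 * k < 2 * x + y ∧ y ≤ 0)) → -q ≤ x →
      -h - 1 ≤ y → x + y ≤ q → (x, y) ∈ (B ∪ BO (2 * k) h) ∩ TB (-q) (-h - 1) q :=
    fun x y h1 h2 h3 h4 => ⟨Or.inr h1, h2, h3, h4⟩
  have inW : ∀ x y : ℤ, ((2 * x + y < 0 ∧ y < 0) ∨ (y < -h ∧ 2 * x + y ≤ 2 * k) ∨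
      (2 * k < 2 * x + y ∧ 0 < y ∧ y ≤ h)) → -q ≤ x →
      -h - 1 ≤ y → x + y ≤ q → (x, y) ∈ (W ∪ WO (2 * k) h) ∩ TB (-q) (-h - 1) q :=
    fun x y h1 h2 h3 h4 => ⟨Or.inr h1, h2, h3, h4⟩
  refine YB_disjoint (α := -q) (β := -h - 1) (γ := q) (by omega)
    (B := B ∪ BO (2 * k) h) (W := W ∪ WO (2 * k) h) ?_ ?_ ?_
  · have p1 : Cn ((B ∪ BO (2 * k) h) ∩ TB (-q) (-h - 1) q) (-q, h + 1) (q - v.2, v.2) := by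
      refine (Cn.row (x' := u.1) (by omega) (fun t h1 h2 => inB _ _ (by omega) (by omega) (by omega)
        (by omega))).trans (Cn.head (v := u) ?_ (inB _ _ (by omega) (by omega) (by omega)
        (by omega)) ((hB.mono BT).trans (Cn.head (v := (v.1 + 1, v.2)) ?_ (BT hB.right)
        (Cn.row (by omega) (fun t h1 h2 => inB _ _ (by omega) (by omega) (by omega) (by omega))))))
      · unfold adj; dsimp only; omega
      · unfold adj; dsimp only; omega
    refine ⟨(-q, h + 1), (q - v.2, -h - 1), (q - v.2, v.2), rfl, rfl, by dsimp only; omega, ?_, p1⟩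
    exact p1.trans (Cn.col (by omega) (fun t h1 h2 => inB _ _ (by omega) (by omega) (by omega)
      (by omega))).symm
  · have p2 : Cn ((W ∪ WO (2 * k) h) ∩ TB (-q) (-h - 1) q) (-q, -h - 1) v' := by
      refine (Cn.row (x' := u'.1) (by omega) (fun t h1 h2 => inW _ _ (by omega) (by omega) (by omega)
        (by omega))).trans (Cn.head (v := u') ?_ (inW _ _ (by omega) (by omega) (by omega)
        (by omega)) (hW.mono WT))
      unfold adj; dsimp only; omega
    by_cases hz : v'.2 = 0
    · refine ⟨(-q, -h - 1), (-q, -h - 1), (q - 1, 1), rfl, rfl, by dsimp only; omega,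
        .refl p2.left, p2.trans (Cn.head (v := (v'.1, 1)) ?_ p2.right (Cn.row (by omega)
        (fun t h1 h2 => inW _ _ (by omega) (by omega) (by omega) (by omega))))⟩
      unfold adj; dsimp only; omega
    · refine ⟨(-q, -h - 1), (-q, -h - 1), (q - v'.2, v'.2), rfl, rfl, by dsimp only; omega,
        .refl p2.left, p2.trans (Cn.head (v := (v'.1 + 1, v'.2)) ?_ p2.right (Cn.row (by omega)
        (fun t h1 h2 => inW _ _ (by omega) (by omega) (by omega) (by omega))))⟩
      unfold adj; dsimp only; omega
  · rintro w (h1 | h1) (h2 | h2)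
    · exact hne ⟨w, h1, h2⟩
    · have := B1 w h1; simp only [WO, Set.mem_ofPred_eq] at h2; omega
    · have := W1 w h2; simp only [BO, Set.mem_ofPred_eq] at h1; omega
    · simp only [BO, WO, Set.mem_ofPred_eq] at h1 h2; omega

/-! ### Part 4: Russo-Seymour-Welsh -/

section fin

variable {μ : Measure (Site → ℝ)}

theorem Pr_compl' (hμ : IsUniformCoupling μ) {A : Set Site} (hA : A.Finite) {E : Set (Set Site)}
    (h : Loc A E) (p : ℝ) : Pr μ p Eᶜ = 1 - Pr μ p E :=
  Pr_compl hμ (A := hA.toFinset) (by rwa [hA.coe_toFinset]) p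

theorem Pr_indep' (hμ : IsUniformCoupling μ) {p : ℝ} {A B : Set Site} (hA : A.Finite)
    (hB : B.Finite) (hAB : Disjoint A B)
    {E F : Set (Set Site)} (hE : Loc A E) (hF : Loc B F) :
    Pr μ p (E ∩ F) = Pr μ p E * Pr μ p F := by
  refine Pr_indep hμ (A := hA.toFinset) (B := hB.toFinset) ?_ (by rwa [hA.coe_toFinset])
    (by rwa [hB.coe_toFinset])
  rw [← Finset.disjoint_coe, hA.coe_toFinset, hB.coe_toFinset]
  exact hAB

theorem Pr_fkg' (hμ : IsUniformCoupling μ) {p : ℝ} (hp : 0 ≤ p) (hp1 : p ≤ 1) {A : Set Site}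
    (hA : A.Finite)
    {E F : Set (Set Site)} (hE : Loc A E) (hF : Loc A F) (uE : IsUpperSet E) (uF : IsUpperSet F) :
    Pr μ p E * Pr μ p F ≤ Pr μ p (E ∩ F) :=
  Pr_fkg hμ hp hp1 (A := hA.toFinset) (by rwa [hA.coe_toFinset]) (by rwa [hA.coe_toFinset]) uE uF

theorem Pr_flip' (hμ : IsUniformCoupling μ) {p : ℝ} (hp : 0 ≤ p) (hp1 : p ≤ 1) {A : Set Site}
    (hA : A.Finite)
    {E : Set (Set Site)} (hE : Loc A E) : Pr μ p {S | Sᶜ ∈ E} = Pr μ (1 - p) E :=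
  Pr_flip hμ hp hp1 (A := hA.toFinset) (by rwa [hA.coe_toFinset])

theorem Pr_equiv' (hμ : IsUniformCoupling μ) {p : ℝ} (hp : 0 ≤ p) (hp1 : p ≤ 1) (τ : Site ≃ Site)
    {A : Set Site} (hA : A.Finite)
    {E : Set (Set Site)} (hE : Loc A E) : Pr μ p {S | τ ⁻¹' S ∈ E} = Pr μ p E :=
  Pr_equiv hμ hp hp1 τ (A := hA.toFinset) (by rwa [hA.coe_toFinset])

theorem Pr_sum_le (hμ : IsUniformCoupling μ) {ι : Type*} (p : ℝ) (s : Finset ι)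
    (E : ι → Set (Set Site)) (F : Set (Set Site)) {A : Set Site} (hA : A.Finite)
    (hE : ∀ i ∈ s, Loc A (E i)) (hF : ∀ i ∈ s, E i ⊆ F)
    (hd : ∀ i ∈ s, ∀ j ∈ s, i ≠ j → ∀ S, S ∈ E i → S ∈ E j → False) :
    ∑ i ∈ s, Pr μ p (E i) ≤ Pr μ p F := by
  have := hμ.1
  have h1 : ∑ i ∈ s, Pr μ p (E i) = μ.real (⋃ i ∈ s, {ω | bl p ω ∈ E i}) := by
    rw [measureReal_biUnion_finset]
    · rfl
    · intro i hi j hj hij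
      rw [Function.onFun, Set.disjoint_left]
      intro ω h1 h2
      exact hd i hi j hj hij _ h1 h2
    · intro i hi
      exact Loc.meas (A := hA.toFinset) (by rw [hA.coe_toFinset]; exact hE i hi) p
  rw [h1]
  refine measureReal_mono ?_
  intro ω hω
  simp only [Set.mem_iUnion, Set.mem_ofPred_eq] at hω
  obtain ⟨i, hi, h⟩ := hω
  exact hF i hi h

end fin

/-- Sup-norm ball. -/
def Bx (r : ℤ) : Set Site := {v | -r ≤ v.1 ∧ v.1 ≤ r ∧ -r ≤ v.2 ∧ v.2 ≤ r}

theorem Bx_finite (r : ℤ) : (Bx r).Finite := by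
  refine (Finset.finite_toSet (Finset.Icc (-r, -r) (r, r))).subset ?_
  rintro ⟨x, y⟩ ⟨h1, h2, h3, h4⟩
  simp only [Finset.coe_Icc, Set.mem_Icc, Prod.mk_le_mk]
  exact ⟨⟨h1, h3⟩, h2, h4⟩

theorem Rc_finite (a b lo hi : ℤ) : (Rc a b lo hi).Finite := by
  obtain ⟨q, q1, q2, q3, q4, q5, q6, q7, q8⟩ := exists_big a b lo hi
  refine (Bx_finite q).subset ?_
  rintro v ⟨h1, h2, h3, h4⟩
  refine ⟨?_, ?_, ?_, ?_⟩ <;> omega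

/-- Reflection in the row `y = 0`. -/
def rho (v : Site) : Site := (v.1 + v.2, -v.2)

theorem rho_rho (v : Site) : rho (rho v) = v := by ext <;> simp [rho]

theorem rho_adj {a b : Site} (h : adj a b) : adj (rho a) (rho b) := by
  unfold adj rho at *; dsimp only; omega

/-- Explored white cluster of the left side. -/
def Wcl (k h : ℤ) (B : Set Site) : Set Site :=
  {v | ∃ u : Site, 2 * u.1 + u.2 ≤ 1 ∧ Cn (Rc 0 (2 * k) 0 h \ B) u v}

/-- The explored region. -/
def hull (k h : ℤ) (A : Set Site) : Set Site :=
  {v | v ∈ Rc 0 (2 * k) 0 h ∧ (v ∈ A ∨ 2 * v.1 + v.2 ≤ 1 ∨ ∃ w ∈ A, adj w v)}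

/-- The unexplored region. -/
def Zr (k h : ℤ) (A : Set Site) : Set Site :=
  {v | v ∈ Rc 0 (2 * k) (-h) h ∧ v ∉ hull k h A ∧ rho v ∉ hull k h A}

/-- Vertical crossing event. -/
def VX (a b lo hi : ℤ) : Set (Set Site) :=
  {B | ∃ u v : Site, u.2 = lo ∧ v.2 = hi ∧ Cn (B ∩ Rc a b lo hi) u v}

/-- Top to lower right event. -/
def E1 (k h : ℤ) : Set (Set Site) :=
  {B | ∃ u v : Site, u.2 = h ∧ 2 * k - 1 ≤ 2 * v.1 + v.2 ∧ v.2 ≤ 0 ∧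
    Cn (B ∩ Rc 0 (2 * k) (-h) h) u v}

/-- The event in the unexplored region. -/
def EP (k h : ℤ) (A : Set Site) : Set (Set Site) :=
  {B | ∃ u v : Site, (u.2 = h ∨ (2 * u.1 + u.2 ≤ 1 ∧ 0 ≤ u.2)) ∧ 2 * k - 1 ≤ 2 * v.1 + v.2 ∧
    v.2 ≤ 0 ∧ Cn (hull k h A ∪ (B ∩ Zr k h A)) u v}

theorem mem_Wcl_of_left {k h : ℤ} {B : Set Site} {v : Site} (hv : v ∈ Rc 0 (2 * k) 0 h) (hB : v ∉ B)
    (hX : 2 * v.1 + v.2 ≤ 1) : v ∈ Wcl k h B := ⟨v, hX, .refl ⟨hv, hB⟩⟩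

theorem mem_Wcl_of_adj {k h : ℤ} {B : Set Site} {v w : Site} (hv : v ∈ Rc 0 (2 * k) 0 h) (hB : v ∉ B)
    (hw : w ∈ Wcl k h B) (ha : adj w v) : v ∈ Wcl k h B := by
  obtain ⟨u, hu, h⟩ := hw
  exact ⟨u, hu, h.tail ha ⟨hv, hB⟩⟩

theorem Wcl_sub {k h : ℤ} {B : Set Site} : Wcl k h B ⊆ Rc 0 (2 * k) 0 h \ B := by
  rintro v ⟨u, hu, h⟩
  exact h.right

theorem hull_sub {k h : ℤ} {A : Set Site} : hull k h A ⊆ Rc 0 (2 * k) 0 h := fun v hv => hv.1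

theorem hull_black {k h : ℤ} {B : Set Site} {v : Site} (hv : v ∈ hull k h (Wcl k h B))
    (hW : v ∉ Wcl k h B) : v ∈ B := by
  by_contra hB
  rcases hv.2 with h1 | h1 | ⟨w, hw, ha⟩
  · exact hW h1
  · exact hW (mem_Wcl_of_left hv.1 hB h1)
  · exact hW (mem_Wcl_of_adj hv.1 hB hw ha)

theorem Wcl_path {k h : ℤ} {B : Set Site} {v : Site} (hv : v ∈ Wcl k h B) :
    ∃ u : Site, 2 * u.1 + u.2 ≤ 1 ∧ Cn (Wcl k h B) u v := by
  obtain ⟨u, hu, hc⟩ := hv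
  refine ⟨u, hu, hc.self.mono ?_⟩
  intro w hw
  exact (show w ∈ Wcl k h B from ⟨u, hu, hw⟩)

theorem Wcl_right {k h : ℤ} {B : Set Site} (hV : B ∈ VX 0 (2 * k) 0 h) {v : Site}
    (hv : v ∈ Wcl k h B) : 2 * v.1 + v.2 < 2 * k - 1 := by
  by_contra hX
  obtain ⟨u, hu, hc⟩ := hv
  obtain ⟨s, t, hs, ht, hst⟩ := hV
  obtain ⟨w, hw1, hw2⟩ := rect_excl (a := 0) (b := 2 * k) (lo := 0) (hi := h) hst hc
    Set.inter_subset_right Set.diff_subset hs ht (by omega) (by omega)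
  exact hw2.2 hw1.1

theorem VX_hull {k h : ℤ} (hk : 1 ≤ k) (hh : 1 ≤ h) {B : Set Site} (hV : B ∈ VX 0 (2 * k) 0 h) :
    ∃ u v : Site, u.2 = 0 ∧ v.2 = h ∧ Cn (hull k h (Wcl k h B) \ Wcl k h B) u v := by
  rcases rect_dual (a := 0) (b := 2 * k) (lo := 0) (hi := h) (by omega) (by omega)
    (hull k h (Wcl k h B) \ Wcl k h B) with ⟨u, v, h1, h2, h3⟩ | ⟨u, v, h1, h2, h3⟩
  · exact ⟨u, v, h1, h2, h3.mono Set.inter_subset_right⟩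
  · exfalso
    have : v ∈ Wcl k h B := by
      refine Cn.ind (Q := fun v => v ∈ Wcl k h B) ?_ ?_ h3
      · intro h4
        by_contra h5
        exact h4.2 ⟨⟨h4.1, Or.inr (Or.inl (by omega))⟩, h5⟩
      · intro a b _ ha hab hb
        by_contra h5
        exact hb.2 ⟨⟨hb.1, Or.inr (Or.inr ⟨a, ha, hab⟩)⟩, h5⟩
    have := Wcl_right hV this
    omega

theorem rho_fix {v : Site} (h1 : 0 ≤ v.2) (h2 : 0 ≤ (rho v).2) : rho v = v := by
  have : v.2 = 0 := by simp only [rho] at h2; omega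
  ext <;> simp [rho, this]

theorem EP_VX_E1 {k h : ℤ} (hk : 1 ≤ k) (hh : 1 ≤ h) {B : Set Site} (hV : B ∈ VX 0 (2 * k) 0 h)
    (hE : B ∈ EP k h (Wcl k h B)) : B ∈ E1 k h := by
  obtain ⟨u0, v0, hu0, hv0, hγ⟩ := VX_hull hk hh hV
  set W := Wcl k h B with hW
  set H := hull k h W with hH
  have HS : ∀ w ∈ H, 0 ≤ 2 * w.1 + w.2 ∧ 2 * w.1 + w.2 ≤ 2 * k ∧ 0 ≤ w.2 ∧ w.2 ≤ h :=
    fun w hw => hull_sub hw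
  have HR : H ⊆ Rc 0 (2 * k) (-h) h := by
    intro w hw; have := HS w hw; exact ⟨by omega, by omega, by omega, by omega⟩
  have WS : ∀ w ∈ W, 0 ≤ 2 * w.1 + w.2 ∧ 2 * w.1 + w.2 ≤ 2 * k ∧ 0 ≤ w.2 ∧ w.2 ≤ h :=
    fun w hw => (Wcl_sub hw).1
  have WH : W ⊆ H := fun w hw => ⟨(Wcl_sub hw).1, Or.inl hw⟩
  set G := {w | Cn (H \ W) u0 w} with hG
  have GH : ∀ w ∈ G, w ∈ H ∧ w ∉ W := fun w hw => Cn.right hw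
  have hγ' : Cn G u0 v0 := hγ.self
  have rfix : ∀ w, w ∈ H → rho w ∈ H → rho w = w := by
    intro w h1 h2; exact rho_fix (HS w h1).2.2.1 (HS _ h2).2.2.1
  -- key planarity claim
  have key : ∀ (s v : Site) (G' : Set Site), s ∈ H → s ∉ W → Cn G' s v →
      2 * k - 1 ≤ 2 * v.1 + v.2 → (∀ t ∈ G', t = s ∨ t ∈ Zr k h W) → s ∈ G := by
    intro s v G' hsH hsW hc hX hG'
    have hG'R : G' ⊆ Rc 0 (2 * k) (-h) h := by
      intro t ht
      rcases hG' t ht with rfl | ht'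
      · exact HR hsH
      · exact ht'.1
    obtain ⟨u, hu, hp⟩ : ∃ u : Site, 2 * u.1 + u.2 ≤ 1 ∧ Cn (W ∪ G') u v := by
      rcases hsH.2 with h1 | h1 | ⟨w, hw, ha⟩
      · exact absurd h1 hsW
      · exact ⟨s, h1, hc.mono Set.subset_union_right⟩
      · obtain ⟨u, hu, hp⟩ := Wcl_path hw
        exact ⟨u, hu, ((hp.mono Set.subset_union_left).tail ha (Or.inr hc.left)).trans
          (hc.mono Set.subset_union_right)⟩
    have hvert : Cn (G ∪ rho ⁻¹' G) (rho v0) v0 := by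
      have e1 : Cn (G ∪ rho ⁻¹' G) (rho v0) (rho u0) :=
        (hγ'.symm).map rho (fun a b h => rho_adj h) (fun a ha => Or.inr (by
          simpa only [Set.mem_preimage, rho_rho] using ha))
      have e2 : rho u0 = u0 := by ext <;> simp [rho, hu0]
      rw [e2] at e1
      exact e1.trans (hγ'.mono Set.subset_union_left)
    obtain ⟨t, ht1, ht2⟩ := rect_excl (a := 0) (b := 2 * k) (lo := -h) (hi := h) hvert hp
      (by
        rintro w (hw | hw)
        · exact HR (GH w hw).1
        · have := HS _ (GH _ hw).1
          simp only [rho] at this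
          exact ⟨by omega, by omega, by omega, by omega⟩)
      (by
        rintro w (hw | hw)
        · exact HR (WH hw)
        · exact hG'R hw)
      (by simp [rho, hv0]) hv0 (by omega) hX
    have ht3 : t ∈ G ∨ (t ∉ H) := by
      rcases ht1 with h1 | h1
      · exact Or.inl h1
      · by_cases h2 : t ∈ H
        · left; have := rfix t h2 (GH _ h1).1
          rw [Set.mem_preimage, this] at h1; exact h1
        · exact Or.inr h2
    rcases ht2 with h2 | h2
    · rcases ht3 with h3 | h3
      · exact absurd h2 (GH t h3).2
      · exact absurd (WH h2) h3
    · rcases hG' t h2 with rfl | h4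
      · rcases ht3 with h3 | h3
        · exact h3
        · exact absurd hsH h3
      · exfalso
        rcases ht1 with h1 | h1
        · exact h4.2.1 (GH t h1).1
        · exact h4.2.2 (GH _ h1).1
  have HWB : H \ W ⊆ B ∩ Rc 0 (2 * k) (-h) h := fun w hw => ⟨hull_black hw.1 hw.2, HR hw.1⟩
  have ZB : B ∩ Zr k h W ⊆ B ∩ Rc 0 (2 * k) (-h) h := fun w hw => ⟨hw.1, hw.2.1⟩
  obtain ⟨u, v, hu, hv, hv2, hp⟩ := hE
  by_cases hvH : v ∈ H
  · have hvW : v ∉ W := fun h1 => by have := Wcl_right hV h1; omega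
    have := key v v {v} hvH hvW (.refl rfl) hv (fun t ht => Or.inl ht)
    exact ⟨v0, v, hv0, hv, hv2, (hγ.symm.trans this).mono HWB⟩
  by_cases hex : ∃ t ∈ H, Cn (H ∪ (B ∩ Zr k h W)) t v
  · obtain ⟨t, htH, ht⟩ := hex
    obtain ⟨s, z, h1, h2, h3, h4⟩ := ht.last_exit H htH hvH
    have h5 : Cn (B ∩ Zr k h W) z v := by
      refine h4.mono ?_
      rintro w ⟨hw1 | hw1, hw2⟩
      · exact absurd hw1 hw2
      · exact hw1
    have hz := h5.left
    by_cases hsW : s ∈ W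
    · exfalso
      have hzR : z ∈ Rc 0 (2 * k) (-h) h := hz.2.1
      have hs := WS s hsW
      have h6 := adj_le h3
      obtain ⟨z1, z2, z3, z4⟩ := hzR
      by_cases hzy : 0 ≤ z.2
      · exact hz.2.2.1 ⟨⟨z1, z2, hzy, z4⟩, Or.inr (Or.inr ⟨s, hsW, h3⟩)⟩
      · have e1 : rho s = s := by
          have : s.2 = 0 := by omega
          ext <;> simp [rho, this]
        refine hz.2.2.2 ⟨⟨?_, ?_, ?_, ?_⟩, Or.inr (Or.inr ⟨s, hsW, ?_⟩)⟩
        · simp only [rho]; omega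
        · simp only [rho]; omega
        · simp only [rho]; omega
        · simp only [rho]; omega
        · have := rho_adj h3; rwa [e1] at this
    · have h7 : Cn ({s} ∪ (B ∩ Zr k h W)) s v :=
        Cn.head h3 (Or.inl rfl) (h5.mono Set.subset_union_right)
      have h8 := key s v _ h2 hsW h7 hv (by
        rintro t (ht | ht)
        · exact Or.inl ht
        · exact Or.inr ht.2)
      refine ⟨v0, v, hv0, hv, hv2, ((hγ.symm.trans h8).mono HWB).trans
        (Cn.head h3 (HWB ⟨h2, hsW⟩) (h5.mono ZB))⟩
  · have h5 : Cn (B ∩ Zr k h W) u v := by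
      refine hp.self.mono ?_
      intro w hw
      rcases Cn.right hw with h1 | h1
      · exact absurd ⟨w, h1, (Cn.symm hw).trans hp⟩ hex
      · exact h1
    refine ⟨u, v, ?_, hv, hv2, h5.mono ZB⟩
    rcases hu with hu | ⟨hu, hu2⟩
    · exact hu
    · exfalso
      obtain ⟨z1, z2, z3, z4⟩ := h5.left.2.1
      exact h5.left.2.2.1 ⟨⟨z1, z2, hu2, z4⟩, Or.inr (Or.inl hu)⟩

theorem EP_dual {k h : ℤ} (hk : 1 ≤ k) (hh : 1 ≤ h) (A B : Set Site) :
    B ∈ EP k h A ∨ rho ⁻¹' Bᶜ ∈ EP k h A := by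
  have hZ : ∀ w ∈ Zr k h A, w ∈ Rc 0 (2 * k) (-h) h := fun w hw => hw.1
  rcases rect_dual4 hk hh (hull k h A ∪ (B ∩ Zr k h A)) with ⟨u, v, h1, h2, h3, h4⟩ |
    ⟨u, v, h1, h2, h3, h4⟩
  · exact Or.inl ⟨u, v, h1, h2, h3, h4.mono Set.inter_subset_right⟩
  · right
    refine ⟨rho u, rho v, ?_, ?_, ?_, h4.map rho (fun a b h => rho_adj h) ?_⟩
    · simp only [rho]; omega
    · simp only [rho]; omega
    · simp only [rho]; omega
    · rintro w ⟨hw1, hw2⟩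
      simp only [Set.mem_union, not_or, Set.mem_inter_iff, not_and] at hw2
      by_cases hr : rho w ∈ hull k h A
      · exact Or.inl hr
      · right
        have hwZ : w ∈ Zr k h A := ⟨hw1, hw2.1, hr⟩
        refine ⟨?_, ?_, hr, by rw [rho_rho]; exact hw2.1⟩
        · rw [Set.mem_preimage, rho_rho]; exact fun hB => hw2.2 hB hwZ
        · obtain ⟨z1, z2, z3, z4⟩ := hw1
          refine ⟨?_, ?_, ?_, ?_⟩ <;> simp only [rho] <;> omega

theorem Wcl_local {k h : ℤ} (A : Set Site) : Loc (hull k h A) {B | Wcl k h B = A} := by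
  intro B B' hBB hB
  have hB : Wcl k h B = A := hB
  show Wcl k h B' = A
  have hiff : ∀ v ∈ hull k h A, v ∈ B ↔ v ∈ B' := by
    intro v hv
    have := Set.ext_iff.mp hBB v
    simp only [Set.mem_inter_iff, hv, and_true] at this
    exact this
  have hAS : ∀ v ∈ A, v ∈ Rc 0 (2 * k) 0 h ∧ v ∉ B := by
    intro v hv; rw [← hB] at hv; exact Wcl_sub hv
  apply Set.Subset.antisymm
  · rintro v ⟨u, hu, hc⟩
    refine Cn.ind (Q := fun v => v ∈ A) ?_ ?_ hc
    · intro h1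
      rw [← hB]
      refine mem_Wcl_of_left h1.1 ?_ hu
      rw [hiff u ⟨h1.1, Or.inr (Or.inl hu)⟩]; exact h1.2
    · intro a b _ ha hab hb
      have : b ∉ B := by
        rw [hiff b ⟨hb.1, Or.inr (Or.inr ⟨a, ha, hab⟩)⟩]; exact hb.2
      rw [← hB] at ha ⊢
      exact mem_Wcl_of_adj hb.1 this ha hab
  · intro v hv
    rw [← hB] at hv
    obtain ⟨u, hu, hc⟩ := Wcl_path hv
    refine ⟨u, hu, hc.mono ?_⟩
    rw [hB]
    intro w hw
    refine ⟨(hAS w hw).1, ?_⟩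
    rw [← hiff w ⟨(hAS w hw).1, Or.inl hw⟩]
    exact (hAS w hw).2

theorem EP_local {k h : ℤ} (A : Set Site) : Loc (Zr k h A) (EP k h A) :=
  Loc.of_inter (D := Zr k h A) subset_rfl (fun T => ∃ u v : Site,
    (u.2 = h ∨ (2 * u.1 + u.2 ≤ 1 ∧ 0 ≤ u.2)) ∧ 2 * k - 1 ≤ 2 * v.1 + v.2 ∧
    v.2 ≤ 0 ∧ Cn (hull k h A ∪ T) u v)

theorem VX_local (a b lo hi : ℤ) : Loc (Rc a b lo hi) (VX a b lo hi) :=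
  Loc.of_inter (D := Rc a b lo hi) subset_rfl (fun T => ∃ u v : Site, u.2 = lo ∧ v.2 = hi ∧ Cn T u v)

theorem E1_local (k h : ℤ) : Loc (Rc 0 (2 * k) (-h) h) (E1 k h) :=
  Loc.of_inter (D := Rc 0 (2 * k) (-h) h) subset_rfl (fun T => ∃ u v : Site, u.2 = h ∧
    2 * k - 1 ≤ 2 * v.1 + v.2 ∧ v.2 ≤ 0 ∧ Cn T u v)

theorem VX_upper (a b lo hi : ℤ) : IsUpperSet (VX a b lo hi) := by
  rintro S S' hS ⟨u, v, h1, h2, h3⟩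
  exact ⟨u, v, h1, h2, h3.mono (Set.inter_subset_inter_left _ hS)⟩

theorem E1_upper (k h : ℤ) : IsUpperSet (E1 k h) := by
  rintro S S' hS ⟨u, v, h1, h2, h3, h4⟩
  exact ⟨u, v, h1, h2, h3, h4.mono (Set.inter_subset_inter_left _ hS)⟩

/-- Reflection as an equivalence. -/
def rhoE : Site ≃ Site := ⟨rho, rho, rho_rho, rho_rho⟩

theorem EP_half {μ : Measure (Site → ℝ)} (hμ : IsUniformCoupling μ) {k h : ℤ} (hk : 1 ≤ k)
    (hh : 1 ≤ h) (A : Set Site) : 1 / 2 ≤ Pr μ (1 / 2) (EP k h A) := by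
  have hZf : (Zr k h A).Finite := (Rc_finite 0 (2 * k) (-h) h).subset (fun w hw => hw.1)
  have h1 : Pr μ (1 / 2) {B | rho ⁻¹' Bᶜ ∈ EP k h A} = Pr μ (1 / 2) (EP k h A) := by
    have e1 := Pr_flip' hμ (p := 1 / 2) (by norm_num) (by norm_num)
      (A := rho ⁻¹' Zr k h A)
      ((hZf.preimage (rhoE.injective.injOn (s := _)))) (E := {B | rho ⁻¹' B ∈ EP k h A}) (by
        intro S S' hS hE
        refine EP_local A _ _ ?_ hE
        ext v
        have := Set.ext_iff.mp hS (rho v)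
        simp only [Set.mem_inter_iff, Set.mem_preimage, rho_rho] at *
        exact this)
    have e2 := Pr_equiv' hμ (p := 1 / 2) (by norm_num) (by norm_num) rhoE hZf (EP_local A)
    rw [← e2]
    rw [show (1 : ℝ) - 1 / 2 = 1 / 2 by norm_num] at e1
    exact e1
  have h2 : (1 : ℝ) ≤ Pr μ (1 / 2) (EP k h A) + Pr μ (1 / 2) {B | rho ⁻¹' Bᶜ ∈ EP k h A} := by
    calc (1 : ℝ) = Pr μ (1 / 2) Set.univ := (Pr_univ hμ _).symm
      _ ≤ Pr μ (1 / 2) (EP k h A ∪ {B | rho ⁻¹' Bᶜ ∈ EP k h A}) :=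
        Pr_mono hμ (fun B _ => EP_dual hk hh A B)
      _ ≤ _ := Pr_union_le hμ _ _ _
  linarith

theorem E1_bound {μ : Measure (Site → ℝ)} (hμ : IsUniformCoupling μ) {k h : ℤ} (hk : 1 ≤ k)
    (hh : 1 ≤ h) : 1 / 2 * Pr μ (1 / 2) (VX 0 (2 * k) 0 h) ≤ Pr μ (1 / 2) (E1 k h) := by
  classical
  set Sf := (Rc_finite 0 (2 * k) 0 h).toFinset with hSf
  set s := Sf.powerset.filter (fun A : Finset Site =>
    ∃ u v : Site, u.2 = 0 ∧ v.2 = h ∧ Cn (hull k h A \ A) u v) with hs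
  have hRf := Rc_finite 0 (2 * k) (-h) h
  have hZf : ∀ A, (Zr k h A).Finite := fun A => hRf.subset (fun w hw => hw.1)
  have hHf : ∀ A, (hull k h A).Finite := fun A => (Rc_finite 0 (2 * k) 0 h).subset (fun w hw => hw.1)
  have hVX : ∀ (A : Set Site) (B : Set Site), (∃ u v : Site, u.2 = 0 ∧ v.2 = h ∧
      Cn (hull k h A \ A) u v) → Wcl k h B = A → B ∈ VX 0 (2 * k) 0 h := by
    rintro A B ⟨u, v, h1, h2, h3⟩ rfl
    refine ⟨u, v, h1, h2, h3.mono ?_⟩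
    intro w hw
    exact (show w ∈ B ∩ Rc 0 (2 * k) 0 h from ⟨hull_black hw.1 hw.2, hw.1.1⟩)
  calc 1 / 2 * Pr μ (1 / 2) (VX 0 (2 * k) 0 h)
      ≤ 1 / 2 * ∑ A ∈ s, Pr μ (1 / 2) {B | Wcl k h B = A} := by
        refine mul_le_mul_of_nonneg_left ?_ (by norm_num)
        refine le_trans (Pr_mono hμ ?_) (Pr_biUnion_le hμ (1 / 2) s (fun A => {B | Wcl k h B = A}))
        intro B hB
        have hsub : Wcl k h B ⊆ Rc 0 (2 * k) 0 h := fun w hw => (Wcl_sub hw).1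
        have hf : (Wcl k h B).Finite := (Rc_finite 0 (2 * k) 0 h).subset hsub
        refine ⟨hf.toFinset, ?_, by simp⟩
        rw [hs, Finset.mem_filter, Finset.mem_powerset]
        refine ⟨?_, by simpa using VX_hull hk hh hB⟩
        intro w hw
        simp only [hSf, Set.Finite.mem_toFinset] at hw ⊢
        exact hsub hw
    _ = ∑ A ∈ s, Pr μ (1 / 2) {B | Wcl k h B = A} * (1 / 2) := by
        rw [mul_comm, Finset.sum_mul]
    _ ≤ ∑ A ∈ s, Pr μ (1 / 2) ({B | Wcl k h B = A} ∩ EP k h A) := by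
        refine Finset.sum_le_sum (fun A _ => ?_)
        rw [Pr_indep' hμ (hHf A) (hZf A) ?_ (Wcl_local (A : Set Site)) (EP_local (A : Set Site))]
        · exact mul_le_mul_of_nonneg_left (EP_half hμ hk hh _) (Pr_nonneg _ _ _)
        · rw [Set.disjoint_left]; intro w h1 h2; exact h2.2.1 h1
    _ ≤ Pr μ (1 / 2) (E1 k h) := by
        refine Pr_sum_le hμ _ s _ _ (A := Rc 0 (2 * k) (-h) h) hRf ?_ ?_ ?_
        · intro A _
          refine ((Wcl_local (A : Set Site)).mono ?_).inter ((EP_local (A : Set Site)).mono ?_)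
          · intro w hw; obtain ⟨z1, z2, z3, z4⟩ := hw.1
            exact ⟨z1, z2, by omega, z4⟩
          · exact fun w hw => hw.1
        · rintro A hA B ⟨h1, h2⟩
          rw [hs, Finset.mem_filter] at hA
          have h3 := hVX A B hA.2 h1
          have h1' : Wcl k h B = A := h1
          rw [← h1'] at h2
          exact EP_VX_E1 hk hh h3 h2
        · rintro A _ A' _ hne B ⟨h1, _⟩ ⟨h2, _⟩
          exact hne (Finset.coe_injective (Eq.trans (Eq.symm h1) h2))

theorem VX_double {μ : Measure (Site → ℝ)} (hμ : IsUniformCoupling μ) {k h : ℤ} (hk : 1 ≤ k)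
    (hh : 1 ≤ h) :
    (1 / 2 * Pr μ (1 / 2) (VX 0 (2 * k) 0 h)) ^ 2 ≤ Pr μ (1 / 2) (VX 0 (2 * k) (-h) h) := by
  have hRf := Rc_finite 0 (2 * k) (-h) h
  have h1 := E1_bound hμ hk hh
  have h2 : Pr μ (1 / 2) {B | rhoE ⁻¹' B ∈ E1 k h} = Pr μ (1 / 2) (E1 k h) :=
    Pr_equiv' hμ (by norm_num) (by norm_num) rhoE hRf (E1_local k h)
  have hloc : Loc (Rc 0 (2 * k) (-h) h) {B | rhoE ⁻¹' B ∈ E1 k h} := by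
    intro S S' hS hE
    refine E1_local k h _ _ ?_ hE
    ext v
    have := Set.ext_iff.mp hS (rho v)
    have e : rho v ∈ Rc 0 (2 * k) (-h) h ↔ v ∈ Rc 0 (2 * k) (-h) h := by
      simp only [Rc, rho, Set.mem_ofPred_eq]; omega
    simp only [Set.mem_inter_iff, Set.mem_preimage, rhoE, Equiv.coe_fn_mk, e] at *
    exact this
  have hfkg := Pr_fkg' hμ (p := 1 / 2) (by norm_num) (by norm_num) hRf (E1_local k h) hloc
    (E1_upper k h) (fun S S' hS hE => E1_upper k h (Set.preimage_mono hS) hE)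
  rw [h2] at hfkg
  have h0 := Pr_nonneg μ (1 / 2) (VX 0 (2 * k) 0 h)
  have h3 : Pr μ (1 / 2) (E1 k h ∩ {B | rhoE ⁻¹' B ∈ E1 k h}) ≤ Pr μ (1 / 2) (VX 0 (2 * k) (-h) h) := by
    refine Pr_mono hμ ?_
    rintro B ⟨⟨u, v, a1, a2, a3, a4⟩, ⟨u', v', b1, b2, b3, b4⟩⟩
    have c4 : Cn (B ∩ Rc 0 (2 * k) (-h) h) (rho u') (rho v') := by
      refine b4.map rho (fun a b h => rho_adj h) ?_
      rintro w ⟨hw1, z1, z2, z3, z4⟩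
      refine ⟨hw1, ?_, ?_, ?_, ?_⟩ <;> simp only [rho] <;> omega
    obtain ⟨t, ht1, ht2⟩ := rect_excl4 hk hh a4.self c4.self (fun w hw => (Cn.right hw).2)
      (fun w hw => (Cn.right hw).2) a1 a2 a3 (by simp only [rho]; omega) (by simp only [rho]; omega)
      (by simp only [rho]; omega)
    exact ⟨rho u', u, by simp only [rho]; omega, a1, Cn.trans ht2 (Cn.symm ht1)⟩
  nlinarith [h1, h3, hfkg, h0]

/-! ### Part 5: crossing estimates and rings -/

/-- General crossing event. -/
def CX (D : Set Site) (U V : Site → Prop) : Set (Set Site) :=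
  {B | ∃ u v : Site, U u ∧ V v ∧ Cn (B ∩ D) u v}

theorem CX_local (D : Set Site) (U V : Site → Prop) : Loc D (CX D U V) :=
  Loc.of_inter (D := D) subset_rfl (fun T => ∃ u v : Site, U u ∧ V v ∧ Cn T u v)

theorem CX_upper (D : Set Site) (U V : Site → Prop) : IsUpperSet (CX D U V) := by
  rintro S S' hS ⟨u, v, h1, h2, h3⟩
  exact ⟨u, v, h1, h2, h3.mono (Set.inter_subset_inter_left _ hS)⟩

theorem VX_eq (a b lo hi : ℤ) : VX a b lo hi = CX (Rc a b lo hi) (fun u => u.2 = lo) (fun v => v.2 = hi) :=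
  rfl

theorem CX_le {μ : Measure (Site → ℝ)} (hμ : IsUniformCoupling μ) {p : ℝ} (hp : 0 ≤ p) (hp1 : p ≤ 1)
    (τ : Site ≃ Site) (hτ : ∀ a b, adj a b → adj (τ a) (τ b)) {D D' : Set Site}
    {U V U' V' : Site → Prop} (hf : D'.Finite) (hD : ∀ v ∈ D', τ v ∈ D)
    (hU : ∀ v ∈ D', U' v → U (τ v)) (hV : ∀ v ∈ D', V' v → V (τ v)) :
    Pr μ p (CX D' U' V') ≤ Pr μ p (CX D U V) := by
  rw [← Pr_equiv' hμ hp hp1 τ hf (CX_local D' U' V')]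
  refine Pr_mono hμ ?_
  rintro B ⟨u, v, h1, h2, h3⟩
  refine ⟨τ u, τ v, hU _ h3.left.2 h1, hV _ h3.right.2 h2, h3.map τ hτ ?_⟩
  rintro w ⟨hw1, hw2⟩
  exact ⟨hw1, hD w hw2⟩

/-- Translation. -/
def tr (t : Site) : Site ≃ Site := Equiv.addRight t

theorem tr_apply (t v : Site) : tr t v = v + t := rfl

theorem tr_adj (t : Site) (a b : Site) (h : adj a b) : adj (tr t a) (tr t b) := adj_add t h

/-- Swap of coordinates. -/
def sw : Site ≃ Site := Equiv.prodComm ℤ ℤ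

theorem sw_apply (v : Site) : sw v = (v.2, v.1) := rfl

theorem sw_adj (a b : Site) (h : adj a b) : adj (sw a) (sw b) := by
  unfold adj at *; simp only [sw_apply]; omega

/-- Rotation. -/
def rot : Site ≃ Site where
  toFun v := (-v.1 - v.2, v.1)
  invFun v := (v.2, -v.1 - v.2)
  left_inv v := by ext <;> simp
  right_inv v := by ext <;> simp <;> ring

theorem rot_apply (v : Site) : rot v = (-v.1 - v.2, v.1) := rfl

theorem rot_symm_apply (v : Site) : rot.symm v = (v.2, -v.1 - v.2) := rfl

theorem rot_adj (a b : Site) (h : adj a b) : adj (rot a) (rot b) := by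
  unfold adj at *; simp only [rot_apply]; omega

theorem rot_symm_adj (a b : Site) (h : adj a b) : adj (rot.symm a) (rot.symm b) := by
  unfold adj at *; simp only [rot_symm_apply]; omega

theorem TT_finite (n : ℤ) : (TT n).Finite := by
  refine (Bx_finite n).subset ?_
  rintro v ⟨h1, h2, h3⟩
  refine ⟨?_, ?_, ?_, ?_⟩ <;> omega

theorem Ywin_local (n : ℤ) : Loc (TT n) {B | Ywin n B} :=
  Loc.of_inter (D := TT n) subset_rfl (fun T => ∃ a b c : Site, a.1 = 0 ∧ b.2 = 0 ∧ c.1 + c.2 = n ∧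
    Cn T a b ∧ Cn T a c)

theorem Ywin_half {μ : Measure (Site → ℝ)} (hμ : IsUniformCoupling μ) (n : ℕ) :
    1 / 2 ≤ Pr μ (1 / 2) {B | Ywin n B} := by
  have h1 : (1 : ℝ) ≤ Pr μ (1 / 2) {B | Ywin n B} + Pr μ (1 / 2) {B | Bᶜ ∈ {B | Ywin n B}} := by
    calc (1 : ℝ) = Pr μ (1 / 2) Set.univ := (Pr_univ hμ _).symm
      _ ≤ Pr μ (1 / 2) ({B | Ywin n B} ∪ {B | Bᶜ ∈ {B | Ywin n B}}) :=
        Pr_mono hμ (fun B _ => Y_exists n B)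
      _ ≤ _ := Pr_union_le hμ _ _ _
  rw [Pr_flip' hμ (by norm_num) (by norm_num) (TT_finite n) (Ywin_local n)] at h1
  norm_num at h1 ⊢
  linarith

theorem VX_base {μ : Measure (Site → ℝ)} (hμ : IsUniformCoupling μ) (m : ℕ) (hm : 1 ≤ m) :
    1 / 4 ≤ Pr μ (1 / 2) (VX 0 (8 * m) 0 (2 * m)) := by
  have h0 := Ywin_half hμ (4 * m)
  have key : ∀ (B : Set Site) (b c : Site), b.2 = 0 → 2 * (m : ℤ) ≤ c.2 → Cn (B ∩ TT (4 * m)) b c →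
      B ∈ VX 0 (8 * m) 0 (2 * m) := by
    intro B b c hb hc hbc
    obtain ⟨u, v, h1, h2, -, h4⟩ := hbc.seg (fun w => w.2) 1 0 (2 * m)
      (fun a b h => (adj_le h).2.2.1) le_rfl hb.le hc (by omega)
    have hu := h4.left.2
    have hv := h4.right.2
    simp only [Set.mem_ofPred_eq] at hu hv
    refine ⟨u, v, by omega, by omega, h4.mono ?_⟩
    rintro w ⟨⟨hw1, hw2, hw3, hw4⟩, hw5, hw6⟩
    exact ⟨hw1, by omega, by omega, by omega, by omega⟩
  have h1 : Pr μ (1 / 2) {B | Ywin (4 * m : ℕ) B} ≤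
      Pr μ (1 / 2) (VX 0 (8 * m) 0 (2 * m)) + Pr μ (1 / 2) {B | sw ⁻¹' B ∈ VX 0 (8 * m) 0 (2 * m)} := by
    refine le_trans (Pr_mono hμ ?_) (Pr_union_le hμ _ _ _)
    rintro B ⟨a, b, c, ha, hb, hc, hab, hac⟩
    push_cast at hc hab hac
    by_cases h2 : 2 * (m : ℤ) ≤ c.2
    · left
      exact key B b c hb h2 (hab.symm.trans hac)
    · right
      refine key _ (sw a) (sw c) ha ?_ (hac.map sw sw_adj ?_)
      · simp only [sw_apply]; omega
      · rintro w ⟨hw1, hw2, hw3, hw4⟩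
        refine ⟨?_, ?_, ?_, ?_⟩
        · exact hw1
        · exact hw3
        · exact hw2
        · simp only [sw_apply]; omega
  rw [Pr_equiv' hμ (by norm_num) (by norm_num) sw (Rc_finite _ _ _ _) (VX_local _ _ _ _)] at h1
  linarith

theorem VX_twice {μ : Measure (Site → ℝ)} (hμ : IsUniformCoupling μ) {k h : ℤ} (hk : 1 ≤ k)
    (hh : 1 ≤ h) {c : ℝ} (hc : 0 ≤ c) (hV : c ≤ Pr μ (1 / 2) (VX 0 (2 * k) 0 (2 * h))) :
    (1 / 2 * c) ^ 2 ≤ Pr μ (1 / 2) (VX 0 (2 * k) 0 (2 * (2 * h))) := by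
  have h1 := VX_double hμ hk (h := 2 * h) (by omega)
  have h2 : (1 / 2 * c) ^ 2 ≤ (1 / 2 * Pr μ (1 / 2) (VX 0 (2 * k) 0 (2 * h))) ^ 2 := by gcongr
  refine h2.trans (h1.trans ?_)
  rw [VX_eq, VX_eq]
  refine CX_le hμ (by norm_num) (by norm_num) (tr (-h, 2 * h)) (tr_adj _) (Rc_finite _ _ _ _) ?_ ?_ ?_
  · rintro v ⟨h1, h2, h3, h4⟩
    refine ⟨?_, ?_, ?_, ?_⟩ <;> simp only [tr_apply, Prod.fst_add, Prod.snd_add] <;> omega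
  · intro v _ hv; simp only [tr_apply, Prod.snd_add]; omega
  · intro v _ hv; simp only [tr_apply, Prod.snd_add]; omega

theorem VX_tall {μ : Measure (Site → ℝ)} (hμ : IsUniformCoupling μ) (m : ℕ) (hm : 1 ≤ m) {p : ℝ}
    (hp : 1 / 2 ≤ p) :
    (1 / 2) ^ 62 ≤ Pr μ p (VX 0 (8 * m) 0 (32 * m)) := by
  have h0 := VX_base hμ m hm
  rw [show (8 * m : ℤ) = 2 * (4 * m) by ring] at h0
  have h1 := VX_twice hμ (by omega) (by omega) (by norm_num) h0
  have h2 := VX_twice hμ (by omega) (by omega) (by norm_num) h1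
  have h3 := VX_twice hμ (by omega) (by omega) (by norm_num) h2
  have h4 := VX_twice hμ (by omega) (by omega) (by norm_num) h3
  rw [show (2 * (4 * m) : ℤ) = 8 * m by ring, show (2 * (2 * (2 * (2 * (2 * m)))) : ℤ) = 32 * m by ring] at h4
  refine le_trans ?_ (h4.trans (Pr_mono_p hμ hp (VX_upper _ _ _ _)))
  norm_num

/-- One side of the ring. -/
def side (τ : Site ≃ Site) (m : ℤ) : Set (Set Site) :=
  CX {v | τ v ∈ Rc (8 * m) (16 * m) (-(16 * m)) (16 * m)} (fun u => (τ u).2 = -(16 * m))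
    (fun u => (τ u).2 = 16 * m)

theorem side_prob {μ : Measure (Site → ℝ)} (hμ : IsUniformCoupling μ) (m : ℕ) (hm : 1 ≤ m) {p : ℝ}
    (hp : 1 / 2 ≤ p) (hp1 : p ≤ 1) (τ : Site ≃ Site)
    (hτ : ∀ a b, adj a b → adj (τ.symm a) (τ.symm b)) :
    (1 / 2) ^ 62 ≤ Pr μ p (side τ m) := by
  refine (VX_tall hμ m hm hp).trans ?_
  rw [VX_eq, side]
  refine CX_le hμ (by linarith) hp1 ((tr (12 * m, -(16 * m))).trans τ.symm)
    (fun a b h => hτ _ _ (tr_adj _ _ _ h)) (Rc_finite _ _ _ _) ?_ ?_ ?_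
  · rintro v ⟨h1, h2, h3, h4⟩
    simp only [Set.mem_ofPred_eq, Equiv.trans_apply, Equiv.apply_symm_apply]
    refine ⟨?_, ?_, ?_, ?_⟩ <;> simp only [tr_apply, Prod.fst_add, Prod.snd_add] <;> omega
  · intro v _ hv
    simp only [Equiv.trans_apply, Equiv.apply_symm_apply, tr_apply, Prod.snd_add]; omega
  · intro v _ hv
    simp only [Equiv.trans_apply, Equiv.apply_symm_apply, tr_apply, Prod.snd_add]; omega

/-- The annulus of the ring. -/
def Ann (m : ℤ) : Set Site := Bx (16 * m) \ Bx (2 * m)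

/-- The ring event. -/
def RG (m : ℤ) : Set (Set Site) :=
  side (Equiv.refl _) m ∩ (side rot m ∩ side (rot.trans rot) m)

theorem side_sub0 {m : ℤ} (hm : 1 ≤ m) {v : Site}
    (hv : v ∈ Rc (8 * m) (16 * m) (-(16 * m)) (16 * m)) : v ∈ Ann m := by
  obtain ⟨h1, h2, h3, h4⟩ := hv
  refine ⟨⟨?_, ?_, ?_, ?_⟩, ?_⟩ <;> try omega
  rintro ⟨g1, g2, g3, g4⟩
  omega

theorem side_sub1 {m : ℤ} (hm : 1 ≤ m) {v : Site}
    (hv : rot v ∈ Rc (8 * m) (16 * m) (-(16 * m)) (16 * m)) : v ∈ Ann m := by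
  obtain ⟨h1, h2, h3, h4⟩ := hv
  simp only [rot_apply] at h1 h2 h3 h4
  refine ⟨⟨?_, ?_, ?_, ?_⟩, ?_⟩ <;> try omega
  rintro ⟨g1, g2, g3, g4⟩
  omega

theorem side_sub2 {m : ℤ} (hm : 1 ≤ m) {v : Site}
    (hv : rot (rot v) ∈ Rc (8 * m) (16 * m) (-(16 * m)) (16 * m)) : v ∈ Ann m := by
  obtain ⟨h1, h2, h3, h4⟩ := hv
  simp only [rot_apply] at h1 h2 h3 h4
  refine ⟨⟨?_, ?_, ?_, ?_⟩, ?_⟩ <;> try omega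
  rintro ⟨g1, g2, g3, g4⟩
  omega

theorem RG_local {m : ℤ} (hm : 1 ≤ m) : Loc (Ann m) (RG m) := by
  refine Loc.inter ?_ (Loc.inter ?_ ?_)
  · exact (CX_local _ _ _).mono (fun v hv => side_sub0 hm hv)
  · exact (CX_local _ _ _).mono (fun v hv => side_sub1 hm hv)
  · exact (CX_local _ _ _).mono (fun v hv => side_sub2 hm hv)

theorem RG_upper (m : ℤ) : IsUpperSet (RG m) :=
  (CX_upper _ _ _).inter ((CX_upper _ _ _).inter (CX_upper _ _ _))

theorem Ann_finite (m : ℤ) : (Ann m).Finite := (Bx_finite _).subset Set.diff_subset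

theorem RG_prob {μ : Measure (Site → ℝ)} (hμ : IsUniformCoupling μ) (m : ℕ) (hm : 1 ≤ m) {p : ℝ}
    (hp : 1 / 2 ≤ p) (hp1 : p ≤ 1) : (1 / 2) ^ 186 ≤ Pr μ p (RG m) := by
  have hm' : (1 : ℤ) ≤ m := by exact_mod_cast hm
  have l0 : Loc (Ann m) (side (Equiv.refl _) m) := (CX_local _ _ _).mono (fun v hv => side_sub0 hm' hv)
  have l1 : Loc (Ann m) (side rot m) := (CX_local _ _ _).mono (fun v hv => side_sub1 hm' hv)
  have l2 : Loc (Ann m) (side (rot.trans rot) m) :=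
    (CX_local _ _ _).mono (fun v hv => side_sub2 hm' hv)
  have p0 := side_prob hμ m hm hp hp1 (Equiv.refl _) (fun a b h => h)
  have p1 := side_prob hμ m hm hp hp1 rot rot_symm_adj
  have p2 := side_prob hμ m hm hp hp1 (rot.trans rot) (fun a b h => rot_symm_adj _ _ (rot_symm_adj _ _ h))
  have f1 := Pr_fkg' hμ (by linarith) hp1 (Ann_finite m) l1 l2 (CX_upper _ _ _) (CX_upper _ _ _)
  have f2 := Pr_fkg' hμ (by linarith) hp1 (Ann_finite m) l0 (l1.inter l2) (CX_upper _ _ _)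
    ((CX_upper _ _ _).inter (CX_upper _ _ _))
  refine le_trans ?_ f2
  calc ((1 : ℝ) / 2) ^ 186 = (1 / 2) ^ 62 * ((1 / 2) ^ 62 * (1 / 2) ^ 62) := by ring
    _ ≤ Pr μ p (side (Equiv.refl _) m) * (Pr μ p (side rot m) * Pr μ p (side (rot.trans rot) m)) := by
      gcongr
    _ ≤ _ := mul_le_mul_of_nonneg_left f1 (Pr_nonneg _ _ _)

theorem X_lip {a b : Site} (h : adj a b) : 2 * b.1 + b.2 ≤ 2 * a.1 + a.2 + 2 := by
  unfold adj at h; omega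

/-- A path crossing the strip in a bounded range of rows meets a vertical crossing. -/
theorem meet0 {m : ℤ} (hm : 1 ≤ m) {S D : Set Site} {u v s t : Site} (h : Cn S u v)
    (hS : ∀ w ∈ S, 8 * m ≤ 2 * w.1 + w.2 → 2 * w.1 + w.2 ≤ 16 * m →
      -(16 * m) ≤ w.2 ∧ w.2 ≤ 16 * m) (hu : 2 * u.1 + u.2 ≤ 8 * m + 1)
    (hv : 16 * m - 1 ≤ 2 * v.1 + v.2) (hD : Cn D s t) 
    (hDs : D ⊆ Rc (8 * m) (16 * m) (-(16 * m)) (16 * m)) (hs : s.2 = -(16 * m)) (ht : t.2 = 16 * m) :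
    ∃ w, Cn S u w ∧ Cn D s w := by
  obtain ⟨a, b, h1, h2, h3, h4⟩ := h.self.seg (fun w => 2 * w.1 + w.2) 2 (8 * m + 1) (16 * m - 1)
    (fun a b h => X_lip h) (by norm_num) hu hv (by omega)
  obtain ⟨w, hw1, hw2⟩ := rect_excl (a := 8 * m) (b := 16 * m) (lo := -(16 * m)) (hi := 16 * m)
    hD.self h4 (fun w hw => hDs (Cn.right hw)) (by
      rintro w ⟨hw1, hw2, hw3⟩
      have := hS w (Cn.right hw1) (by omega) (by omega)
      exact ⟨by omega, by omega, this.1, this.2⟩) hs ht h1 h2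
  exact ⟨w, hw2.1, hw1⟩

/-- A path through the annulus which escapes. -/
theorem meet_out {m : ℤ} (hm : 1 ≤ m) {B : Set Site} (hB : B ∈ RG m) :
    ∃ z, z ∈ B ∩ Ann m ∧ ∀ (S : Set Site) (u v : Site), Cn S u v → u ∈ Bx (2 * m) → v ∉ Bx (16 * m) →
      ∃ w, Cn (S ∩ Bx (16 * m)) u w ∧ Cn (B ∩ Ann m) z w := by
  obtain ⟨⟨s0, t0, hs0, ht0, c0⟩, ⟨s1, t1, hs1, ht1, c1⟩, ⟨s2, t2, hs2, ht2, c2⟩⟩ := hB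
  have c0 : Cn (B ∩ Rc (8 * m) (16 * m) (-(16 * m)) (16 * m)) s0 t0 := c0
  have hs0 : s0.2 = -(16 * m) := hs0
  have ht0 : t0.2 = 16 * m := ht0
  have c0' : Cn (B ∩ Ann m) s0 t0 := c0.mono (Set.inter_subset_inter_right _ (fun v hv => side_sub0 hm hv))
  have c1' : Cn (B ∩ Ann m) s1 t1 := c1.mono (Set.inter_subset_inter_right _ (fun v hv => side_sub1 hm hv))
  have c2' : Cn (B ∩ Ann m) s2 t2 := c2.mono (Set.inter_subset_inter_right _ (fun v hv => side_sub2 hm hv))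
  -- images
  have d1 : Cn ((rot.symm ⁻¹' B) ∩ Rc (8 * m) (16 * m) (-(16 * m)) (16 * m)) (rot s1) (rot t1) := by
    refine c1.map rot rot_adj ?_
    rintro a ⟨h1, h2⟩
    exact ⟨by simpa using h1, h2⟩
  have d2 : Cn ((rot.symm ⁻¹' (rot.symm ⁻¹' B)) ∩ Rc (8 * m) (16 * m) (-(16 * m)) (16 * m))
      (rot (rot s2)) (rot (rot t2)) := by
    refine c2.map (fun v => rot (rot v)) (fun a b h => rot_adj _ _ (rot_adj _ _ h)) ?_
    rintro a ⟨h1, h2⟩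
    exact ⟨by simpa using h1, h2⟩
  have back1 : ∀ w, Cn ((rot.symm ⁻¹' B) ∩ Rc (8 * m) (16 * m) (-(16 * m)) (16 * m)) (rot s1) w →
      Cn (B ∩ Ann m) s1 (rot.symm w) := by
    intro w hw
    have := hw.map rot.symm rot_symm_adj (T := B ∩ Ann m)
      (fun a ha => ⟨ha.1, side_sub1 hm (by simpa using ha.2)⟩)
    simpa using this
  have back2 : ∀ w, Cn ((rot.symm ⁻¹' (rot.symm ⁻¹' B)) ∩ Rc (8 * m) (16 * m) (-(16 * m)) (16 * m))
      (rot (rot s2)) w → Cn (B ∩ Ann m) s2 (rot.symm (rot.symm w)) := by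
    intro w hw
    have := hw.map (fun v => rot.symm (rot.symm v)) (fun a b h => rot_symm_adj _ _ (rot_symm_adj _ _ h))
      (T := B ∩ Ann m) (fun a ha => ⟨ha.1, side_sub2 hm (by simpa using ha.2)⟩)
    simpa using this
  have I01 : Cn (B ∩ Ann m) s0 s1 := by
    have e := (c0.symm.map (T := (rot.symm ⁻¹' B) ∩ (rot.symm ⁻¹' Rc (8 * m) (16 * m) (-(16 * m)) (16 * m)))
      rot rot_adj (fun a ha => ⟨by simpa using ha.1, by simpa using ha.2⟩))
    have a1 := c0.left.2
    have a2 := c0.right.2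
    obtain ⟨g1, g2, g3, g4⟩ := a1
    obtain ⟨k1, k2, k3, k4⟩ := a2
    obtain ⟨w, hw1, hw2⟩ := meet0 hm e (by
      rintro w ⟨-, l1, l2, l3, l4⟩ l5 l6
      simp only [rot_symm_apply] at l1 l2 l3 l4
      omega) (by simp only [rot_apply]; omega) (by simp only [rot_apply]; omega) d1
      Set.inter_subset_right hs1 ht1
    have f1 := back1 w hw2
    have f2 := hw1.map (T := B ∩ Ann m) rot.symm rot_symm_adj
      (fun a ha => ⟨ha.1, side_sub0 hm ha.2⟩)
    simp only [Equiv.symm_apply_apply] at f2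
    exact (c0'.trans f2).trans f1.symm
  have I12 : Cn (B ∩ Ann m) s1 s2 := by
    have e := (d1.symm.map (T := (rot.symm ⁻¹' (rot.symm ⁻¹' B)) ∩
      (rot.symm ⁻¹' Rc (8 * m) (16 * m) (-(16 * m)) (16 * m)))
      rot rot_adj (fun a ha => ⟨by simpa using ha.1, by simpa using ha.2⟩))
    obtain ⟨g1, g2, g3, g4⟩ := d1.left.2
    obtain ⟨k1, k2, k3, k4⟩ := d1.right.2
    have hs1' : (rot s1).2 = -(16 * m) := hs1
    have ht1' : (rot t1).2 = 16 * m := ht1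
    obtain ⟨w, hw1, hw2⟩ := meet0 hm e (by
      rintro w ⟨-, l1, l2, l3, l4⟩ l5 l6
      simp only [rot_symm_apply] at l1 l2 l3 l4
      omega) (by rw [rot_apply (rot t1)]; omega) (by rw [rot_apply (rot s1)]; omega) d2
      Set.inter_subset_right hs2 ht2
    have f1 := back2 w hw2
    have f2 := hw1.map (T := B ∩ Ann m) (fun v => rot.symm (rot.symm v))
      (fun a b h => rot_symm_adj _ _ (rot_symm_adj _ _ h))
      (fun a ha => ⟨ha.1, side_sub1 hm (by simpa using ha.2)⟩)
    simp only [Equiv.symm_apply_apply] at f2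
    exact (c1'.trans f2).trans f1.symm
  refine ⟨s0, c0'.left, ?_⟩
  intro S u v hc hu hv
  set T : Set Site := {w | 2 * w.1 + w.2 ≤ 16 * m ∧ -w.1 - 2 * w.2 ≤ 16 * m ∧ w.2 - w.1 ≤ 16 * m} with hT
  have hTB : T ⊆ Bx (16 * m) := by
    rintro w ⟨h1, h2, h3⟩
    refine ⟨?_, ?_, ?_, ?_⟩ <;> omega
  have huT : u ∈ T := by
    obtain ⟨h1, h2, h3, h4⟩ := hu
    refine ⟨?_, ?_, ?_⟩ <;> omega
  obtain ⟨a, b, ha, hab, -, hb, -⟩ := hc.first_exit T huT (fun h => hv (hTB h))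
  have hST : S ∩ T ⊆ S ∩ Bx (16 * m) := Set.inter_subset_inter_right _ hTB
  have haT := ha.right.2
  have hcase : 16 * m - 1 ≤ 2 * a.1 + a.2 ∨ 16 * m - 1 ≤ -a.1 - 2 * a.2 ∨ 16 * m - 1 ≤ a.2 - a.1 := by
    by_contra hne
    apply hb
    simp only [not_or] at hne
    unfold adj at hab
    refine ⟨?_, ?_, ?_⟩ <;> omega
  obtain ⟨u1, u2, u3, u4⟩ := hu
  rcases hcase with h1 | h1 | h1
  · obtain ⟨w, hw1, hw2⟩ := meet0 hm ha (by rintro w ⟨-, l1, l2, l3⟩ l4 l5; omega) (by omega) h1 c0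
      Set.inter_subset_right hs0 ht0
    exact ⟨w, hw1.mono hST, hw2.mono (Set.inter_subset_inter_right _ (fun v hv => side_sub0 hm hv))⟩
  · have e := ha.map (T := rot.symm ⁻¹' (S ∩ T)) rot rot_adj (fun a ha => by simpa using ha)
    obtain ⟨w, hw1, hw2⟩ := meet0 hm e (by
      rintro w ⟨-, l1, l2, l3⟩ l4 l5
      simp only [rot_symm_apply] at l1 l2 l3
      omega) (by simp only [rot_apply]; omega) (by simp only [rot_apply]; omega) d1
      Set.inter_subset_right hs1 ht1
    refine ⟨rot.symm w, ?_, I01.trans (back1 w hw2)⟩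
    have f2 := hw1.map (T := S ∩ Bx (16 * m)) rot.symm rot_symm_adj (fun a ha => hST ha)
    simpa using f2
  · have e := ha.map (T := rot.symm ⁻¹' (rot.symm ⁻¹' (S ∩ T))) (fun v => rot (rot v))
      (fun a b h => rot_adj _ _ (rot_adj _ _ h)) (fun a ha => by simpa using ha)
    obtain ⟨w, hw1, hw2⟩ := meet0 hm e (by
      rintro w ⟨-, l1, l2, l3⟩ l4 l5
      simp only [rot_symm_apply] at l1 l2 l3
      omega) (by simp only [rot_apply]; omega) (by simp only [rot_apply]; omega) d2
      Set.inter_subset_right hs2 ht2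
    refine ⟨rot.symm (rot.symm w), ?_, (I01.trans I12).trans (back2 w hw2)⟩
    have f2 := hw1.map (T := S ∩ Bx (16 * m)) (fun v => rot.symm (rot.symm v))
      (fun a b h => rot_symm_adj _ _ (rot_symm_adj _ _ h)) (fun a ha => hST ha)
    simpa using f2

/-! ### Part 6: one-arm probabilities -/

theorem Bx_mono {r s : ℤ} (h : r ≤ s) : Bx r ⊆ Bx s := by
  rintro v ⟨h1, h2, h3, h4⟩
  exact ⟨by omega, by omega, by omega, by omega⟩

theorem Cn.clip {S : Set Site} {u v : Site} {n : ℤ} (h : Cn S u v) (hu : u ∈ Bx n) (hv : v ∉ Bx (n - 1)) :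
    ∃ v', Cn (S ∩ Bx n) u v' ∧ v' ∉ Bx (n - 1) := by
  by_cases hu' : u ∈ Bx (n - 1)
  · obtain ⟨a, b, h1, h2, h3, h4, -⟩ := h.first_exit _ hu' hv
    refine ⟨b, Cn.tail (h1.mono (Set.inter_subset_inter_right _ (Bx_mono (by omega)))) h2 ⟨h3, ?_⟩, h4⟩
    have ha := h1.right.2
    obtain ⟨g1, g2, g3, g4⟩ := ha
    have := adj_le h2
    refine ⟨?_, ?_, ?_, ?_⟩ <;> omega
  · exact ⟨u, .refl ⟨h.left, hu⟩, hu'⟩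

def AQ (m n : ℤ) : Set (Set Site) := CX (Bx n) (fun u => u ∈ Bx m) (fun v => v ∉ Bx (n - 1))

/-- One-arm event. -/
def arm (n : ℤ) : Set (Set Site) := CX (Bx n) (fun u => u = 0) (fun v => v ∉ Bx (n - 1))

/-- One-arm probability. -/
def ar (μ : Measure (Site → ℝ)) (p : ℝ) (n : ℕ) : ℝ := Pr μ p (arm n)

theorem zero_mem_Bx {r : ℤ} (h : 0 ≤ r) : (0 : Site) ∈ Bx r := by
  refine ⟨?_, ?_, ?_, ?_⟩ <;> simp <;> omega

theorem arm_anti {m n : ℤ} (hm : 0 ≤ m) (h : m ≤ n) : arm n ⊆ arm m := by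
  rintro B ⟨u, v, rfl, hv, hc⟩
  obtain ⟨v', h1, h2⟩ := hc.clip (n := m) (zero_mem_Bx hm) (fun h => hv (Bx_mono (by omega) h))
  refine ⟨0, v', rfl, h2, h1.mono ?_⟩
  rintro w ⟨hw, hw2⟩
  exact ⟨hw.1, hw2⟩

theorem ar_anti {μ : Measure (Site → ℝ)} (hμ : IsUniformCoupling μ) (p : ℝ) {m n : ℕ} (h : m ≤ n) :
    ar μ p n ≤ ar μ p m := Pr_mono hμ (arm_anti (by omega) (by omega))

theorem AQ_zero (n : ℤ) : AQ 0 n = arm n := by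
  have : ∀ u : Site, u ∈ Bx 0 ↔ u = 0 := by
    rintro ⟨x, y⟩
    simp only [Bx, Set.mem_ofPred_eq, Prod.mk_eq_zero]
    omega
  unfold AQ arm
  simp only [this]

theorem AQ_bound {μ : Measure (Site → ℝ)} (hμ : IsUniformCoupling μ) {p : ℝ}
    (hp : 1 / 2 ≤ p) (hp1 : p ≤ 1) {m n : ℕ} (hmn : m ≤ n) :
    (1 / 2) ^ 65 * ((m + 1 : ℝ) / (n + 1)) ≤ Pr μ p (AQ m n) := by
  set M : ℕ := n / 16 + 1 with hM
  set N : ℕ := 4 * M / (2 * m + 1) + 1 with hN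
  have h1 := VX_tall hμ M (by omega) hp
  have h2 : Pr μ p (VX 0 (8 * M) 0 (32 * M)) ≤ ∑ i ∈ Finset.range N,
      Pr μ p {B | (tr (-(8 * M : ℤ) + i * (2 * m + 1) + m, 16 * M)) ⁻¹' B ∈ AQ m n} := by
    refine le_trans (Pr_mono hμ ?_) (Pr_biUnion_le hμ p (Finset.range N) _)
    rintro B ⟨u, v, hu, hv, hc⟩
    obtain ⟨a, b, e1, e2, e3, e4, e5⟩ := hc.first_exit {w | w.2 < 16 * M}
      (by simp only [Set.mem_ofPred_eq]; omega) (by simp only [Set.mem_ofPred_eq]; omega)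
    have ha : a.2 < 16 * M := e1.right.2
    have hb2 : b.2 = 16 * M := by
      have := adj_le e2
      simp only [Set.mem_ofPred_eq] at e4
      omega
    obtain ⟨k1, k2, k3, k4⟩ := e3.2
    set i : ℕ := ((b.1 + 8 * M) / (2 * m + 1)).toNat with hi
    have q0 : 0 ≤ (b.1 + 8 * (M : ℤ)) / (2 * m + 1) := Int.ediv_nonneg (by omega) (by omega)
    have q1 : (i : ℤ) = (b.1 + 8 * M) / (2 * m + 1) := by omega
    have q2 := Int.emod_add_mul_ediv (b.1 + 8 * (M : ℤ)) (2 * m + 1)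
    have q3 := Int.emod_nonneg (b.1 + 8 * (M : ℤ)) (show (2 * m + 1 : ℤ) ≠ 0 by omega)
    have q4 := Int.emod_lt_of_pos (b.1 + 8 * (M : ℤ)) (show (0 : ℤ) < 2 * m + 1 by omega)
    rw [← q1, mul_comm (2 * (m : ℤ) + 1) (i : ℤ)] at q2
    refine ⟨i, ?_, ?_⟩
    · rw [Finset.mem_range, hN, Nat.lt_succ_iff, Nat.le_div_iff_mul_le (by omega)]
      zify
      push_cast
      omega
    · set t : Site := (-(8 * M : ℤ) + i * (2 * m + 1) + m, 16 * M) with ht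
      have ht1 : t.1 = -(8 * M : ℤ) + i * (2 * m + 1) + m := rfl
      have ht2 : t.2 = 16 * M := rfl
      have f := e5.map (T := (tr t) ⁻¹' B) (tr (-t)) (tr_adj _) (by
        rintro w ⟨hw, -⟩
        simpa [tr_apply] using hw)
      have hbm : tr (-t) b ∈ Bx m := by
        refine ⟨?_, ?_, ?_, ?_⟩ <;> simp only [tr_apply, Prod.fst_add, Prod.snd_add, Prod.fst_neg,
          Prod.snd_neg, ht1, ht2] <;> omega
      obtain ⟨v', g1, g2⟩ := f.clip (n := n) (Bx_mono (by omega) hbm) (by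
        rintro ⟨g1, g2, g3, g4⟩
        simp only [tr_apply, Prod.snd_add, Prod.snd_neg, ht2] at g4
        omega)
      exact ⟨_, v', hbm, g2, g1⟩
  have h3 : ∀ i ∈ Finset.range N,
      Pr μ p {B | (tr (-(8 * M : ℤ) + i * (2 * m + 1) + m, 16 * M)) ⁻¹' B ∈ AQ m n} = Pr μ p (AQ m n) :=
    fun i _ => Pr_equiv' hμ (by linarith) hp1 _ (Bx_finite n) (CX_local _ _ _)
  rw [Finset.sum_congr rfl h3, Finset.sum_const, Finset.card_range, nsmul_eq_mul] at h2
  have h4 : (N : ℝ) * (m + 1) ≤ 5 * (n + 1) := by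
    have a1 : 4 * M / (2 * m + 1) * (2 * m + 1) ≤ 4 * M := Nat.div_mul_le_self _ _
    have a2 : N * (m + 1) ≤ 5 * (n + 1) := by
      rw [hN, add_mul]
      have : 4 * M / (2 * m + 1) * (m + 1) ≤ 4 * M / (2 * m + 1) * (2 * m + 1) :=
        Nat.mul_le_mul_left _ (by omega)
      omega
    exact_mod_cast a2
  have h5 := Pr_nonneg μ p (AQ m n)
  have h6 : (0 : ℝ) < m + 1 := by positivity
  have h7 : (0 : ℝ) < n + 1 := by positivity
  rw [mul_div_assoc', div_le_iff₀ h7]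
  have h8 : (1 / 2 : ℝ) ^ 62 * (m + 1) ≤ Pr μ p (AQ m n) * (5 * (n + 1)) := by
    calc (1 / 2 : ℝ) ^ 62 * (m + 1) ≤ (N * Pr μ p (AQ m n)) * (m + 1) := by
          gcongr; exact h1.trans h2
      _ = Pr μ p (AQ m n) * (N * (m + 1)) := by ring
      _ ≤ _ := by gcongr
  have h9 : (1 / 2 : ℝ) ^ 65 * (m + 1) = (1 / 8) * ((1 / 2 : ℝ) ^ 62 * (m + 1)) := by ring
  rw [h9]
  nlinarith

theorem arm_glue {k n : ℤ} (hk : 1 ≤ k) (hn : 16 * k + 1 ≤ n) :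
    arm (16 * k + 1) ∩ (RG k ∩ AQ (2 * k) n) ⊆ arm n := by
  rintro B ⟨⟨u, v, rfl, hv, hc⟩, hR, ⟨a, b, ha, hb, hd⟩⟩
  obtain ⟨z, hz, hz2⟩ := meet_out hk hR
  obtain ⟨w, e1, e2⟩ := hz2 _ _ _ hc (zero_mem_Bx (by omega)) (by simpa using hv)
  obtain ⟨w', f1, f2⟩ := hz2 _ _ _ hd ha (fun h => hb (Bx_mono (by omega) h))
  have hA : B ∩ Ann k ⊆ B ∩ Bx n := fun v hv => ⟨hv.1, Bx_mono (by omega) hv.2.1⟩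
  have hA2 : (B ∩ Bx (16 * k + 1)) ∩ Bx (16 * k) ⊆ B ∩ Bx n :=
    fun v hv => ⟨hv.1.1, Bx_mono (by omega) hv.2⟩
  refine ⟨0, b, rfl, hb, ?_⟩
  exact (((e1.mono hA2).trans (e2.symm.mono hA)).trans (f2.mono hA)).trans
    ((f1.mono Set.inter_subset_left).symm.trans hd)

theorem ar_lower {μ : Measure (Site → ℝ)} (hμ : IsUniformCoupling μ) {p : ℝ}
    (hp : 1 / 2 ≤ p) (hp1 : p ≤ 1) (n : ℕ) : (1 / 2) ^ 65 * (1 / (n + 1 : ℝ)) ≤ ar μ p n := by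
  have := AQ_bound hμ hp hp1 (m := 0) (n := n) (by omega)
  simp only [Nat.cast_zero, zero_add, AQ_zero] at this
  exact this

theorem ar_pos {μ : Measure (Site → ℝ)} (hμ : IsUniformCoupling μ) {p : ℝ}
    (hp : 1 / 2 ≤ p) (hp1 : p ≤ 1) (n : ℕ) : 0 < ar μ p n :=
  lt_of_lt_of_le (by positivity) (ar_lower hμ hp hp1 n)

theorem ar_compare {μ : Measure (Site → ℝ)} (hμ : IsUniformCoupling μ) {p : ℝ}
    (hp : 1 / 2 ≤ p) (hp1 : p ≤ 1) {m n : ℕ} (hmn : m ≤ n) :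
    ar μ p m * (m + 1) ≤ 2 ^ 255 * (n + 1) * ar μ p n := by
  have hn0 : (0 : ℝ) < n + 1 := by positivity
  by_cases hm : m < 17
  · have h1 : ar μ p m ≤ 1 := Pr_le_one hμ _ _
    have h2 := ar_lower hμ hp hp1 n
    have h3 : (m + 1 : ℝ) ≤ 17 := by exact_mod_cast hm
    have h4 : (1 : ℝ) ≤ 2 ^ 65 * ((n + 1) * ar μ p n) := by
      have : (1 / 2 : ℝ) ^ 65 ≤ (n + 1) * ar μ p n := by
        have := mul_le_mul_of_nonneg_left h2 hn0.le
        refine le_trans (le_of_eq ?_) this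
        field_simp
      calc (1 : ℝ) = 2 ^ 65 * (1 / 2 : ℝ) ^ 65 := by norm_num
        _ ≤ _ := by gcongr
    calc ar μ p m * (m + 1) ≤ 1 * 17 := by gcongr
      _ ≤ 17 * (2 ^ 65 * ((n + 1) * ar μ p n)) := by linarith
      _ ≤ 2 ^ 190 * (2 ^ 65 * ((n + 1) * ar μ p n)) := by gcongr; norm_num
      _ = _ := by ring
  · set k : ℕ := (m - 1) / 16 with hk
    have hk1 : 1 ≤ k := by omega
    have r := RG_prob hμ k hk1 hp hp1
    have q := AQ_bound hμ hp hp1 (m := 2 * k) (n := n) (by omega)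
    have hp0 : 0 ≤ p := by linarith
    have hBf := Bx_finite n
    have l1 : Loc (Bx n) (arm (16 * k + 1)) := (CX_local _ _ _).mono (Bx_mono (by omega))
    have l2 : Loc (Bx n) (RG k) := (RG_local (by omega)).mono (fun v hv => Bx_mono (by omega) hv.1)
    have l3 : Loc (Bx n) (AQ (2 * k) n) := CX_local _ _ _
    have f1 := Pr_fkg' hμ hp0 hp1 hBf l2 l3 (RG_upper _) (CX_upper _ _ _)
    have f2 := Pr_fkg' hμ hp0 hp1 hBf l1 (l2.inter l3) (CX_upper _ _ _)
      ((RG_upper _).inter (CX_upper _ _ _))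
    have f3 : Pr μ p (arm (16 * k + 1) ∩ (RG k ∩ AQ (2 * k) n)) ≤ ar μ p n :=
      Pr_mono hμ (arm_glue (by omega) (by omega))
    have f4 : ar μ p m ≤ Pr μ p (arm (16 * k + 1)) := Pr_mono hμ (arm_anti (by omega) (by omega))
    push_cast at q
    have h5 : ar μ p m * ((1 / 2) ^ 186 * ((1 / 2) ^ 65 * ((2 * k + 1 : ℝ) / (n + 1)))) ≤ ar μ p n := by
      refine le_trans ?_ f3
      refine le_trans ?_ f2
      refine mul_le_mul f4 (le_trans ?_ f1) (by positivity) (Pr_nonneg _ _ _)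
      exact mul_le_mul r q (by positivity) (Pr_nonneg _ _ _)
    have h6 : (m + 1 : ℝ) ≤ 16 * (2 * k + 1) := by
      have : m + 1 ≤ 16 * (2 * k + 1) := by omega
      exact_mod_cast this
    have h7 : ar μ p m * (2 * k + 1) ≤ 2 ^ 251 * (n + 1) * ar μ p n := by
      have := mul_le_mul_of_nonneg_left h5 (show (0 : ℝ) ≤ 2 ^ 251 * (n + 1) by positivity)
      refine le_trans (le_of_eq ?_) this
      field_simp
    have h8 : 0 ≤ ar μ p m := Pr_nonneg _ _ _
    calc ar μ p m * (m + 1) ≤ ar μ p m * (16 * (2 * k + 1)) := by gcongr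
      _ = 16 * (ar μ p m * (2 * k + 1)) := by ring
      _ ≤ 16 * (2 ^ 251 * (n + 1) * ar μ p n) := by gcongr
      _ = _ := by ring

/-! ### Part 7: finite-size criterion -/

/-- Horizontal crossing (with slack). -/
def HX (a b lo hi : ℤ) : Set (Set Site) :=
  CX (Rc a b lo hi) (fun u => 2 * u.1 + u.2 ≤ a + 1) (fun v => b - 1 ≤ 2 * v.1 + v.2)

theorem HX_local (a b lo hi : ℤ) : Loc (Rc a b lo hi) (HX a b lo hi) := CX_local _ _ _

theorem HX_of_path {B S : Set Site} {u v : Site} {a b lo hi : ℤ} (hab : a + 3 ≤ b) (h : Cn S u v)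
    (hSB : S ⊆ B) (hS : ∀ w ∈ S, a ≤ 2 * w.1 + w.2 → 2 * w.1 + w.2 ≤ b → lo ≤ w.2 ∧ w.2 ≤ hi)
    (hu : 2 * u.1 + u.2 ≤ a + 1) (hv : b - 1 ≤ 2 * v.1 + v.2) : B ∈ HX a b lo hi := by
  obtain ⟨s, t, h1, h2, -, h4⟩ := h.seg (fun w => 2 * w.1 + w.2) 2 (a + 1) (b - 1)
    (fun a b h => X_lip h) (by norm_num) hu hv (by omega)
  refine ⟨s, t, h1, h2, h4.mono ?_⟩
  rintro w ⟨hw1, hw2, hw3⟩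
  have := hS w hw1 (by omega) (by omega)
  exact ⟨hSB hw1, by omega, by omega, this.1, this.2⟩

theorem HX_shift {μ : Measure (Site → ℝ)} (hμ : IsUniformCoupling μ) {q : ℝ} (hq : 0 ≤ q) (hq1 : q ≤ 1)
    (A s w h : ℤ) (hA : ∃ t, A = 2 * t + s) :
    Pr μ q (HX A (A + w) s (s + h)) ≤ Pr μ q (HX 0 w 0 h) := by
  obtain ⟨t, rfl⟩ := hA
  refine CX_le hμ hq hq1 (tr (-t, -s)) (tr_adj _) (Rc_finite _ _ _ _) ?_ ?_ ?_
  · rintro v ⟨h1, h2, h3, h4⟩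
    refine ⟨?_, ?_, ?_, ?_⟩ <;> simp only [tr_apply, Prod.fst_add, Prod.snd_add] <;> omega
  · intro v _ hv; simp only [tr_apply, Prod.snd_add, Prod.fst_add]; omega
  · intro v _ hv; simp only [tr_apply, Prod.snd_add, Prod.fst_add]; omega

/-- Crossings at scales at least `n0` are unlikely. -/
def Good (μ : Measure (Site → ℝ)) (q : ℝ) (n0 : ℕ) (ε : ℝ) : Prop :=
  ∀ n h : ℕ, n0 ≤ n → 3 * h ^ 2 ≤ 16 * n ^ 2 → Pr μ q (HX 0 (2 * n) 0 h) ≤ ε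

theorem exists_min_row {S : Set Site} (hS : S.Finite) {u : Site} (hu : u ∈ S) :
    ∃ s ∈ S, ∀ w ∈ S, s.2 ≤ w.2 := by
  obtain ⟨s, hs, h⟩ := Set.exists_min_image S (fun w => w.2) hS ⟨u, hu⟩
  exact ⟨s, hs, h⟩

/-- A crossing of a tall column crosses one of the windows. -/
theorem column_cover {B : Set Site} {a i : ℤ} {K : ℕ} (hi : 1 ≤ i) (ha : ∃ t, a = 2 * t)
    (hB : B ∈ HX a (a + 220 * i) 0 (58 * i * K + 252 * i)) :
    (∃ k ∈ Finset.range (K + 1), B ∈ HX a (a + 220 * i) (58 * i * k) (58 * i * k + 252 * i)) ∨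
    (∃ k ∈ Finset.range K, ∀ A s : ℤ,
      (A = (a + 220 * i + 3 * (58 * i * (k + 1))) / 2 ∨ A = (a + 220 * i + 3 * (58 * i * (k + 1))) / 2 + 1) →
      s = (a - 58 * i * (k + 1)) / 2 - 97 * i →
      sw ⁻¹' B ∈ HX A (A + 180 * i) s (s + 207 * i)) := by
  obtain ⟨u, v, hu, hv, hc⟩ := hB
  obtain ⟨a', rfl⟩ := ha
  set S : Set Site := {w | Cn (B ∩ Rc (2 * a') (2 * a' + 220 * i) 0 (58 * i * K + 252 * i)) u w} with hS
  have hSR : S ⊆ Rc (2 * a') (2 * a' + 220 * i) 0 (58 * i * K + 252 * i) := fun w hw => (Cn.right hw).2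
  have hSf : S.Finite := (Rc_finite _ _ _ _).subset hSR
  have hcS : Cn S u v := hc.self
  obtain ⟨s, hs, hmin⟩ := exists_min_row hSf hcS.left
  obtain ⟨s1, s2, s3, s4⟩ := hSR hs
  have q0 : 0 ≤ s.2 / (58 * i) := Int.ediv_nonneg s3 (by omega)
  have q2 := Int.emod_add_mul_ediv s.2 (58 * i)
  have q3 := Int.emod_nonneg s.2 (show 58 * i ≠ 0 by omega)
  have q4 := Int.emod_lt_of_pos s.2 (show 0 < 58 * i by omega)
  obtain ⟨k, hk⟩ : ∃ k : ℕ, s.2 / (58 * i) = k := ⟨(s.2 / (58 * i)).toNat, by omega⟩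
  rw [hk] at q2
  by_cases hkK : K ≤ k
  · left
    refine ⟨K, by simp, ?_⟩
    have : 58 * i * (K : ℤ) ≤ 58 * i * k := by
      apply mul_le_mul_of_nonneg_left _ (by omega); exact_mod_cast hkK
    refine HX_of_path (S := S) (by omega) hcS (fun w hw => (Cn.right hw).1) ?_ hu hv
    intro w hw _ _
    have := hmin w hw
    have := (hSR hw).2.2.2
    omega
  · by_cases hmax : ∀ w ∈ S, w.2 ≤ 58 * i * k + 252 * i
    · left
      refine ⟨k, by simp; omega, ?_⟩
      refine HX_of_path (S := S) (by omega) hcS (fun w hw => (Cn.right hw).1) ?_ hu hv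
      intro w hw _ _
      have := hmin w hw
      have := hmax w hw
      omega
    · right
      push Not at hmax
      obtain ⟨t, ht, ht2⟩ := hmax
      refine ⟨k, by simp; omega, ?_⟩
      have hst : Cn (B ∩ Rc (2 * a') (2 * a' + 220 * i) 0 (58 * i * K + 252 * i)) s t :=
        (Cn.symm hs).trans ht
      have hy0 : 58 * i * (k + 1 : ℤ) = 58 * i * k + 58 * i := by ring
      obtain ⟨g, g', e1, e2, -, e4⟩ := hst.seg (fun w => w.2) 1 (58 * i * (k + 1)) (58 * i * k + 252 * i)
        (fun a b h => (adj_le h).2.2.1) le_rfl (by omega) (by omega) (by omega)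
      obtain ⟨j, hj⟩ : ∃ j : ℤ, 58 * i * (k + 1) = 2 * j := ⟨29 * i * (k + 1), by ring⟩
      rw [hj]
      have hc0 : (2 * a' + 220 * i + 3 * (2 * j)) / 2 = a' + 110 * i + 3 * j := by omega
      have hs0 : (2 * a' - 2 * j) / 2 - 97 * i = a' - j - 97 * i := by omega
      rw [hc0, hs0]
      rintro A s hA rfl
      have f := e4.map (T := sw ⁻¹' (B ∩ (Rc (2 * a') (2 * a' + 220 * i) 0 (58 * i * K + 252 * i)) ∩
        {w | 58 * i * (k + 1) - 1 + 1 ≤ w.2 ∧ w.2 ≤ 58 * i * k + 252 * i + 1 - 1})) sw sw_adj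
        (fun w hw => hw)
      obtain ⟨⟨-, l1, l2, l3, l4⟩, l5, l6⟩ := e4.left
      obtain ⟨⟨-, m1, m2, m3, m4⟩, m5, m6⟩ := e4.right
      rw [hj] at e1 l5 m5 hy0
      refine HX_of_path (by omega) f (fun w hw => hw.1.1) ?_ ?_ ?_
      · rintro w ⟨⟨-, n1, n2, n3, n4⟩, n5, n6⟩ - -
        simp only [sw_apply] at n1 n2 n5 n6
        rw [hj] at n5
        omega
      · simp only [sw_apply]; omega
      · simp only [sw_apply]; omega

theorem column_prob {μ : Measure (Site → ℝ)} (hμ : IsUniformCoupling μ) {q : ℝ} (hq : 0 ≤ q) (hq1 : q ≤ 1)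
    {n0 : ℕ} {ε : ℝ} (hG : Good μ q n0 ε) {i : ℕ} (hi : 1 ≤ i) (hin : n0 ≤ 90 * i) (K : ℕ) (a' : ℤ) :
    Pr μ q (HX (2 * a') (2 * a' + 220 * i) 0 (58 * i * K + 252 * i)) ≤ (2 * K + 1) * ε := by
  have hch : ∀ k : ℕ, ∃ A s : ℤ, (∃ t, A = 2 * t + s) ∧
      (A = (2 * a' + 220 * i + 3 * (58 * i * (k + 1))) / 2 ∨
        A = (2 * a' + 220 * i + 3 * (58 * i * (k + 1))) / 2 + 1) ∧
      s = (2 * a' - 58 * i * (k + 1)) / 2 - 97 * i := by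
    intro k
    rcases Int.even_or_odd' ((2 * a' + 220 * i + 3 * (58 * i * (k + 1))) / 2 -
      ((2 * a' - 58 * i * (k + 1)) / 2 - 97 * i)) with ⟨d, hd | hd⟩
    · exact ⟨_, _, ⟨d, by omega⟩, .inl rfl, rfl⟩
    · exact ⟨_, _, ⟨d + 1, by omega⟩, .inr rfl, rfl⟩
  choose A s h1 h2 h3 using hch
  have e1 : Pr μ q (HX (2 * a') (2 * a' + 220 * i) 0 (58 * i * K + 252 * i)) ≤
      Pr μ q {B | ∃ k ∈ Finset.range (K + 1),
        B ∈ HX (2 * a') (2 * a' + 220 * i) (58 * i * k) (58 * i * k + 252 * i)} +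
      Pr μ q {B | ∃ k ∈ Finset.range K, B ∈ {B | sw ⁻¹' B ∈ HX (A k) (A k + 180 * i) (s k) (s k + 207 * i)}} := by
    refine le_trans (Pr_mono hμ ?_) (Pr_union_le hμ _ _ _)
    intro B hB
    rcases column_cover (by omega) ⟨a', rfl⟩ hB with h | ⟨k, hk, h⟩
    · exact .inl h
    · exact .inr ⟨k, hk, h _ _ (h2 k) (h3 k)⟩
  have e2 := Pr_biUnion_le hμ q (Finset.range (K + 1))
    (fun k : ℕ => HX (2 * a') (2 * a' + 220 * i) (58 * i * k) (58 * i * k + 252 * i))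
  have e3 := Pr_biUnion_le hμ q (Finset.range K)
    (fun k : ℕ => {B | sw ⁻¹' B ∈ HX (A k) (A k + 180 * i) (s k) (s k + 207 * i)})
  have e4 : ∑ k ∈ Finset.range (K + 1), Pr μ q (HX (2 * a') (2 * a' + 220 * i) (58 * i * k) (58 * i * k + 252 * i))
      ≤ ∑ k ∈ Finset.range (K + 1), ε := by
    refine Finset.sum_le_sum (fun k _ => ?_)
    refine (HX_shift hμ hq hq1 _ _ _ _ ⟨a' - 29 * i * k, by ring⟩).trans ?_
    have := hG (110 * i) (252 * i) (by omega) (by nlinarith)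
    push_cast at this
    rw [show (220 * i : ℤ) = 2 * (110 * i) by ring]
    exact this
  have e5 : ∑ k ∈ Finset.range K, Pr μ q {B | sw ⁻¹' B ∈ HX (A k) (A k + 180 * i) (s k) (s k + 207 * i)}
      ≤ ∑ k ∈ Finset.range K, ε := by
    refine Finset.sum_le_sum (fun k _ => ?_)
    rw [Pr_equiv' hμ hq hq1 sw (Rc_finite _ _ _ _) (HX_local _ _ _ _)]
    refine (HX_shift hμ hq hq1 _ _ _ _ (h1 k)).trans ?_
    have := hG (90 * i) (207 * i) (by omega) (by nlinarith)
    push_cast at this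
    rw [show (180 * i : ℤ) = 2 * (90 * i) by ring]
    exact this
  simp only [Finset.sum_const, Finset.card_range, nsmul_eq_mul] at e4 e5
  push_cast at e4
  linarith

theorem HX_mono_h {a b lo hi hi' : ℤ} (h : hi ≤ hi') : HX a b lo hi ⊆ HX a b lo hi' := by
  rintro B ⟨u, v, h1, h2, h3⟩
  refine ⟨u, v, h1, h2, h3.mono ?_⟩
  rintro w ⟨hw, g1, g2, g3, g4⟩
  exact ⟨hw, g1, g2, g3, by omega⟩

theorem Good.step {μ : Measure (Site → ℝ)} (hμ : IsUniformCoupling μ) {q : ℝ} (hq : 0 ≤ q) (hq1 : q ≤ 1)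
    {n0 : ℕ} {ε : ℝ} (hn0 : 10000 ≤ n0) (hG : Good μ q n0 ε) : Good μ q (4 * n0) ((19 * ε) ^ 3) := by
  intro N h hN hh
  set i : ℕ := (N - 2) / 330 with hi
  have hh2 : h ≤ 774 * i := by
    by_contra hne
    have : 774 * i + 1 ≤ h := by omega
    have h2 : N ≤ 330 * i + 331 := by omega
    nlinarith
  have hcol : ∀ a' : ℤ, Pr μ q (HX (2 * a') (2 * a' + 220 * i) 0 h) ≤ 19 * ε := by
    intro a'
    have e := column_prob hμ hq hq1 hG (i := i) (by omega) (by omega) 9 a'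
    refine le_trans (Pr_mono hμ (HX_mono_h ?_)) (e.trans (by norm_num))
    push_cast
    omega
  have c0 := hcol 0
  have c1 := hcol (110 * i + 1)
  have c2 := hcol (220 * i + 2)
  have hsub : HX 0 (2 * N) 0 h ⊆ HX (2 * 0) (2 * 0 + 220 * i) 0 h ∩
      (HX (2 * (110 * i + 1)) (2 * (110 * i + 1) + 220 * i) 0 h ∩
        HX (2 * (220 * i + 2)) (2 * (220 * i + 2) + 220 * i) 0 h) := by
    rintro B ⟨u, v, h1, h2, h3⟩
    refine ⟨?_, ?_, ?_⟩ <;> refine HX_of_path (by omega) h3 Set.inter_subset_left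
      (fun w hw _ _ => ⟨hw.2.2.2.1, hw.2.2.2.2⟩) (by omega) (by omega)
  refine (Pr_mono hμ hsub).trans ?_
  have d12 : Disjoint (Rc (2 * (110 * i + 1)) (2 * (110 * i + 1) + 220 * i) 0 h)
      (Rc (2 * (220 * i + 2)) (2 * (220 * i + 2) + 220 * i) 0 h) := by
    rw [Set.disjoint_left]
    rintro w ⟨a1, a2, -, -⟩ ⟨b1, b2, -, -⟩
    omega
  have d0 : Disjoint (Rc (2 * 0) (2 * 0 + 220 * i) 0 h)
      (Rc (2 * (110 * i + 1)) (2 * (220 * i + 2) + 220 * i) 0 h) := by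
    rw [Set.disjoint_left]
    rintro w ⟨a1, a2, -, -⟩ ⟨b1, b2, -, -⟩
    omega
  have l1 : Loc (Rc (2 * (110 * i + 1)) (2 * (220 * i + 2) + 220 * i) 0 h)
      (HX (2 * (110 * i + 1)) (2 * (110 * i + 1) + 220 * i) 0 h) := by
    refine (HX_local _ _ _ _).mono ?_
    rintro w ⟨a1, a2, a3, a4⟩
    exact ⟨by omega, by omega, a3, a4⟩
  have l2 : Loc (Rc (2 * (110 * i + 1)) (2 * (220 * i + 2) + 220 * i) 0 h)
      (HX (2 * (220 * i + 2)) (2 * (220 * i + 2) + 220 * i) 0 h) := by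
    refine (HX_local _ _ _ _).mono ?_
    rintro w ⟨a1, a2, a3, a4⟩
    exact ⟨by omega, by omega, a3, a4⟩
  rw [Pr_indep' hμ (Rc_finite _ _ _ _) (Rc_finite _ _ _ _) d0 (HX_local _ _ _ _) (l1.inter l2),
    Pr_indep' hμ (Rc_finite _ _ _ _) (Rc_finite _ _ _ _) d12 (HX_local _ _ _ _) (HX_local _ _ _ _)]
  have e0 : 0 ≤ 19 * ε := (Pr_nonneg _ _ _).trans c0
  calc _ ≤ (19 * ε) * ((19 * ε) * (19 * ε)) := by
        refine mul_le_mul c0 (mul_le_mul c1 c2 (Pr_nonneg _ _ _) e0) ?_ e0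
        exact mul_nonneg (Pr_nonneg _ _ _) (Pr_nonneg _ _ _)
    _ = _ := by ring

theorem Good.iter {μ : Measure (Site → ℝ)} (hμ : IsUniformCoupling μ) {q : ℝ} (hq : 0 ≤ q) (hq1 : q ≤ 1)
    {n0 : ℕ} (hn0 : 10000 ≤ n0) (hG : Good μ q n0 (1 / 100)) (j : ℕ) :
    Good μ q (4 ^ j * n0) ((1 / 100) * (7 / 10) ^ j) := by
  induction j with
  | zero => simpa using hG
  | succ j ih =>
    have h4 : 1 ≤ 4 ^ j := Nat.one_le_pow _ _ (by norm_num)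
    have := Good.step hμ hq hq1 (by nlinarith) ih
    rw [pow_succ, mul_comm (4 ^ j) 4, mul_assoc]
    intro n h hn hh
    refine (this n h hn hh).trans ?_
    have h1 : (7 / 10 : ℝ) ^ j ≤ 1 := pow_le_one₀ (by norm_num) (by norm_num)
    have h0 : (0 : ℝ) ≤ (7 / 10 : ℝ) ^ j := by positivity
    rw [pow_succ (7 / 10 : ℝ)]
    set x := (7 / 10 : ℝ) ^ j
    have : x ^ 3 ≤ x := by nlinarith [mul_nonneg h0 (sub_nonneg.mpr h1)]
    nlinarith

/-! ### Part 8: links with the frozen definitions -/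

theorem exp_pi3 : Complex.exp (Complex.I * (Real.pi / 3)) = (1 / 2 : ℝ) + (Real.sqrt 3 / 2 : ℝ) * Complex.I := by
  rw [mul_comm]
  rw [show ((Real.pi : ℂ) / 3) = ((Real.pi / 3 : ℝ) : ℂ) by push_cast; ring]
  rw [Complex.exp_mul_I, ← Complex.ofReal_cos, ← Complex.ofReal_sin, Real.cos_pi_div_three,
    Real.sin_pi_div_three]

theorem embed_re (v : Site) : (embed v).re = v.1 + v.2 / 2 := by
  unfold embed
  rw [exp_pi3]
  simp
  ring

theorem embed_im (v : Site) : (embed v).im = v.2 * (Real.sqrt 3 / 2) := by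
  unfold embed
  rw [exp_pi3]
  simp

theorem int_sq_form {a b : ℤ} (h : a * a + a * b + b * b = 1) :
    (a = 1 ∧ b = 0) ∨ (a = -1 ∧ b = 0) ∨ (a = 0 ∧ b = 1) ∨ (a = 0 ∧ b = -1) ∨ (a = 1 ∧ b = -1) ∨
      (a = -1 ∧ b = 1) := by
  have h1 : a ≤ 1 := by nlinarith [sq_nonneg (a + 2 * b)]
  have h2 : -1 ≤ a := by nlinarith [sq_nonneg (a + 2 * b)]
  have h3 : b ≤ 1 := by nlinarith [sq_nonneg (b + 2 * a)]
  have h4 : -1 ≤ b := by nlinarith [sq_nonneg (b + 2 * a)]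
  interval_cases a <;> interval_cases b <;> simp_all

theorem Tri_adj (u v : Site) : Tri.Adj u v ↔ adj u v := by
  have e : Tri.Adj u v ↔ (v.1 - u.1) * (v.1 - u.1) + (v.1 - u.1) * (v.2 - u.2) + (v.2 - u.2) * (v.2 - u.2) = 1 := by
    show dist (embed u) (embed v) = 1 ↔ _
    have h0 : dist (embed u) (embed v) ^ 2 =
        (((v.1 - u.1) * (v.1 - u.1) + (v.1 - u.1) * (v.2 - u.2) + (v.2 - u.2) * (v.2 - u.2) : ℤ) : ℝ) := by
      rw [dist_eq_norm, Complex.sq_norm, Complex.normSq_apply, Complex.sub_re, Complex.sub_im, embed_re,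
        embed_re, embed_im, embed_im]
      have h3 : Real.sqrt 3 * Real.sqrt 3 = 3 := Real.mul_self_sqrt (by norm_num)
      push_cast
      linear_combination ((u.2 : ℝ) - v.2) ^ 2 / 4 * h3
    constructor
    · intro h
      rw [h] at h0
      have : ((1 : ℤ) : ℝ) = (((v.1 - u.1) * (v.1 - u.1) + (v.1 - u.1) * (v.2 - u.2) + (v.2 - u.2) * (v.2 - u.2) : ℤ) : ℝ) := by
        rw [← h0]; norm_num
      exact (Int.cast_injective this).symm
    · intro h
      rw [h] at h0
      have := dist_nonneg (x := embed u) (y := embed v)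
      push_cast at h0
      nlinarith
  rw [e]
  unfold adj
  constructor
  · intro h
    have := int_sq_form h
    omega
  · rintro (⟨h1, h2⟩ | ⟨h1, h2⟩ | ⟨h1, h2⟩ | ⟨h1, h2⟩ | ⟨h1, h2⟩ | ⟨h1, h2⟩) <;> rw [h1, h2] <;> ring

theorem reach_iff {G : SimpleGraph Site} {S : Set Site} (hG : ∀ u v, G.Adj u v ↔ adj u v ∧ u ∈ S ∧ v ∈ S)
    {u v : Site} (hu : u ∈ S) : G.Reachable u v ↔ Cn S u v := by
  rw [SimpleGraph.reachable_iff_reflTransGen]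
  constructor
  · intro h
    refine ⟨hu, ?_⟩
    induction h with
    | refl => exact .refl
    | tail _ hab ih => exact ih.tail ⟨((hG _ _).1 hab).1, ((hG _ _).1 hab).2.2⟩
  · intro h
    refine Cn.ind (Q := fun w => Relation.ReflTransGen G.Adj u w) (fun _ => .refl) ?_ h
    intro a b ha hQ hab hb
    exact hQ.tail ((hG a b).2 ⟨hab, ha.right, hb⟩)

theorem ConnIn_iff (p : ℝ) (ω : Site → ℝ) (S : Set Site) (u v : Site) :
    ConnIn p ω S u v ↔ Cn (bl p ω ∩ S) u v := by
  have hG : ∀ a b, (restrictGraph (blackGraph p ω) S).Adj a b ↔ adj a b ∧ a ∈ bl p ω ∩ S ∧ b ∈ bl p ω ∩ S := by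
    intro a b
    show (Tri.Adj a b ∧ a ∈ bl p ω ∧ b ∈ bl p ω) ∧ a ∈ S ∧ b ∈ S ↔ _
    rw [Tri_adj, Set.mem_inter_iff, Set.mem_inter_iff]
    tauto
  constructor
  · rintro ⟨h1, h2, h3, h4, h5⟩
    exact (reach_iff hG ⟨h3, h1⟩).1 h5
  · intro h
    exact ⟨h.left.2, h.right.2, h.left.1, h.right.1, (reach_iff hG h.left).2 h⟩

theorem Conn_iff (p : ℝ) (ω : Site → ℝ) (u v : Site) : Conn p ω u v ↔ Cn (bl p ω) u v := by
  have hG : ∀ a b, (blackGraph p ω).Adj a b ↔ adj a b ∧ a ∈ bl p ω ∧ b ∈ bl p ω := by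
    intro a b
    show (Tri.Adj a b ∧ a ∈ bl p ω ∧ b ∈ bl p ω) ↔ _
    rw [Tri_adj]
  constructor
  · rintro ⟨h3, h4, h5⟩
    exact (reach_iff hG h3).1 h5
  · intro h
    exact ⟨h.left, h.right, (reach_iff hG h.left).2 h⟩

theorem HX_HCross {p : ℝ} {ω : Site → ℝ} {n h : ℕ} (hh : 3 * h ^ 2 ≤ 16 * n ^ 2)
    (H : bl p ω ∈ HX 0 (2 * n) 0 h) : HCross p ω 0 n 0 (2 * n) := by
  obtain ⟨u, v, h1, h2, h3⟩ := H
  refine ⟨u, v, ?_, ?_, ?_⟩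
  · rw [ConnIn_iff]
    refine h3.mono ?_
    rintro w ⟨hw, g1, g2, g3, g4⟩
    refine ⟨hw, ?_, ?_⟩
    · rw [embed_re]
      have g1' : (0 : ℝ) ≤ 2 * w.1 + w.2 := by exact_mod_cast g1
      have g2' : (2 * w.1 + w.2 : ℝ) ≤ 2 * n := by exact_mod_cast g2
      constructor <;> linarith
    · rw [embed_im]
      have g3' : (0 : ℝ) ≤ w.2 := by exact_mod_cast g3
      have g4' : (w.2 : ℝ) ≤ h := by exact_mod_cast g4
      refine ⟨by positivity, ?_⟩
      refine abs_le_of_sq_le_sq' ?_ (by positivity) |>.2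
      have hh' : (3 : ℝ) * h ^ 2 ≤ 16 * n ^ 2 := by exact_mod_cast hh
      rw [mul_pow, div_pow, Real.sq_sqrt (by norm_num)]
      nlinarith
  · rw [embed_re]
    have : (2 * u.1 + u.2 : ℝ) ≤ 0 + 1 := by exact_mod_cast h1
    linarith
  · rw [embed_re]
    have : (2 * n - 1 : ℝ) ≤ 2 * v.1 + v.2 := by exact_mod_cast h2
    linarith

theorem Good_of_L {μ : Measure (Site → ℝ)} (hμ : IsUniformCoupling μ) {p : ℝ} (hp : pc < p)
    (hL : Lnat μ p ≠ 0) {n0 : ℕ} (hn : Lnat μ p < n0) : Good μ (1 - p) n0 (1 / 100) := by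
  intro n h hn' hh
  have hprob := hμ.1
  have e : Lnat μ p = sSup {n : ℕ | (1 : ℝ) / 100 ≤ prob μ {ω | HCross (1 - p) ω 0 n 0 (2 * n)}} := by
    unfold Lnat
    rw [if_neg (not_lt.2 hp.le)]
  have hb : BddAbove {n : ℕ | (1 : ℝ) / 100 ≤ prob μ {ω | HCross (1 - p) ω 0 n 0 (2 * n)}} := by
    by_contra hb
    exact hL (e.trans (Nat.sSup_of_not_bddAbove hb))
  have hn2 : n ∉ {n : ℕ | (1 : ℝ) / 100 ≤ prob μ {ω | HCross (1 - p) ω 0 n 0 (2 * n)}} := by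
    intro hmem
    have := le_csSup hb hmem
    rw [← e] at this
    omega
  rw [Set.mem_ofPred_eq, not_le] at hn2
  refine le_trans ?_ hn2.le
  refine ENNReal.toReal_mono (measure_ne_top _ _) (measure_mono ?_)
  intro ω hω
  exact HX_HCross hh hω

/-! ### Part 9: percolation above the characteristic length -/

theorem window_exists {B : Set Site} {U i : ℤ} (hi : 1 ≤ i) (hU : U ≤ 3520 * i) {s t : Site}
    (h : Cn (B ∩ TT U) s t) (hst : 2 * s.1 + s.2 + 440 * i ≤ 2 * t.1 + t.2) :
    ∃ k ∈ Finset.range 32, B ∈ HX (2 * (110 * i * (k : ℕ))) (2 * (110 * i * (k : ℕ)) + 220 * i) 0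
      (58 * i * (57 : ℕ) + 252 * i) := by
  obtain ⟨-, s1, s2, s3⟩ := h.left
  obtain ⟨-, t1, t2, t3⟩ := h.right
  set k : ℤ := (2 * s.1 + s.2) / (220 * i) with hk
  have k0 : 0 ≤ k := Int.ediv_nonneg (by omega) (by omega)
  have k1 : k * (220 * i) ≤ 2 * s.1 + s.2 := Int.ediv_mul_le _ (by omega)
  have k2 : 2 * s.1 + s.2 < (k + 1) * (220 * i) := Int.lt_ediv_add_one_mul_self _ (by omega)
  have k3 : k + 1 < 32 := by
    by_contra hne
    have : 31 * (220 * i) ≤ k * (220 * i) := by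
      apply mul_le_mul_of_nonneg_right <;> omega
    omega
  obtain ⟨m, hm⟩ := Int.eq_ofNat_of_zero_le (show 0 ≤ k + 1 by omega)
  refine ⟨m, Finset.mem_range.2 (by omega), ?_⟩
  rw [show ((m : ℕ) : ℤ) = k + 1 from hm.symm]
  refine HX_of_path (by omega) h Set.inter_subset_left ?_ ?_ ?_
  · rintro w ⟨-, w1, w2, w3⟩ - -
    push_cast
    constructor <;> omega
  · nlinarith
  · nlinarith

/-- Union of the column crossings. -/
def EC (i : ℕ) : Set (Set Site) := {B | ∃ k ∈ Finset.range 32, B ∈ HX (2 * (110 * i * (k : ℕ)))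
  (2 * (110 * i * (k : ℕ)) + 220 * i) 0 (58 * i * (57 : ℕ) + 252 * i)}

theorem sw_path {B : Set Site} {U : ℤ} {s t : Site} (h : Cn (B ∩ TT U) s t) :
    Cn (sw ⁻¹' B ∩ TT U) (sw s) (sw t) := by
  refine h.map (T := sw ⁻¹' B ∩ TT U) sw sw_adj ?_
  rintro w ⟨hw, w1, w2, w3⟩
  exact ⟨hw, w2, w1, by rw [sw_apply]; simp only; omega⟩

theorem sw_sw (B : Set Site) : sw ⁻¹' (sw ⁻¹' B) = B := rfl

theorem tall_EC {B : Set Site} {U : ℤ} {i : ℕ} (hi : 1 ≤ i) (hU : U ≤ 3520 * i) {s t : Site}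
    (h : Cn (B ∩ TT U) s t) (hst : s.2 + 440 * i ≤ t.2) : B ∈ EC i ∨ sw ⁻¹' B ∈ EC i := by
  have hi' : (1 : ℤ) ≤ i := by exact_mod_cast hi
  by_cases h1 : 2 * t.1 + t.2 + 440 * i ≤ 2 * s.1 + s.2
  · exact .inl (window_exists hi' hU h.symm h1)
  · refine .inr (window_exists hi' hU (sw_path h) ?_)
    simp only [sw_apply]
    omega

theorem Ywin_EC {B : Set Site} {U : ℤ} {i : ℕ} (hi : 1 ≤ i) (hU0 : 880 * i ≤ U) (hU : U ≤ 3520 * i)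
    (h : Ywin U B) : B ∈ EC i ∨ sw ⁻¹' B ∈ EC i := by
  obtain ⟨a, b, c, ha, hb, hc, hab, hac⟩ := h
  by_cases h1 : 440 * i ≤ c.2
  · exact tall_EC hi hU (hab.symm.trans hac) (by omega)
  · have := tall_EC hi hU (sw_path hac) (by simp only [sw_apply]; omega)
    rw [sw_sw] at this
    exact this.symm

theorem EC_prob {μ : Measure (Site → ℝ)} (hμ : IsUniformCoupling μ) {q : ℝ} (hq : 0 ≤ q) (hq1 : q ≤ 1)
    {n0 : ℕ} {ε : ℝ} (hG : Good μ q n0 ε) {i : ℕ} (hi : 1 ≤ i) (hin : n0 ≤ 90 * i) :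
    Pr μ q (EC i ∪ {B | sw ⁻¹' B ∈ EC i}) ≤ 7360 * ε := by
  have h1 : Pr μ q (EC i) ≤ 3680 * ε := by
    refine (Pr_biUnion_le hμ q _ _).trans ?_
    refine (Finset.sum_le_sum (fun k _ => column_prob hμ hq hq1 hG hi hin 57 (110 * i * (k : ℕ)))).trans ?_
    rw [Finset.sum_const, Finset.card_range, nsmul_eq_mul]
    push_cast
    linarith
  have h2 : Pr μ q {B | sw ⁻¹' B ∈ EC i} ≤ 3680 * ε := by
    have l : Loc (Bx (20000 * i)) (EC i) := by
      intro S S' hS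
      rintro ⟨k, hk, h⟩
      refine ⟨k, hk, ((HX_local _ _ _ _).mono ?_) S S' hS h⟩
      have hk' := Finset.mem_range.1 hk
      have : (i : ℤ) * k ≤ i * 32 := by
        apply mul_le_mul_of_nonneg_left <;> omega
      have : 0 ≤ (i : ℤ) * k := by positivity
      rintro w ⟨w1, w2, w3, w4⟩
      push_cast at w4
      rw [mul_assoc] at w1 w2
      refine ⟨?_, ?_, ?_, ?_⟩ <;> omega
    rw [Pr_equiv' hμ hq hq1 sw (Bx_finite _) l]
    exact h1
  linarith [Pr_union_le hμ q (EC i) {B | sw ⁻¹' B ∈ EC i}]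

/-- Some `Y` board of size in `[r, R)` is won. -/
def YS (r R : ℕ) : Set (Set Site) := {B | ∃ U : ℕ, r ≤ U ∧ U < R ∧ Ywin U B}

theorem YS_prob {μ : Measure (Site → ℝ)} (hμ : IsUniformCoupling μ) {q : ℝ} (hq : 0 ≤ q) (hq1 : q ≤ 1)
    {n0 : ℕ} (hn0 : 10000 ≤ n0) (hG : Good μ q n0 (1 / 100)) {m : ℕ} (hm : m = 4 ^ 18 * n0)
    (J : ℕ) :
    Pr μ q (YS (880 * m) (4 ^ J * (880 * m))) ≤ 1 / 2 * (1 - (7 / 10) ^ J) := by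
  induction J with
  | zero =>
    have : YS (880 * m) (4 ^ 0 * (880 * m)) = ∅ := by
      ext B
      simp only [YS, Set.mem_ofPred_eq, Set.mem_empty_iff_false, iff_false]
      rintro ⟨U, h1, h2, -⟩
      omega
    rw [this]
    simp [Pr]
  | succ J ih =>
    have hg := Good.iter hμ hq hq1 hn0 hG (J + 18)
    rw [show 4 ^ (J + 18) * n0 = 4 ^ J * m by rw [hm]; ring] at hg
    have hm1 : 1 ≤ m := by rw [hm]; omega
    have h4 : 1 ≤ 4 ^ J := Nat.one_le_pow _ _ (by norm_num)
    have e := EC_prob hμ hq hq1 hg (i := 4 ^ J * m)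
      (by nlinarith) (by omega)
    have hsub : YS (880 * m) (4 ^ (J + 1) * (880 * m)) ⊆
        YS (880 * m) (4 ^ J * (880 * m)) ∪
        (EC (4 ^ J * m) ∪ {B | sw ⁻¹' B ∈ EC (4 ^ J * m)}) := by
      rintro B ⟨U, h1, h2, h3⟩
      by_cases hlt : U < 4 ^ J * (880 * m)
      · exact .inl ⟨U, h1, hlt, h3⟩
      · right
        have e1 : 4 ^ J * (880 * m) = 880 * (4 ^ J * m) := by ring
        have e2 : 4 ^ (J + 1) * (880 * m) = 3520 * (4 ^ J * m) := by ring
        rw [e1] at hlt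
        rw [e2] at h2
        exact Ywin_EC (by nlinarith)
          (by exact_mod_cast not_lt.1 hlt) (by exact_mod_cast h2.le) h3
    have e3 := (Pr_mono hμ (p := q) hsub).trans (Pr_union_le hμ q _ _)
    have e4 : (7 / 10 : ℝ) ^ (J + 18) = (7 / 10) ^ J * (7 / 10) ^ 18 := pow_add _ _ _
    have e5 : (7 / 10 : ℝ) ^ 18 ≤ 17 / 10000 := by norm_num
    have e6 : (0 : ℝ) < (7 / 10) ^ J := by positivity
    rw [e4] at e
    have e7 := mul_le_mul_of_nonneg_left e5 e6.le
    have e8 : (7 / 10 : ℝ) ^ (J + 1) = (7 / 10) ^ J * (7 / 10) := pow_succ _ _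
    rw [e8]
    linarith

theorem Y_chain {B : Set Site} {r R : ℕ} (hrR : r ≤ R) (h : ∀ U : ℕ, r ≤ U → U ≤ R → Ywin U B) :
    ∃ s ∈ TT r, ∃ a b c : Site, a.1 = 0 ∧ b.2 = 0 ∧ c.1 + c.2 = R ∧ Cn (B ∩ TT R) a b ∧ Cn (B ∩ TT R) a c ∧
      Cn (B ∩ TT R) s a := by
  induction R, hrR using Nat.le_induction with
  | base =>
    obtain ⟨a, b, c, h1, h2, h3, h4, h5⟩ := h r le_rfl le_rfl
    exact ⟨a, h4.left.2, a, b, c, h1, h2, h3, h4, h5, .refl h4.left⟩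
  | succ R hrR ih =>
    obtain ⟨s, hs, a, b, c, h1, h2, h3, h4, h5, h6⟩ := ih (fun U g1 g2 => h U g1 (by omega))
    obtain ⟨a', b', c', i1, i2, i3, i4, i5⟩ := h (R + 1) (by omega) le_rfl
    have hsub : B ∩ TT R ⊆ B ∩ TT (R + 1 : ℕ) := by
      rintro w ⟨hw, w1, w2, w3⟩
      exact ⟨hw, w1, w2, by push_cast; omega⟩
    refine ⟨s, hs, a', b', c', i1, i2, i3, i4, i5, ?_⟩
    refine (h6.mono hsub).trans ?_
    by_contra hne
    obtain ⟨-, c1, c2, c3⟩ := h5.right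
    have hadj : adj c (c.1 + 1, c.2) := by unfold adj; simp
    have hcT : (c.1 + 1, c.2) ∈ TT (R + 1 : ℕ) := ⟨by simp only; omega, c2, by push_cast; omega⟩
    set B1 : Set Site := {w | Cn (B ∩ TT R) a w} ∪ {(c.1 + 1, c.2)} with hB1
    have y1 : Ywin (R + 1 : ℕ) B1 := by
      have sub : {w | Cn (B ∩ TT R) a w} ⊆ B1 ∩ TT (R + 1 : ℕ) := by
        intro w hw
        exact ⟨.inl hw, (hsub (Cn.right hw)).2⟩
      refine ⟨a, b, (c.1 + 1, c.2), h1, h2, by push_cast; omega, h4.self.mono sub, ?_⟩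
      exact (h5.self.mono sub).tail hadj ⟨.inr rfl, hcT⟩
    have y2 : Ywin (R + 1 : ℕ) {w | Cn (B ∩ TT (R + 1 : ℕ)) a' w} := by
      have sub : {w | Cn (B ∩ TT (R + 1 : ℕ)) a' w} ⊆ {w | Cn (B ∩ TT (R + 1 : ℕ)) a' w} ∩ TT (R + 1 : ℕ) := by
        intro w hw
        exact ⟨hw, (Cn.right hw).2⟩
      exact ⟨a', b', c', i1, i2, i3, i4.self.mono sub, i5.self.mono sub⟩
    refine Y_disjoint (by positivity) y1 y2 ?_
    rintro v - (hv | hv) hv'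
    · exact hne ((Cn.mono hsub hv).trans (Cn.symm hv'))
    · rw [Set.mem_singleton_iff] at hv
      rw [hv] at hv'
      exact hne (((h5.mono hsub).tail hadj (Cn.right hv')).trans (Cn.symm hv'))

def YA (r R : ℕ) : Set (Set Site) := {B | ∀ U : ℕ, r ≤ U → U < R → Ywin U B}

theorem YA_local (r R : ℕ) : Loc (TT R) (YA r R) := by
  intro S S' hS h U h1 h2
  refine ((Ywin_local U).mono ?_) S S' hS (h U h1 h2)
  rintro w ⟨w1, w2, w3⟩
  exact ⟨w1, w2, by omega⟩

theorem YA_upper (r R : ℕ) : IsUpperSet (YA r R) := by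
  intro S S' hS h U h1 h2
  exact (h U h1 h2).mono (fun v hv => hS hv.1)

theorem YA_prob {μ : Measure (Site → ℝ)} (hμ : IsUniformCoupling μ) {p : ℝ} (hp : 0 ≤ p) (hp1 : p ≤ 1)
    {n0 : ℕ} (hn0 : 10000 ≤ n0) (hG : Good μ (1 - p) n0 (1 / 100)) {m : ℕ} (hm : m = 4 ^ 18 * n0)
    (J : ℕ) :
    1 / 2 ≤ Pr μ p (YA (880 * m) (4 ^ J * (880 * m))) := by
  have e := YS_prob hμ (by linarith) (by linarith) hn0 hG hm J
  set r := 880 * m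
  set R := 4 ^ J * r
  have l : Loc (TT R) (YS r R) := by
    rintro S S' hS ⟨U, h1, h2, h⟩
    refine ⟨U, h1, h2, ((Ywin_local U).mono ?_) S S' hS h⟩
    rintro w ⟨w1, w2, w3⟩
    exact ⟨w1, w2, by omega⟩
  rw [← Pr_flip' hμ hp hp1 (TT_finite _) l] at e
  have l2 : Loc (TT R) {S | Sᶜ ∈ YS r R} := by
    intro S S' hS h
    refine l _ _ ?_ h
    ext v
    have := Set.ext_iff.1 hS v
    simp only [Set.mem_inter_iff, Set.mem_compl_iff] at this ⊢
    tauto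
  have e2 := Pr_compl' hμ (TT_finite _) l2 p
  have e3 : Pr μ p {S | Sᶜ ∈ YS r R}ᶜ ≤ Pr μ p (YA r R) := by
    refine Pr_mono hμ ?_
    intro S hS U h1 h2
    rcases Y_exists U S with h | h
    · exact h
    · exact (hS ⟨U, h1, h2, h⟩).elim
  have : (0 : ℝ) < (7 / 10) ^ J := by positivity
  linarith

theorem ar_infinite {μ : Measure (Site → ℝ)} (hμ : IsUniformCoupling μ) {p : ℝ} (hp : 1 / 2 ≤ p) (hp1 : p ≤ 1)
    {n0 : ℕ} (hn0 : 10000 ≤ n0) (hG : Good μ (1 - p) n0 (1 / 100)) (n : ℕ) :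
    (1 / 2) ^ 500 * ar μ p n0 ≤ ar μ p n := by
  have hp0 : 0 ≤ p := by linarith
  obtain ⟨m, hm⟩ : ∃ m, m = 4 ^ 18 * n0 := ⟨_, rfl⟩
  have hmn : n0 ≤ m := by rw [hm]; omega
  set r := 880 * m with hr
  have hr1 : 1 ≤ r := by omega
  set R := 4 ^ (n + 3) * r with hR
  have hRn : 64 * (n + 1) * r ≤ R := by
    rw [hR, pow_add]
    have : n + 1 ≤ 4 ^ n := Nat.lt_pow_self (by norm_num)
    have h2 := Nat.mul_le_mul_right r (Nat.mul_le_mul_right 64 this)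
    norm_num
    linarith
  have hRr : 64 * r ≤ R := by nlinarith
  have hRn2 : 64 * (n + 1) ≤ R := by nlinarith
  have hsub : arm (16 * r + 1 : ℕ) ∩ (RG r ∩ YA r R) ⊆ arm n := by
    rintro B ⟨⟨u0, v0, rfl, hv0, hc0⟩, hB, hY⟩
    obtain ⟨s, hs, a, b, c, -, -, hc, -, h5, h6⟩ := Y_chain (B := B) (r := r) (R := R - 1) (by omega)
      (fun U h1 h2 => hY U h1 (by omega))
    have hsc := (h6.trans h5).mono (Set.inter_subset_left)
    obtain ⟨z, -, hz⟩ := meet_out (m := (r : ℤ)) (by exact_mod_cast hr1) hB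
    have hcR : (c.1 + c.2 : ℤ) = R - 1 := by rw [hc]; push_cast [show 1 ≤ R by omega]; rfl
    have hv0' : v0 ∉ Bx (16 * r) := by
      intro hh; apply hv0; push_cast; simpa using hh
    obtain ⟨w, hw1, hw2⟩ := hz _ _ _ hc0 (zero_mem_Bx (by positivity)) hv0'
    obtain ⟨w', hw1', hw2'⟩ := hz _ _ _ hsc
      (by obtain ⟨s1, s2, s3⟩ := hs; exact ⟨by omega, by omega, by omega, by omega⟩)
      (by rintro ⟨g1, g2, g3, g4⟩; omega)
    have c1 : Cn B 0 w := by
      refine hw1.mono ?_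
      rintro x ⟨⟨hx, -⟩, -⟩
      exact hx
    have c2 : Cn B s w' := hw1'.mono Set.inter_subset_left
    have c3 : Cn B 0 c := ((c1.trans (hw2.symm.mono Set.inter_subset_left)).trans
      (hw2'.mono Set.inter_subset_left)).trans (c2.symm.trans hsc)
    obtain ⟨v', hv1, hv2⟩ := c3.clip (n := (n : ℤ)) (zero_mem_Bx (by positivity))
      (by rintro ⟨g1, g2, g3, g4⟩; omega)
    exact ⟨0, v', rfl, hv2, hv1⟩
  have hTB : TT R ⊆ Bx (17 * R) := by
    rintro w ⟨w1, w2, w3⟩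
    exact ⟨by omega, by omega, by omega, by omega⟩
  have l1 : Loc (Bx (17 * R)) (arm (16 * r + 1 : ℕ)) := (CX_local _ _ _).mono (Bx_mono (by push_cast; omega))
  have l2 : Loc (Bx (17 * R)) (RG r) := (RG_local (by exact_mod_cast hr1)).mono
    (Set.diff_subset.trans (Bx_mono (by omega)))
  have l3 : Loc (Bx (17 * R)) (YA r R) := (YA_local r R).mono hTB
  have f1 := Pr_fkg' hμ hp0 hp1 (Bx_finite _) l1 (l2.inter l3) (CX_upper _ _ _)
    ((RG_upper _).inter (YA_upper _ _))
  have f2 := Pr_fkg' hμ hp0 hp1 (Bx_finite _) l2 l3 (RG_upper _) (YA_upper _ _)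
  have f3 := RG_prob hμ r hr1 hp hp1
  have f4 := YA_prob hμ hp0 hp1 hn0 hG hm (n + 3)
  have f5 := Pr_mono hμ (p := p) hsub
  have f6 : (1 / 2 : ℝ) ^ 187 ≤ Pr μ p (RG r ∩ YA r R) := by
    refine le_trans ?_ f2
    rw [pow_succ]
    exact mul_le_mul f3 f4 (by norm_num) (Pr_nonneg _ _ _)
  have f7 : ar μ p (16 * r + 1) * (1 / 2) ^ 187 ≤ ar μ p n :=
    (mul_le_mul_of_nonneg_left f6 (Pr_nonneg _ _ _)).trans (f1.trans f5)
  have f8 := ar_compare hμ hp hp1 (m := n0) (n := 16 * r + 1) (by omega)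
  have f9 : ((16 * r + 1 : ℕ) + 1 : ℝ) ≤ 2 ^ 51 * (n0 + 1) := by
    rw [hr, hm]; push_cast; norm_num; linarith [show (0 : ℝ) ≤ n0 by positivity]
  have g0 : 0 ≤ ar μ p (16 * r + 1) := Pr_nonneg _ _ _
  have g1 : ar μ p n0 * (n0 + 1) ≤ (2 ^ 306 * ar μ p (16 * r + 1)) * (n0 + 1) := by
    refine f8.trans ?_
    calc _ ≤ 2 ^ 255 * (2 ^ 51 * (n0 + 1 : ℝ)) * ar μ p (16 * r + 1) := by gcongr
      _ = (2 ^ 255 * 2 ^ 51) * ar μ p (16 * r + 1) * (n0 + 1) := by ring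
      _ = _ := by rw [← pow_add]
  have g2 : ar μ p n0 ≤ 2 ^ 306 * ar μ p (16 * r + 1) := le_of_mul_le_mul_right g1 (by positivity)
  refine le_trans ?_ f7
  calc (1 / 2 : ℝ) ^ 500 * ar μ p n0 ≤ (1 / 2) ^ 500 * (2 ^ 306 * ar μ p (16 * r + 1)) := by gcongr
    _ = (1 / 2) ^ 194 * ar μ p (16 * r + 1) := by
      rw [← mul_assoc, show (1 / 2 : ℝ) ^ 500 = (1 / 2) ^ 194 * (1 / 2) ^ 306 by rw [← pow_add],
        mul_assoc ((1 / 2 : ℝ) ^ 194), ← mul_pow]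
      norm_num
    _ ≤ (1 / 2) ^ 187 * ar μ p (16 * r + 1) := by
      refine mul_le_mul_of_nonneg_right ?_ g0
      exact pow_le_pow_of_le_one (by norm_num) (by norm_num) (by norm_num)
    _ = _ := mul_comm _ _

theorem arm_conn {p : ℝ} {ω : Site → ℝ} (h : ∀ n : ℕ, bl p ω ∈ arm n) : ConnInf p ω 0 := by
  have h0 : ∀ n : ℕ, ∃ v, v ∉ Bx ((n : ℤ) - 1) ∧ Cn (bl p ω) 0 v := by
    intro n
    obtain ⟨u, v, hu, hv, hc⟩ := h n
    rw [hu] at hc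
    exact ⟨v, hv, hc.mono Set.inter_subset_left⟩
  obtain ⟨v, hv, hc⟩ := h0 0
  refine ⟨hc.left, ?_⟩
  intro hfin
  obtain ⟨M, hM⟩ := (hfin.image (fun v : Site => |v.1| + |v.2|)).bddAbove
  obtain ⟨v, hv, hc⟩ := h0 (M.toNat + 1)
  have : |v.1| + |v.2| ≤ M := hM ⟨v, (Conn_iff _ _ _ _).2 hc, rfl⟩
  apply hv
  have a1 := abs_le.1 (show |v.1| ≤ M by have := abs_nonneg v.2; omega)
  have a2 := abs_le.1 (show |v.2| ≤ M by have := abs_nonneg v.1; omega)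
  refine ⟨?_, ?_, ?_, ?_⟩ <;> push_cast <;> omega

theorem theta_ge {μ : Measure (Site → ℝ)} (hμ : IsUniformCoupling μ) {p c : ℝ} (hc : ∀ n, c ≤ ar μ p n) :
    c ≤ theta μ p := by
  have hprob := hμ.1
  have hm : ∀ n : ℕ, MeasurableSet {ω | bl p ω ∈ arm n} := by
    intro n
    have l : Loc ((Bx_finite (n : ℤ)).toFinset : Set Site) (arm n) := by
      rw [(Bx_finite (n : ℤ)).coe_toFinset]
      exact CX_local _ _ _
    exact l.meas p
  have ha : Antitone (fun n : ℕ => {ω | bl p ω ∈ arm n}) := by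
    intro m n hmn ω hω
    exact arm_anti (by positivity) (by exact_mod_cast hmn) hω
  have ht := tendsto_measure_iInter_atTop (μ := μ) (fun n => (hm n).nullMeasurableSet) ha
    ⟨0, measure_ne_top _ _⟩
  have ht2 := (ENNReal.tendsto_toReal (measure_ne_top μ _)).comp ht
  have h1 : c ≤ (μ (⋂ n : ℕ, {ω | bl p ω ∈ arm n})).toReal :=
    ge_of_tendsto' ht2 (fun n => hc n)
  refine h1.trans (ENNReal.toReal_mono (measure_ne_top _ _) (measure_mono ?_))
  intro ω hω
  exact arm_conn (fun n => Set.mem_iInter.1 hω n)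

/-! ### Part 10: connecting one more point -/

/-- All the points of `F` are connected inside `D`. -/
def Con (D F : Set Site) : Set (Set Site) := {B | ∀ f ∈ F, ∀ g ∈ F, Cn (B ∩ D) f g}

theorem Con_local (D F : Set Site) : Loc D (Con D F) := by
  intro S S' h hS f hf g hg
  rw [← h]
  exact hS f hf g hg

theorem Con_upper (D F : Set Site) : IsUpperSet (Con D F) := by
  intro S S' h hS f hf g hg
  exact (hS f hf g hg).mono (Set.inter_subset_inter_left _ h)

theorem Con_anti (D : Set Site) {F F' : Set Site} (h : F ⊆ F') : Con D F' ⊆ Con D F :=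
  fun _ hB f hf g hg => hB f (h hf) g (h hg)

theorem Cn_tr {S : Set Site} (t : Site) {a b : Site} (h : Cn S a b) :
    Cn (tr t ⁻¹' S) (a - t) (b - t) := by
  have h2 := h.map (T := tr t ⁻¹' S) (tr (-t)) (tr_adj (-t)) (by
    intro x hx
    show x + -t + t ∈ S
    rw [neg_add_cancel_right]
    exact hx)
  rw [sub_eq_add_neg, sub_eq_add_neg]
  exact h2

theorem Con_tr {μ : Measure (Site → ℝ)} (hμ : IsUniformCoupling μ) {p : ℝ} (hp : 0 ≤ p) (hp1 : p ≤ 1)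
    {D : Set Site} (hD : D.Finite) (F : Set Site) (t : Site) :
    Pr μ p (Con (tr t ⁻¹' D) (tr t ⁻¹' F)) = Pr μ p (Con D F) := by
  rw [← Pr_equiv' hμ hp hp1 (tr t) (hD.preimage (tr t).injective.injOn) (Con_local _ _)]
  congr 1
  ext S
  constructor
  · intro h f hf g hg
    have h1 := h (f - t) (by show f - t + t ∈ F; rwa [sub_add_cancel]) (g - t)
      (by show g - t + t ∈ F; rwa [sub_add_cancel])
    have h2 := h1.map (T := S ∩ D) (tr t) (tr_adj t) (fun x hx => hx)
    rw [tr_apply, tr_apply, sub_add_cancel, sub_add_cancel] at h2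
    exact h2
  · intro h f hf g hg
    have h1 := Cn_tr t (h _ hf _ hg)
    rw [tr_apply, tr_apply, add_sub_cancel_right, add_sub_cancel_right] at h1
    exact h1

/-- Connections after filling a box. -/
def ConP (D F : Set Site) (k : ℤ) : Set (Set Site) := {B | B ∪ Bx k ∈ Con D F}

theorem ConP_local (D F : Set Site) (k : ℤ) : Loc (D \ Bx k) (ConP D F k) := by
  intro S S' h hS
  refine Con_local D F _ _ ?_ hS
  ext v
  have := Set.ext_iff.1 h v
  simp only [Set.mem_inter_iff, Set.mem_union, Set.mem_diff] at this ⊢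
  tauto

theorem ConP_upper (D F : Set Site) (k : ℤ) : IsUpperSet (ConP D F k) := by
  intro S S' h hS
  exact Con_upper D F (Set.union_subset_union_left _ h) hS

theorem ring_reach {B D : Set Site} {k : ℤ} (hk : 1 ≤ k) (hD : Bx (16 * k) ⊆ D) {z : Site}
    (hz : ∀ S u v, Cn S u v → u ∈ Bx (2 * k) → v ∉ Bx (16 * k) →
      ∃ w, Cn (S ∩ Bx (16 * k)) u w ∧ Cn (B ∩ Ann k) z w) {f g : Site} (hf : f ∉ Bx (16 * k))
    (h : Cn ((B ∪ Bx (2 * k)) ∩ D) f g) (hn : ¬ Cn (B ∩ D) f g) : Cn (B ∩ D) f z := by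
  have hfB : f ∈ B ∩ D := by
    rcases h.left with ⟨h1 | h1, h2⟩
    · exact ⟨h1, h2⟩
    · exact (hf (Bx_mono (by omega) h1)).elim
  obtain ⟨a, b, h1, h2, h3, h4, h5⟩ := h.first_exit {x | Cn (B ∩ D) f x} (.refl hfB) hn
  have ha : Cn (B ∩ D) f a := h1.right.2
  have hb : b ∈ Bx (2 * k) := by
    rcases h3 with ⟨g1 | g1, g2⟩
    · exact (h4 (ha.tail h2 ⟨g1, g2⟩)).elim
    · exact g1
  have hpath : Cn ({x | Cn (B ∩ D) f x} ∪ {b}) b f := by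
    refine Cn.head h2.symm (.inr rfl) ?_
    exact (ha.self.mono Set.subset_union_left).symm
  obtain ⟨w, w1, w2⟩ := hz _ _ _ hpath hb hf
  have hw : Cn (B ∩ D) f w := by
    rcases w1.right.1 with h | h
    · exact h
    · rw [Set.mem_singleton_iff] at h
      exact (w2.right.2.2 (h ▸ hb)).elim
  refine hw.trans (w2.symm.mono ?_)
  rintro x ⟨x1, x2, x3⟩
  exact ⟨x1, hD x2⟩

theorem ConP_RG {D F : Set Site} {k : ℤ} (hk : 1 ≤ k) (hD : Bx (16 * k) ⊆ D)
    (hF : ∀ f ∈ F, f ∉ Bx (16 * k)) : ConP D F (2 * k) ∩ RG k ⊆ Con D F := by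
  rintro B ⟨h1, h2⟩ f hf g hg
  obtain ⟨z, -, hz⟩ := meet_out hk h2
  by_contra hn
  have c1 := ring_reach hk hD hz (hF f hf) (h1 f hf g hg) hn
  have c2 := ring_reach hk hD hz (hF g hg) (h1 g hg f hf) (fun h => hn h.symm)
  exact hn (c1.trans c2.symm)

theorem Con_ext0 {μ : Measure (Site → ℝ)} (hμ : IsUniformCoupling μ) {p : ℝ} (hp : 1 / 2 ≤ p) (hp1 : p ≤ 1)
    {D F : Set Site} (hDf : D.Finite) {s : ℕ} (hD : Bx s ⊆ D) (hF0 : F.Nonempty)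
    (hF : ∀ f ∈ F, f ∉ Bx ((s : ℤ) - 1)) :
    Pr μ p (Con D (insert 0 F)) ≤ 2 ^ 446 * ar μ p s * Pr μ p (Con D F) := by
  have hp0 : 0 ≤ p := by linarith
  have hP : 0 ≤ Pr μ p (Con D F) := Pr_nonneg _ _ _
  by_cases hs : s < 17
  · have h1 := Pr_mono hμ (p := p) (Con_anti D (Set.subset_insert (0 : Site) F))
    have h2 := ar_lower hμ hp hp1 (n := s)
    have h3 : 1 ≤ 2 ^ 446 * ar μ p s := by
      have : (1 : ℝ) / 32 ≤ 1 / (s + 1) := by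
        apply one_div_le_one_div_of_le (by positivity)
        have : (s : ℝ) ≤ 16 := by exact_mod_cast (by omega : s ≤ 16)
        linarith
      have h4 : (1 / 2 : ℝ) ^ 65 * (1 / 32) ≤ ar μ p s := le_trans (by gcongr) h2
      have h5 : (2 : ℝ) ^ 70 ≤ 2 ^ 446 := pow_le_pow_right₀ (by norm_num) (by norm_num)
      calc (1 : ℝ) ≤ 2 ^ 70 * ((1 / 2 : ℝ) ^ 65 * (1 / 32)) := by norm_num
        _ ≤ _ := by gcongr
    calc _ ≤ Pr μ p (Con D F) := h1
      _ ≤ _ := le_mul_of_one_le_left hP h3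
  · obtain ⟨k, hk⟩ : ∃ k : ℕ, k = (s - 1) / 16 := ⟨_, rfl⟩
    have hk1 : 1 ≤ k := by omega
    have hk1' : (1 : ℤ) ≤ k := by exact_mod_cast hk1
    have hD' : Bx (16 * k) ⊆ D := (Bx_mono (by omega)).trans hD
    have hF' : ∀ f ∈ F, f ∉ Bx (16 * k) := fun f hf h => hF f hf (Bx_mono (by omega) h)
    have hsub : Con D (insert 0 F) ⊆ arm (2 * k : ℕ) ∩ ConP D F (2 * k) := by
      intro B hB
      obtain ⟨f, hf⟩ := hF0
      constructor
      · obtain ⟨v', h1, h2⟩ := (hB 0 (Set.mem_insert _ _) f (Set.mem_insert_of_mem _ hf)).clip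
          (n := 2 * k) (zero_mem_Bx (by positivity)) (fun h => hF' f hf (Bx_mono (by omega) h))
        refine ⟨0, v', rfl, by push_cast; exact h2, h1.mono ?_⟩
        push_cast
        exact Set.inter_subset_inter_left _ Set.inter_subset_left
      · exact Con_upper D F Set.subset_union_left (Con_anti D (Set.subset_insert (0 : Site) F) hB)
    have e1 := Pr_mono hμ (p := p) hsub
    rw [Pr_indep' hμ (A := Bx (2 * k)) (B := D \ Bx (2 * k)) (Bx_finite _) (hDf.subset Set.diff_subset)
      Set.disjoint_sdiff_right (by have := CX_local (Bx (2 * k : ℕ)) (fun u => u = 0) (fun v => v ∉ Bx ((2 * k : ℕ) - 1));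
                                   push_cast at this; unfold arm; push_cast; exact this) (ConP_local D F _)] at e1
    have e2 := Pr_fkg' hμ hp0 hp1 hDf ((ConP_local D F (2 * k)).mono Set.diff_subset)
      ((RG_local hk1').mono (Set.diff_subset.trans hD')) (ConP_upper _ _ _) (RG_upper _)
    have e3 := Pr_mono hμ (p := p) (ConP_RG hk1' hD' hF')
    have e4 := RG_prob hμ k hk1 hp hp1
    have e5 := ar_compare hμ hp hp1 (m := 2 * k) (n := s) (by omega)
    have n1 : 0 ≤ Pr μ p (ConP D F (2 * k)) := Pr_nonneg _ _ _
    have n2 : 0 ≤ ar μ p s := Pr_nonneg _ _ _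
    have e6 : Pr μ p (ConP D F (2 * k)) * (1 / 2) ^ 186 ≤ Pr μ p (Con D F) :=
      (mul_le_mul_of_nonneg_left e4 n1).trans (e2.trans e3)
    have e7 : Pr μ p (ConP D F (2 * k)) ≤ 2 ^ 186 * Pr μ p (Con D F) := by
      have := mul_le_mul_of_nonneg_left e6 (show (0 : ℝ) ≤ 2 ^ 186 by positivity)
      refine le_trans (le_of_eq ?_) this
      rw [mul_left_comm, ← mul_pow]
      norm_num
    have e8 : ar μ p (2 * k) ≤ 2 ^ 260 * ar μ p s := by
      have h : ((s : ℝ) + 1) ≤ 2 ^ 5 * ((2 * k : ℕ) + 1 : ℝ) := by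
        have : s + 1 ≤ 2 ^ 5 * (2 * k + 1) := by omega
        exact_mod_cast this
      refine le_of_mul_le_mul_right (e5.trans ?_) (show (0 : ℝ) < (2 * k : ℕ) + 1 by positivity)
      calc _ ≤ 2 ^ 255 * (2 ^ 5 * ((2 * k : ℕ) + 1 : ℝ)) * ar μ p s := by gcongr
        _ = (2 ^ 255 * 2 ^ 5) * ar μ p s * ((2 * k : ℕ) + 1 : ℝ) := by ring
        _ = _ := by rw [← pow_add]
    calc _ ≤ ar μ p (2 * k) * Pr μ p (ConP D F (2 * k)) := e1
      _ ≤ (2 ^ 260 * ar μ p s) * (2 ^ 186 * Pr μ p (Con D F)) := mul_le_mul e8 e7 n1 (mul_nonneg (pow_nonneg (by norm_num) _) n2)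
      _ = (2 ^ 260 * 2 ^ 186) * ar μ p s * Pr μ p (Con D F) := by ring
      _ = _ := by rw [← pow_add]

/-- Sup distance. -/
def sd (u v : Site) : ℕ := max (u.1 - v.1).natAbs (u.2 - v.2).natAbs

theorem sd_le {u v : Site} {k : ℕ} : sd u v ≤ k ↔ u - v ∈ Bx k := by
  unfold sd Bx
  simp only [Set.mem_ofPred_eq, Prod.fst_sub, Prod.snd_sub]
  omega

theorem sd_comm (u v : Site) : sd u v = sd v u := by unfold sd; omega

theorem sd_tri (u v w : Site) : sd u w ≤ sd u v + sd v w := by unfold sd; omega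

theorem sd_Bx {u v : Site} {k : ℕ} (h : k ≤ sd u v) : u - v ∉ Bx ((k : ℤ) - 1) := by
  unfold sd at h
  unfold Bx
  simp only [Set.mem_ofPred_eq, Prod.fst_sub, Prod.snd_sub]
  omega

theorem Con_ext {μ : Measure (Site → ℝ)} (hμ : IsUniformCoupling μ) {p : ℝ} (hp : 1 / 2 ≤ p) (hp1 : p ≤ 1)
    {D F : Set Site} (hDf : D.Finite) {s : ℕ} {u : Site} (hD : ∀ v, sd v u ≤ s → v ∈ D) (hF0 : F.Nonempty)
    (hF : ∀ f ∈ F, s ≤ sd f u) :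
    Pr μ p (Con D (insert u F)) ≤ 2 ^ 446 * ar μ p s * Pr μ p (Con D F) := by
  have hp0 : 0 ≤ p := by linarith
  rw [← Con_tr hμ hp0 hp1 hDf F u, ← Con_tr hμ hp0 hp1 hDf (insert u F) u]
  have : tr u ⁻¹' (insert u F) = insert 0 (tr u ⁻¹' F) := by
    ext v
    simp only [Set.mem_preimage, Set.mem_insert_iff, tr_apply, add_eq_right]
  rw [this]
  refine Con_ext0 hμ hp hp1 (hDf.preimage (tr u).injective.injOn) ?_ ?_ ?_
  · intro v hv
    refine hD _ (sd_le.2 ?_)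
    rw [tr_apply, add_sub_cancel_right]
    exact hv
  · obtain ⟨f, hf⟩ := hF0
    exact ⟨f - u, by show f - u + u ∈ F; rwa [sub_add_cancel]⟩
  · intro f hf
    have := sd_Bx (hF _ hf)
    rwa [tr_apply, add_sub_cancel_right] at this

/-- Two points at distance at least `2k+1` are connected. -/
theorem Con_two {μ : Measure (Site → ℝ)} (hμ : IsUniformCoupling μ) {p : ℝ} (hp : 0 ≤ p) (hp1 : p ≤ 1)
    {D : Set Site} {k : ℕ} {u v : Site} (h : 2 * k + 1 ≤ sd u v) :
    Pr μ p (Con D {u, v}) ≤ ar μ p k * ar μ p k := by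
  have l : ∀ t : Site, Loc (tr (-t) ⁻¹' (Bx k)) {S | tr t ⁻¹' S ∈ arm k} := by
    intro t S S' hS hh
    refine (CX_local (Bx k) _ _) _ _ ?_ hh
    ext x
    have := Set.ext_iff.1 hS (tr t x)
    simp only [Set.mem_inter_iff, Set.mem_preimage, tr_apply, add_neg_cancel_right] at this ⊢
    exact this
  have f : ∀ t : Site, (tr (-t) ⁻¹' (Bx k)).Finite := fun t => (Bx_finite k).preimage (tr (-t)).injective.injOn
  have e : ∀ t : Site, Pr μ p {S | tr t ⁻¹' S ∈ arm k} = ar μ p k := fun t =>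
    Pr_equiv' hμ hp hp1 (tr t) (Bx_finite k) (CX_local _ _ _)
  have hd : Disjoint (tr (-u) ⁻¹' (Bx k)) (tr (-v) ⁻¹' (Bx k)) := by
    rw [Set.disjoint_left]
    intro x hx hx'
    rw [Set.mem_preimage, tr_apply, ← sub_eq_add_neg] at hx hx'
    have h1 := sd_le.2 hx
    have h2 := sd_le.2 hx'
    have := sd_tri u x v
    rw [sd_comm u x] at this
    omega
  have key : ∀ (B : Set Site) (a b : Site), k + 1 ≤ sd b a → Cn (B ∩ D) a b → B ∈ {S | tr a ⁻¹' S ∈ arm k} := by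
    intro B a b hab hc
    have h1 := Cn_tr a hc
    rw [sub_self] at h1
    obtain ⟨v', g1, g2⟩ := h1.clip (n := (k : ℤ)) (zero_mem_Bx (by positivity))
      (by have := sd_Bx hab; push_cast at this; intro hh; exact this (Bx_mono (by omega) hh))
    refine ⟨0, v', rfl, g2, g1.mono ?_⟩
    rintro x ⟨⟨hx, -⟩, hx'⟩
    exact ⟨hx, hx'⟩
  have hsub : Con D {u, v} ⊆ {S | tr u ⁻¹' S ∈ arm k} ∩ {S | tr v ⁻¹' S ∈ arm k} := by
    intro B hB
    have hc := hB u (by simp) v (by simp)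
    exact ⟨key B u v (by rw [sd_comm]; omega) hc, key B v u (by omega) hc.symm⟩
  refine (Pr_mono hμ hsub).trans ?_
  rw [Pr_indep' hμ (f u) (f v) hd (l u) (l v), e, e]

/-! ### Part 11: moments of cluster volumes -/

/-- Sup ball as a finset. -/
def bxF (f : Site) (R : ℕ) : Finset Site :=
  Finset.Icc (f.1 - R) (f.1 + R) ×ˢ Finset.Icc (f.2 - R) (f.2 + R)

theorem mem_bxF {f u : Site} {R : ℕ} : u ∈ bxF f R ↔ sd u f ≤ R := by
  unfold bxF sd
  simp only [Finset.mem_product, Finset.mem_Icc]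
  omega

theorem card_bxF (f : Site) (R : ℕ) : (bxF f R).card = (2 * R + 1) ^ 2 := by
  unfold bxF
  rw [Finset.card_product, Int.card_Icc, Int.card_Icc, sq]
  congr 1 <;> omega

theorem sum_bxF (f : Site) (R : ℕ) : ∑ u ∈ bxF f R, 1 / ((sd u f : ℝ) + 1) ≤ 8 * (R + 1) := by
  induction R with
  | zero =>
    have : ∑ u ∈ bxF f 0, 1 / ((sd u f : ℝ) + 1) ≤ ∑ u ∈ bxF f 0, (1 : ℝ) := by
      refine Finset.sum_le_sum (fun u _ => ?_)
      rw [div_le_one (by positivity)]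
      linarith [show (0 : ℝ) ≤ sd u f by positivity]
    rw [Finset.sum_const, card_bxF] at this
    norm_num at this ⊢
    linarith
  | succ R ih =>
    have hsub : bxF f R ⊆ bxF f (R + 1) := by
      intro u hu
      rw [mem_bxF] at *
      omega
    rw [← Finset.sum_sdiff hsub]
    have h1 : ∑ u ∈ bxF f (R + 1) \ bxF f R, 1 / ((sd u f : ℝ) + 1) ≤
        ∑ u ∈ bxF f (R + 1) \ bxF f R, 1 / ((R : ℝ) + 1) := by
      refine Finset.sum_le_sum (fun u hu => ?_)
      rw [Finset.mem_sdiff, mem_bxF, mem_bxF] at hu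
      have : (R : ℝ) ≤ sd u f := by exact_mod_cast (by omega : R ≤ sd u f)
      gcongr
    rw [Finset.sum_const, Finset.card_sdiff_of_subset hsub, card_bxF, card_bxF, nsmul_eq_mul,
      show (2 * (R + 1) + 1) ^ 2 - (2 * R + 1) ^ 2 = 8 * (R + 1) by
        rw [show (2 * (R + 1) + 1) ^ 2 = 8 * (R + 1) + (2 * R + 1) ^ 2 by ring]; omega] at h1
    push_cast at h1 ⊢
    rw [mul_one_div, mul_div_assoc, div_self (by positivity)] at h1
    linarith

theorem sum_ball {Λ : Finset Site} {f : Site} {R : ℕ} (h : ∀ u ∈ Λ, sd u f ≤ R) :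
    ∑ u ∈ Λ, 1 / ((sd u f : ℝ) + 1) ≤ 8 * (R + 1) :=
  (Finset.sum_le_sum_of_subset_of_nonneg (fun u hu => mem_bxF.2 (h u hu))
    (fun _ _ _ => by positivity)).trans (sum_bxF f R)

theorem card_ball {Λ : Finset Site} {f : Site} {R : ℕ} (h : ∀ u ∈ Λ, sd u f ≤ R) :
    Λ.card ≤ (2 * R + 1) ^ 2 := by
  rw [← card_bxF f R]
  exact Finset.card_le_card (fun u hu => mem_bxF.2 (h u hu))

theorem weight_sum {Λ F : Finset Site} {v1 : Site} {r l K N : ℕ} (hΛ : ∀ u ∈ Λ, sd u v1 ≤ r)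
    (hF : ∀ f ∈ F, sd f v1 ≤ r) (hK : F.card ≤ K) (hK1 : 1 ≤ K) (hN : Λ.card ≤ N) :
    ∑ u ∈ Λ, (1 / ((l : ℝ) + 1) + ∑ f ∈ F, if sd u f ≤ l then 1 / ((sd u f : ℝ) + 1) else 0) ≤
      ((min r l : ℕ) + 1) * (20 * K + N / ((l : ℝ) + 1) ^ 2) := by
  rw [Finset.sum_add_distrib, Finset.sum_comm]
  have h1 : ∑ f ∈ F, ∑ u ∈ Λ, (if sd u f ≤ l then 1 / ((sd u f : ℝ) + 1) else 0) ≤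
      ∑ f ∈ F, 16 * (((min r l : ℕ) : ℝ) + 1) := by
    refine Finset.sum_le_sum (fun f hf => ?_)
    rw [← Finset.sum_filter]
    refine (sum_ball (R := min l (2 * r)) ?_).trans ?_
    · intro u hu
      rw [Finset.mem_filter] at hu
      have a1 := sd_tri u v1 f
      have a2 := hΛ u hu.1
      have a3 := hF f hf
      rw [sd_comm v1 f] at a1
      omega
    · have : ((min l (2 * r) : ℕ) : ℝ) ≤ 2 * (min r l : ℕ) := by
        exact_mod_cast (by omega : min l (2 * r) ≤ 2 * min r l)
      linarith
  have h2 : ∑ f ∈ F, 16 * (((min r l : ℕ) : ℝ) + 1) ≤ K * (16 * (((min r l : ℕ) : ℝ) + 1)) := by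
    rw [Finset.sum_const, nsmul_eq_mul]
    have : (F.card : ℝ) ≤ K := by exact_mod_cast hK
    gcongr
  have h3 : ∑ u ∈ Λ, 1 / ((l : ℝ) + 1) ≤ ((min r l : ℕ) + 1) * (4 + N / ((l : ℝ) + 1) ^ 2) := by
    rw [Finset.sum_const, nsmul_eq_mul, mul_one_div]
    have hl : (0 : ℝ) < (l : ℝ) + 1 := by positivity
    have hN' : (Λ.card : ℝ) ≤ N := by exact_mod_cast hN
    rcases le_total l r with h | h
    · rw [min_eq_right h]
      have : (Λ.card : ℝ) / (l + 1) ≤ N / (l + 1) := by gcongr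
      have e : (N : ℝ) / (l + 1) = (l + 1) * (N / ((l : ℝ) + 1) ^ 2) := by field_simp
      rw [mul_add]
      linarith
    · rw [min_eq_left h]
      have hc : (Λ.card : ℝ) ≤ (2 * r + 1) ^ 2 := by exact_mod_cast card_ball hΛ
      have hr : (r : ℝ) ≤ l := by exact_mod_cast h
      have hr0 : (0 : ℝ) ≤ r := by positivity
      have e : (Λ.card : ℝ) / (l + 1) ≤ (r + 1) * 4 := by
        rw [div_le_iff₀ hl]
        nlinarith
      have : (0 : ℝ) ≤ (r + 1) * (N / ((l : ℝ) + 1) ^ 2) := by positivity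
      rw [mul_add]
      linarith
  have hK' : (1 : ℝ) ≤ K := by exact_mod_cast hK1
  have : (0 : ℝ) ≤ ((min r l : ℕ) : ℝ) := by positivity
  nlinarith

/-- The growth factor. -/
def AA (a : ℝ) (l K N r : ℕ) : ℝ :=
  2 ^ 446 * 2 ^ 255 * (l + 1) * a * (((min r l : ℕ) + 1) * (20 * K + N / ((l : ℝ) + 1) ^ 2))

theorem Con_sum {μ : Measure (Site → ℝ)} (hμ : IsUniformCoupling μ) {p : ℝ} (hp : 1 / 2 ≤ p) (hp1 : p ≤ 1)
    {D : Set Site} (hDf : D.Finite) {Λ F : Finset Site} {v1 : Site} {r l K N : ℕ}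
    (hD : ∀ u ∈ Λ, ∀ v, sd v u ≤ l → v ∈ D) (hΛ : ∀ u ∈ Λ, sd u v1 ≤ r)
    (hF : ∀ f ∈ F, sd f v1 ≤ r) (hF0 : F.Nonempty) (hK : F.card ≤ K) (hN : Λ.card ≤ N) :
    ∑ u ∈ Λ, Pr μ p (Con D (insert u F : Finset Site)) ≤ AA (ar μ p l) l K N r * Pr μ p (Con D F) := by
  have hK1 : 1 ≤ K := le_trans (Finset.card_pos.2 hF0) hK
  have hP : 0 ≤ Pr μ p (Con D F) := Pr_nonneg _ _ _
  have ha : 0 ≤ ar μ p l := Pr_nonneg _ _ _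
  have hc0 : 0 ≤ 2 ^ 446 * 2 ^ 255 * ((l : ℝ) + 1) * ar μ p l * Pr μ p (Con D F) :=
    mul_nonneg (mul_nonneg (mul_nonneg (mul_nonneg (pow_nonneg (by norm_num) _) (pow_nonneg (by norm_num) _))
      (by positivity)) ha) hP
  have key : ∀ u ∈ Λ, Pr μ p (Con D (insert u F : Finset Site)) ≤
      (2 ^ 446 * 2 ^ 255 * (l + 1) * ar μ p l * Pr μ p (Con D F)) *
      (1 / ((l : ℝ) + 1) + ∑ f ∈ F, if sd u f ≤ l then 1 / ((sd u f : ℝ) + 1) else 0) := by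
    intro u hu
    obtain ⟨f0, hf0, hmin⟩ := Finset.exists_min_image F (fun f => sd f u) hF0
    set m := min (sd f0 u) l with hm
    have e1 := Con_ext hμ hp hp1 hDf (s := m) (u := u) (F := (F : Set Site))
      (fun v hv => hD u hu v (by omega)) (by exact_mod_cast hF0)
      (fun f hf => by have := hmin f (by exact_mod_cast hf); omega)
    have e2 := ar_compare hμ hp hp1 (m := m) (n := l) (by omega)
    have hm0 : (0 : ℝ) < (m : ℝ) + 1 := by positivity
    have e3 : ar μ p m ≤ 2 ^ 255 * (l + 1) * ar μ p l * (1 / (m + 1)) := by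
      rw [mul_one_div, le_div_iff₀ hm0]
      exact e2
    have hnn : ∀ f ∈ F, (0 : ℝ) ≤ if sd u f ≤ l then 1 / ((sd u f : ℝ) + 1) else 0 := by
      intro f _
      split_ifs
      · positivity
      · exact le_rfl
    have e4 : 1 / ((m : ℝ) + 1) ≤ 1 / ((l : ℝ) + 1) +
        ∑ f ∈ F, if sd u f ≤ l then 1 / ((sd u f : ℝ) + 1) else 0 := by
      by_cases hc : sd f0 u ≤ l
      · have h1 := Finset.single_le_sum hnn hf0
        rw [sd_comm u f0, if_pos hc] at h1
        rw [hm, min_eq_left hc]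
        have : (0 : ℝ) ≤ 1 / ((l : ℝ) + 1) := by positivity
        linarith
      · have h1 := Finset.sum_nonneg hnn
        rw [hm, min_eq_right (by omega)]
        linarith
    rw [Finset.coe_insert]
    calc _ ≤ 2 ^ 446 * ar μ p m * Pr μ p (Con D F) := e1
      _ ≤ 2 ^ 446 * (2 ^ 255 * (l + 1) * ar μ p l * (1 / (m + 1))) * Pr μ p (Con D F) := by gcongr
      _ = (2 ^ 446 * 2 ^ 255 * (l + 1) * ar μ p l * Pr μ p (Con D F)) * (1 / (m + 1)) := by
        generalize (2 : ℝ) ^ 446 = x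
        generalize (2 : ℝ) ^ 255 = y
        ring
      _ ≤ _ := mul_le_mul_of_nonneg_left e4 hc0
  refine (Finset.sum_le_sum key).trans ?_
  rw [← Finset.mul_sum]
  refine (mul_le_mul_of_nonneg_left (weight_sum hΛ hF hK hK1 hN) hc0).trans (le_of_eq ?_)
  unfold AA
  generalize (2 : ℝ) ^ 446 = x
  generalize (2 : ℝ) ^ 255 = y
  ring

open Classical in
/-- Recursive moment functional. -/
def gm (D : Set Site) (Λ : Finset Site) : ℕ → Finset Site → Set Site → ENNReal
  | 0, F, B => if B ∈ Con D F then 1 else 0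
  | j + 1, F, B => ∑ u ∈ Λ, gm D Λ j (insert u F) B

theorem Con_meas {μ : Measure (Site → ℝ)} (hμ : IsUniformCoupling μ) (p : ℝ) {D : Set Site} (hDf : D.Finite)
    (F : Set Site) : MeasurableSet {ω | bl p ω ∈ Con D F} := by
  have l : Loc (hDf.toFinset : Set Site) (Con D F) := by
    rw [hDf.coe_toFinset]
    exact Con_local _ _
  exact l.meas p

theorem gm_meas {μ : Measure (Site → ℝ)} (hμ : IsUniformCoupling μ) (p : ℝ) {D : Set Site} (hDf : D.Finite)
    (Λ : Finset Site) (j : ℕ) (F : Finset Site) : Measurable (fun ω => gm D Λ j F (bl p ω)) := by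
  induction j generalizing F with
  | zero =>
    exact Measurable.ite (Con_meas hμ p hDf F) measurable_const measurable_const
  | succ j ih =>
    exact Finset.measurable_fun_sum _ (fun u _ => ih _)

theorem gm_upper {μ : Measure (Site → ℝ)} (hμ : IsUniformCoupling μ) {p : ℝ} (hp : 1 / 2 ≤ p) (hp1 : p ≤ 1)
    {D : Set Site} (hDf : D.Finite) {Λ : Finset Site} {v1 : Site} {r l K N : ℕ}
    (hD : ∀ u ∈ Λ, ∀ v, sd v u ≤ l → v ∈ D) (hΛ : ∀ u ∈ Λ, sd u v1 ≤ r) (hN : Λ.card ≤ N) (j : ℕ)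
    (F : Finset Site) (hF : ∀ f ∈ F, sd f v1 ≤ r) (hF0 : F.Nonempty) (hK : F.card + j ≤ K) :
    ∫⁻ ω, gm D Λ j F (bl p ω) ∂μ ≤ ENNReal.ofReal (AA (ar μ p l) l K N r ^ j * Pr μ p (Con D F)) := by
  have hprob := hμ.1
  have hA : 0 ≤ AA (ar μ p l) l K N r := by
    have : 0 ≤ ar μ p l := Pr_nonneg _ _ _
    unfold AA
    positivity
  induction j generalizing F with
  | zero =>
    have : (fun ω => gm D Λ 0 F (bl p ω)) = Set.indicator {ω | bl p ω ∈ Con D F} 1 := by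
      funext ω
      rfl
    rw [this, lintegral_indicator_one (Con_meas hμ p hDf F), pow_zero, one_mul]
    unfold Pr Measure.real
    rw [ENNReal.ofReal_toReal (measure_ne_top _ _)]
  | succ j ih =>
    show ∫⁻ ω, ∑ u ∈ Λ, gm D Λ j (insert u F) (bl p ω) ∂μ ≤ _
    rw [lintegral_finset_sum _ (fun u _ => gm_meas hμ p hDf Λ j _)]
    have h1 : ∀ u ∈ Λ, ∫⁻ ω, gm D Λ j (insert u F) (bl p ω) ∂μ ≤
        ENNReal.ofReal (AA (ar μ p l) l K N r ^ j * Pr μ p (Con D (insert u F : Finset Site))) := by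
      intro u hu
      refine ih _ ?_ (Finset.insert_nonempty _ _) ?_
      · intro f hf
        rcases Finset.mem_insert.1 hf with rfl | hf
        · exact hΛ _ hu
        · exact hF f hf
      · have := Finset.card_insert_le u F
        omega
    refine (Finset.sum_le_sum h1).trans ?_
    rw [← ENNReal.ofReal_sum_of_nonneg (fun u _ => mul_nonneg (pow_nonneg hA _) (Pr_nonneg _ _ _)),
      ← Finset.mul_sum]
    apply ENNReal.ofReal_le_ofReal
    have h2 := Con_sum hμ hp hp1 hDf hD hΛ hF hF0 (K := K) (by omega) hN
    calc _ ≤ AA (ar μ p l) l K N r ^ j * (AA (ar μ p l) l K N r * Pr μ p (Con D F)) :=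
          mul_le_mul_of_nonneg_left h2 (pow_nonneg hA _)
      _ = _ := by rw [pow_succ, mul_assoc]

theorem gm_lower {D : Set Site} {Λ C : Finset Site} (hC : C ⊆ Λ) {B : Set Site} (j : ℕ) (F : Finset Site)
    (hB : B ∈ Con D (F ∪ C : Finset Site)) : (C.card : ENNReal) ^ j ≤ gm D Λ j F B := by
  induction j generalizing F with
  | zero =>
    have : B ∈ Con D F := Con_anti D (by intro x hx; simp only [Finset.coe_union]; exact .inl hx) hB
    unfold gm
    rw [if_pos this, pow_zero]
  | succ j ih =>
    show _ ≤ ∑ u ∈ Λ, gm D Λ j (insert u F) B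
    have h1 : ∑ u ∈ C, (C.card : ENNReal) ^ j ≤ ∑ u ∈ C, gm D Λ j (insert u F) B := by
      refine Finset.sum_le_sum (fun u hu => ih _ ?_)
      refine Con_anti D ?_ hB
      intro x hx
      simp only [Finset.coe_union, Finset.coe_insert, Set.mem_union, Set.mem_insert_iff] at hx ⊢
      rcases hx with (rfl | hx) | hx
      · exact .inr hu
      · exact .inl hx
      · exact .inr hx
    rw [Finset.sum_const, nsmul_eq_mul] at h1
    rw [pow_succ, mul_comm]
    exact h1.trans (Finset.sum_le_sum_of_subset hC)

theorem rank_sum (C : Finset Site) (f : Site → ℕ) (j : ℕ) :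
    C.card ^ (j + 1) ≤ 2 ^ (j + 1) * ∑ v ∈ C, (C.filter (fun u => f u ≤ f v)).card ^ j := by
  classical
  set G := C.filter (fun v => 2 * (C.filter (fun u => f u ≤ f v)).card < C.card) with hG
  have hGc : 2 * G.card ≤ C.card := by
    rcases G.eq_empty_or_nonempty with h | h
    · rw [h]; simp
    · obtain ⟨v, hv, hmax⟩ := Finset.exists_max_image G f h
      have h1 : G ⊆ C.filter (fun u => f u ≤ f v) := by
        intro u hu
        exact Finset.mem_filter.2 ⟨(Finset.mem_filter.1 hu).1, hmax u hu⟩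
      have h2 := (Finset.mem_filter.1 hv).2
      have h3 := Finset.card_le_card h1
      omega
  have hsub : G ⊆ C := Finset.filter_subset _ _
  have h1 : ∑ v ∈ C \ G, C.card ^ j ≤ ∑ v ∈ C \ G, 2 ^ j * (C.filter (fun u => f u ≤ f v)).card ^ j := by
    refine Finset.sum_le_sum (fun v hv => ?_)
    rw [Finset.mem_sdiff, hG, Finset.mem_filter] at hv
    rw [← mul_pow]
    refine Nat.pow_le_pow_left ?_ _
    by_contra hne
    exact hv.2 ⟨hv.1, by omega⟩
  rw [Finset.sum_const, smul_eq_mul, Finset.card_sdiff_of_subset hsub, ← Finset.mul_sum] at h1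
  have h2 : ∑ v ∈ C \ G, (C.filter (fun u => f u ≤ f v)).card ^ j ≤
      ∑ v ∈ C, (C.filter (fun u => f u ≤ f v)).card ^ j := Finset.sum_le_sum_of_subset Finset.sdiff_subset
  calc C.card ^ (j + 1) = C.card ^ j * C.card := pow_succ _ _
    _ ≤ C.card ^ j * (2 * (C.card - G.card)) := Nat.mul_le_mul_left _ (by omega)
    _ = 2 * ((C.card - G.card) * C.card ^ j) := by ring
    _ ≤ 2 * (2 ^ j * ∑ v ∈ C \ G, (C.filter (fun u => f u ≤ f v)).card ^ j) := Nat.mul_le_mul_left _ h1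
    _ ≤ 2 * (2 ^ j * ∑ v ∈ C, (C.filter (fun u => f u ≤ f v)).card ^ j) := by gcongr
    _ = _ := by ring

theorem moment_bound {μ : Measure (Site → ℝ)} (hμ : IsUniformCoupling μ) {p : ℝ} (hp : 1 / 2 ≤ p) (hp1 : p ≤ 1)
    {D : Set Site} (hDf : D.Finite) {V : Finset Site} {l : ℕ}
    (hD : ∀ u ∈ V, ∀ v, sd v u ≤ l → v ∈ D) (j : ℕ) {t : ℝ} (ht : 0 ≤ t) {E : Set (Site → ℝ)}
    (hE : ∀ ω ∈ E, ∃ C : Finset Site, C ⊆ V ∧ bl p ω ∈ Con D C ∧ t ≤ C.card) :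
    t ^ (j + 2) * μ.real E ≤ 2 ^ (j + 1) * ∑ v1 ∈ V, ∑ v2 ∈ V,
      AA (ar μ p l) l (j + 2) V.card (sd v2 v1) ^ j * Pr μ p (Con D ({v1, v2} : Finset Site)) := by
  have hprob := hμ.1
  have ha : 0 ≤ ar μ p l := Pr_nonneg _ _ _
  have hA : ∀ r, 0 ≤ AA (ar μ p l) l (j + 2) V.card r := by
    intro r
    unfold AA
    positivity
  have hnn : ∀ v1 v2, 0 ≤ AA (ar μ p l) l (j + 2) V.card (sd v2 v1) ^ j *
      Pr μ p (Con D ({v1, v2} : Finset Site)) :=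
    fun v1 v2 => mul_nonneg (pow_nonneg (hA _) _) (Pr_nonneg _ _ _)
  set G : (Site → ℝ) → ENNReal := fun ω => 2 ^ (j + 1) * ∑ v1 ∈ V, ∑ v2 ∈ V,
    gm D (V.filter (fun u => sd u v1 ≤ sd v2 v1)) j {v1, v2} (bl p ω) with hG
  have hGm : Measurable G := by
    refine Measurable.const_mul ?_ _
    exact Finset.measurable_fun_sum _ (fun v1 _ => Finset.measurable_fun_sum _ (fun v2 _ => gm_meas hμ p hDf _ _ _))
  have hsub : E ⊆ {ω | ENNReal.ofReal (t ^ (j + 2)) ≤ G ω} := by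
    intro ω hω
    obtain ⟨C, hCV, hC, htC⟩ := hE ω hω
    have h1 : ENNReal.ofReal (t ^ (j + 2)) ≤ (C.card : ENNReal) ^ (j + 2) := by
      have : ((C.card : ENNReal)) ^ (j + 2) = ENNReal.ofReal ((C.card : ℝ) ^ (j + 2)) := by
        rw [ENNReal.ofReal_pow (by positivity), ENNReal.ofReal_natCast]
      rw [this]
      apply ENNReal.ofReal_le_ofReal
      gcongr
    have h2 : ∀ v1 ∈ C, (C.card : ENNReal) ^ (j + 1) ≤ 2 ^ (j + 1) * ∑ v2 ∈ C,
        gm D (V.filter (fun u => sd u v1 ≤ sd v2 v1)) j {v1, v2} (bl p ω) := by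
      intro v1 hv1
      have r := rank_sum C (fun u => sd u v1) j
      have r' : ((C.card ^ (j + 1) : ℕ) : ENNReal) ≤
        ((2 ^ (j + 1) * ∑ v ∈ C, (C.filter (fun u => sd u v1 ≤ sd v v1)).card ^ j : ℕ) : ENNReal) := by
        exact_mod_cast r
      push_cast at r'
      refine r'.trans ?_
      gcongr with v2 hv2
      refine gm_lower (Finset.filter_subset_filter _ hCV) j _ ?_
      refine Con_anti D ?_ hC
      intro x hx
      simp only [Finset.coe_union, Finset.coe_insert, Finset.coe_singleton, Set.mem_union, Set.mem_insert_iff,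
        Set.mem_singleton_iff, Finset.mem_coe, Finset.mem_filter] at hx ⊢
      rcases hx with (rfl | rfl) | hx
      · exact hv1
      · exact hv2
      · exact hx.1
    have h3 : (C.card : ENNReal) ^ (j + 2) ≤ 2 ^ (j + 1) * ∑ v1 ∈ C, ∑ v2 ∈ C,
        gm D (V.filter (fun u => sd u v1 ≤ sd v2 v1)) j {v1, v2} (bl p ω) := by
      rw [Finset.mul_sum]
      have := Finset.sum_le_sum h2
      rw [Finset.sum_const, nsmul_eq_mul] at this
      rw [pow_succ, mul_comm]
      exact this
    refine h1.trans (h3.trans ?_)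
    have h4 : ∑ v1 ∈ C, ∑ v2 ∈ C, gm D (V.filter (fun u => sd u v1 ≤ sd v2 v1)) j {v1, v2} (bl p ω) ≤
        ∑ v1 ∈ V, ∑ v2 ∈ V, gm D (V.filter (fun u => sd u v1 ≤ sd v2 v1)) j {v1, v2} (bl p ω) :=
      le_trans (Finset.sum_le_sum_of_subset hCV)
        (Finset.sum_le_sum (fun v1 _ => Finset.sum_le_sum_of_subset hCV))
    exact mul_le_mul' le_rfl h4
  have hmk := mul_meas_ge_le_lintegral (μ := μ) hGm (ENNReal.ofReal (t ^ (j + 2)))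
  have hup : ∫⁻ ω, G ω ∂μ ≤ ENNReal.ofReal (2 ^ (j + 1) * ∑ v1 ∈ V, ∑ v2 ∈ V,
      AA (ar μ p l) l (j + 2) V.card (sd v2 v1) ^ j * Pr μ p (Con D ({v1, v2} : Finset Site))) := by
    rw [hG, lintegral_const_mul _ (Finset.measurable_fun_sum _ (fun v1 _ =>
      Finset.measurable_fun_sum _ (fun v2 _ => gm_meas hμ p hDf _ _ _))),
      ENNReal.ofReal_mul (by positivity), lintegral_finset_sum _ (fun v1 _ =>
      Finset.measurable_fun_sum _ (fun v2 _ => gm_meas hμ p hDf _ _ _)),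
      ENNReal.ofReal_sum_of_nonneg (fun v1 _ => Finset.sum_nonneg (fun v2 _ => hnn v1 v2)),
      ENNReal.ofReal_pow (by norm_num), show ENNReal.ofReal 2 = 2 by simp]
    gcongr with v1 hv1
    rw [lintegral_finset_sum _ (fun v2 _ => gm_meas hμ p hDf _ _ _),
      ENNReal.ofReal_sum_of_nonneg (fun v2 _ => hnn v1 v2)]
    gcongr with v2 hv2
    refine gm_upper hμ hp hp1 hDf (v1 := v1) ?_ ?_ ?_ j _ ?_ ?_ ?_
    · intro u hu
      exact hD u (Finset.mem_filter.1 hu).1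
    · intro u hu
      exact (Finset.mem_filter.1 hu).2
    · exact Finset.card_le_card (Finset.filter_subset _ _)
    · intro f hf
      rcases Finset.mem_insert.1 hf with rfl | hf
      · unfold sd; omega
      · rw [Finset.mem_singleton.1 hf]
    · exact Finset.insert_nonempty _ _
    · have := Finset.card_le_two (a := v1) (b := v2)
      omega
  have hfin : ENNReal.ofReal (t ^ (j + 2) * μ.real E) ≤ ENNReal.ofReal (2 ^ (j + 1) * ∑ v1 ∈ V, ∑ v2 ∈ V,
      AA (ar μ p l) l (j + 2) V.card (sd v2 v1) ^ j * Pr μ p (Con D ({v1, v2} : Finset Site))) := by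
    refine le_trans ?_ (hmk.trans hup)
    rw [ENNReal.ofReal_mul (by positivity)]
    gcongr
    unfold Measure.real
    rw [ENNReal.ofReal_toReal (measure_ne_top _ _)]
    exact measure_mono hsub
  refine (ENNReal.ofReal_le_ofReal_iff ?_).1 hfin
  exact mul_nonneg (by positivity) (Finset.sum_nonneg (fun v1 _ => Finset.sum_nonneg (fun v2 _ => hnn v1 v2)))

/-! ### Part 12: conclusion -/

theorem two_pt {μ : Measure (Site → ℝ)} (hμ : IsUniformCoupling μ) {p : ℝ} (hp : 1 / 2 ≤ p) (hp1 : p ≤ 1)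
    {D : Set Site} (v1 v2 : Site) (l : ℕ) :
    Pr μ p (Con D ({v1, v2} : Finset Site)) * (((min (sd v2 v1) l : ℕ) : ℝ) + 1) ^ 2 ≤
      9 * (2 ^ 255 * (l + 1) * ar μ p l) ^ 2 := by
  have hprob := hμ.1
  have ha : 0 ≤ ar μ p l := Pr_nonneg _ _ _
  have hP1 : Pr μ p (Con D ({v1, v2} : Finset Site)) ≤ 1 := Pr_le_one hμ _ _
  have hP0 : 0 ≤ Pr μ p (Con D ({v1, v2} : Finset Site)) := Pr_nonneg _ _ _
  rcases Nat.eq_zero_or_pos (sd v2 v1) with h | h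
  · rw [h, Nat.zero_min]
    have h2 := ar_lower hμ hp hp1 l
    have hl : (0 : ℝ) < (l : ℝ) + 1 := by positivity
    have h3 : (1 : ℝ) ≤ 2 ^ 255 * (l + 1) * ar μ p l := by
      rw [mul_one_div, div_le_iff₀ hl] at h2
      have : (0 : ℝ) ≤ (l + 1) * ar μ p l := by positivity
      norm_num at h2 ⊢
      nlinarith
    have h4 : (1 : ℝ) ≤ (2 ^ 255 * (l + 1) * ar μ p l) ^ 2 := one_le_pow₀ h3
    simp only [Nat.cast_zero, zero_add, one_pow, mul_one]
    linarith
  · obtain ⟨k, hk⟩ : ∃ k, k = min ((sd v2 v1 - 1) / 2) l := ⟨_, rfl⟩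
    have h1 := Con_two hμ (by linarith : (0 : ℝ) ≤ p) hp1 (D := D) (k := k) (u := v1) (v := v2)
      (by rw [sd_comm]; omega)
    have h2 := ar_compare hμ hp hp1 (m := k) (n := l) (by omega)
    have hs : ((min (sd v2 v1) l : ℕ) : ℝ) + 1 ≤ 3 * (k + 1) := by
      exact_mod_cast (by omega : min (sd v2 v1) l + 1 ≤ 3 * (k + 1))
    have hk0 : 0 ≤ ar μ p k := Pr_nonneg _ _ _
    have e : (({v1, v2} : Finset Site) : Set Site) = {v1, v2} := by simp
    rw [e] at *
    calc _ ≤ (ar μ p k * ar μ p k) * (3 * (k + 1)) ^ 2 := by gcongr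
      _ = 9 * (ar μ p k * (k + 1)) ^ 2 := by ring
      _ ≤ 9 * (2 ^ 255 * (l + 1) * ar μ p l) ^ 2 := by
        have : 0 ≤ ar μ p k * (k + 1) := by positivity
        exact mul_le_mul_of_nonneg_left (pow_le_pow_left₀ this h2 2) (by norm_num)

theorem pair_bound {μ : Measure (Site → ℝ)} (hμ : IsUniformCoupling μ) {p : ℝ} (hp : 1 / 2 ≤ p) (hp1 : p ≤ 1)
    {D : Set Site} (v1 v2 : Site) (l N j : ℕ) (hj : 2 ≤ j) :
    AA (ar μ p l) l (j + 2) N (sd v2 v1) ^ j * Pr μ p (Con D ({v1, v2} : Finset Site)) ≤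
      (2 ^ 446 * 2 ^ 255 * ar μ p l * (20 * ((j : ℝ) + 2) * ((l : ℝ) + 1) ^ 2 + N)) ^ j *
        (9 * (2 ^ 255) ^ 2 * ar μ p l ^ 2) := by
  have ha : 0 ≤ ar μ p l := Pr_nonneg _ _ _
  have hP0 : 0 ≤ Pr μ p (Con D ({v1, v2} : Finset Site)) := Pr_nonneg _ _ _
  have h := two_pt hμ hp hp1 (D := D) v1 v2 l
  have hl : (0 : ℝ) < (l : ℝ) + 1 := by positivity
  obtain ⟨C1, hC1⟩ : ∃ C : ℝ, C = 2 ^ 446 * 2 ^ 255 := ⟨_, rfl⟩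
  have hC1p : 0 ≤ C1 := by
    rw [hC1]; exact mul_nonneg (pow_nonneg (by norm_num) _) (pow_nonneg (by norm_num) _)
  obtain ⟨b, hb⟩ : ∃ C : ℝ, C = 2 ^ 255 := ⟨_, rfl⟩
  unfold AA
  rw [← hC1]
  rw [← hb] at h ⊢
  set s : ℝ := ((min (sd v2 v1) l : ℕ) : ℝ) + 1 with hs
  have hs0 : 0 < s := by positivity
  have hsl : s ≤ l + 1 := by
    rw [hs]
    have : ((min (sd v2 v1) l : ℕ) : ℝ) ≤ l := by exact_mod_cast min_le_right _ _
    linarith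
  set σ : ℝ := s / (l + 1) with hσ
  have hσ0 : 0 ≤ σ := by positivity
  have hσ1 : σ ≤ 1 := by rw [hσ, div_le_one hl]; exact hsl
  set Z : ℝ := C1 * ar μ p l * (20 * ((j : ℝ) + 2) * ((l : ℝ) + 1) ^ 2 + N) with hZ
  have hZ0 : 0 ≤ Z := by positivity
  have e : C1 * (l + 1) * ar μ p l * (s * (20 * ((j + 2 : ℕ) : ℝ) + N / ((l : ℝ) + 1) ^ 2)) = Z * σ := by
    rw [hZ, hσ]
    push_cast
    field_simp
  rw [e, mul_pow]
  have h2 : σ ^ j ≤ σ ^ 2 := pow_le_pow_of_le_one hσ0 hσ1 hj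
  have h3 : σ ^ 2 * Pr μ p (Con D ({v1, v2} : Finset Site)) ≤ 9 * b ^ 2 * ar μ p l ^ 2 := by
    rw [hσ, div_pow, div_mul_eq_mul_div, div_le_iff₀ (by positivity)]
    linarith
  calc _ = Z ^ j * (σ ^ j * Pr μ p (Con D ({v1, v2} : Finset Site))) := by rw [mul_assoc]
    _ ≤ Z ^ j * (σ ^ 2 * Pr μ p (Con D ({v1, v2} : Finset Site))) :=
      mul_le_mul_of_nonneg_left (mul_le_mul_of_nonneg_right h2 hP0) (pow_nonneg hZ0 _)
    _ ≤ _ := mul_le_mul_of_nonneg_left h3 (pow_nonneg hZ0 _)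

theorem moment_bound' {μ : Measure (Site → ℝ)} (hμ : IsUniformCoupling μ) {p : ℝ} (hp : 1 / 2 ≤ p) (hp1 : p ≤ 1)
    {D : Set Site} (hDf : D.Finite) {V : Finset Site} {l : ℕ}
    (hD : ∀ u ∈ V, ∀ v, sd v u ≤ l → v ∈ D) (j : ℕ) (hj : 2 ≤ j) {t : ℝ} (ht : 0 ≤ t) {E : Set (Site → ℝ)}
    (hE : ∀ ω ∈ E, ∃ C : Finset Site, C ⊆ V ∧ bl p ω ∈ Con D C ∧ t ≤ C.card) :
    t ^ (j + 2) * μ.real E ≤ 2 ^ (j + 1) * ((V.card : ℝ) ^ 2 *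
      ((2 ^ 446 * 2 ^ 255 * ar μ p l * (20 * ((j : ℝ) + 2) * ((l : ℝ) + 1) ^ 2 + V.card)) ^ j *
        (9 * (2 ^ 255) ^ 2 * ar μ p l ^ 2))) := by
  refine (moment_bound hμ hp hp1 hDf hD j ht hE).trans ?_
  refine mul_le_mul_of_nonneg_left ?_ (by positivity)
  have := Finset.sum_le_sum (s := V) (fun v1 _ => Finset.sum_le_sum (s := V) (fun v2 _ =>
    pair_bound hμ hp hp1 (D := D) v1 v2 l V.card j hj))
  refine this.trans (le_of_eq ?_)
  rw [Finset.sum_const, Finset.sum_const, nsmul_eq_mul, nsmul_eq_mul, ← mul_assoc, ← sq]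

theorem final_num {C1 C2 c K : ℝ} (hC1 : 0 < C1) (hC2 : 0 < C2) (hc : 0 < c) (hK : 2 ≤ K)
    {C3 : ℝ} (hC3 : C3 = 40 * K * C1 / c) {a L n x N M t P : ℝ} (ha : 0 < a) (hL : 1 ≤ L) (hn : L ≤ n)
    (hx : 24 * C3 + 1 ≤ x) (hN0 : 0 ≤ N) (hN : N ≤ 25 * n ^ 2) (hM0 : 0 ≤ M) (hM : M ≤ K * L ^ 2) (hP : 0 ≤ P)
    (ht : x * n ^ 2 * (c * a) ≤ t)
    (h : ∀ j : ℕ, 2 ≤ j → t ^ (j + 2) * P ≤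
      2 ^ (j + 1) * (N ^ 2 * ((C1 * a * (20 * ((j : ℝ) + 2) * M + N)) ^ j * (C2 * a ^ 2)))) :
    P ≤ 1250 * C2 / c ^ 2 * Real.exp 1 * Real.exp (-(1 / (12 * C3)) * x * n ^ 2 / L ^ 2) := by
  have hC3p : 0 < C3 := by rw [hC3]; positivity
  have hn0 : 0 < n := by linarith
  have hL0 : 0 < L := by linarith
  have hx1 : 1 ≤ x := by linarith
  have hx0 : 0 < x := by linarith
  obtain ⟨y, hy⟩ : ∃ y, y = 1 / (12 * C3) * x * n ^ 2 / L ^ 2 := ⟨_, rfl⟩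
  have hy0 : 0 ≤ y := by rw [hy]; positivity
  have hr : 1 ≤ n ^ 2 / L ^ 2 := by
    rw [one_le_div (by positivity)]
    gcongr
  have hy2 : 2 ≤ y := by
    have e1 : 2 ≤ 1 / (12 * C3) * x := by
      rw [div_mul_eq_mul_div, le_div_iff₀ (by positivity)]
      linarith
    rw [hy, mul_div_assoc]
    nlinarith
  obtain ⟨j, hj⟩ : ∃ j, j = ⌊y⌋₊ := ⟨_, rfl⟩
  have hj2 : 2 ≤ j := by
    rw [hj]
    exact Nat.le_floor (by exact_mod_cast hy2)
  have hjy : (j : ℝ) ≤ y := by rw [hj]; exact Nat.floor_le hy0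
  have hjy' : y < j + 1 := by rw [hj]; exact Nat.lt_floor_add_one y
  have hj2' : (2 : ℝ) ≤ j := by exact_mod_cast hj2
  have hh := h j hj2
  obtain ⟨W, hW⟩ : ∃ W, W = x * n ^ 2 * (c * a) := ⟨_, rfl⟩
  have hW0 : 0 < W := by rw [hW]; positivity
  -- the ratio
  have hR : 2 * (C1 * a * (20 * ((j : ℝ) + 2) * M + N)) ≤ W * (1 / 3) := by
    have e1 : (j : ℝ) * L ^ 2 * (12 * C3) ≤ x * n ^ 2 := by
      have : (j : ℝ) ≤ x * n ^ 2 / (12 * C3 * L ^ 2) := by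
        refine hjy.trans (le_of_eq ?_)
        rw [hy]; field_simp
      rw [le_div_iff₀ (by positivity)] at this
      linarith
    have e2 : ((j : ℝ) + 2) * M ≤ 2 * j * (K * L ^ 2) := by
      have : (j : ℝ) + 2 ≤ 2 * j := by linarith
      gcongr
    have e3 : C3 * c = 40 * K * C1 := by rw [hC3]; field_simp
    have e4 : n ^ 2 * (24 * C3) ≤ x * n ^ 2 := by
      have : 0 ≤ n ^ 2 := by positivity
      nlinarith
    have e5 : 20 * ((j : ℝ) + 2) * M + N ≤ 20 * K * (2 * (j * L ^ 2) + n ^ 2) := by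
      have : 0 ≤ n ^ 2 := by positivity
      nlinarith
    have e6 : 2 * C1 * (20 * ((j : ℝ) + 2) * M + N) ≤ c * (C3 * (2 * (j * L ^ 2) + n ^ 2)) := by
      calc _ ≤ 2 * C1 * (20 * K * (2 * (j * L ^ 2) + n ^ 2)) := by gcongr
        _ = (40 * K * C1) * (2 * (j * L ^ 2) + n ^ 2) := by ring
        _ = _ := by rw [← e3]; ring
    have e7 : C3 * (2 * (j * L ^ 2) + n ^ 2) ≤ x * n ^ 2 * (1 / 3) := by
      have : 0 ≤ x * n ^ 2 := by positivity
      nlinarith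
    calc _ = a * (2 * C1 * (20 * ((j : ℝ) + 2) * M + N)) := by ring
      _ ≤ a * (c * (x * n ^ 2 * (1 / 3))) := by
        refine mul_le_mul_of_nonneg_left (e6.trans ?_) ha.le
        exact mul_le_mul_of_nonneg_left e7 hc.le
      _ = _ := by rw [hW]; ring
  have hR0 : 0 ≤ 2 * (C1 * a * (20 * ((j : ℝ) + 2) * M + N)) := by positivity
  have hR' := pow_le_pow_left₀ hR0 hR j
  rw [mul_pow 2, mul_pow W] at hR'
  have hWt : W ^ (j + 2) * P ≤ t ^ (j + 2) * P := by
    rw [← hW] at ht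
    gcongr
  have hpre : 2 * N ^ 2 * (C2 * a ^ 2) ≤ 1250 * C2 / c ^ 2 * W ^ 2 := by
    have e1 : N ^ 2 ≤ (25 * n ^ 2) ^ 2 := by gcongr
    have e2 : 1250 * C2 / c ^ 2 * W ^ 2 = 1250 * C2 * a ^ 2 * (n ^ 2) ^ 2 * x ^ 2 := by
      rw [hW]; field_simp
    rw [e2]
    have e3 : (1 : ℝ) ≤ x ^ 2 := one_le_pow₀ hx1
    calc 2 * N ^ 2 * (C2 * a ^ 2) ≤ 2 * (25 * n ^ 2) ^ 2 * (C2 * a ^ 2) := by gcongr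
      _ = 1250 * C2 * a ^ 2 * (n ^ 2) ^ 2 * 1 := by ring
      _ ≤ _ := by gcongr
  have hPP : W ^ (j + 2) * P ≤ W ^ (j + 2) * (1250 * C2 / c ^ 2 * (1 / 3) ^ j) := by
    calc _ ≤ _ := hWt.trans hh
      _ = (2 ^ j * (C1 * a * (20 * ((j : ℝ) + 2) * M + N)) ^ j) * (2 * N ^ 2 * (C2 * a ^ 2)) := by
        rw [pow_succ]; ring
      _ ≤ (W ^ j * (1 / 3) ^ j) * (1250 * C2 / c ^ 2 * W ^ 2) := by
        refine mul_le_mul hR' hpre (by positivity) (by positivity)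
      _ = _ := by rw [pow_add]; ring
  have hP3 : P ≤ 1250 * C2 / c ^ 2 * (1 / 3) ^ j := le_of_mul_le_mul_left hPP (by positivity)
  have hexp : (1 / 3 : ℝ) ^ j ≤ Real.exp 1 * Real.exp (-y) := by
    have e1 : (1 / 3 : ℝ) ≤ Real.exp (-1) := by
      rw [Real.exp_neg, one_div]
      have := Real.exp_one_lt_d9
      exact inv_anti₀ (Real.exp_pos 1) (by linarith)
    calc (1 / 3 : ℝ) ^ j ≤ Real.exp (-1) ^ j := by gcongr
      _ = Real.exp (-(j : ℝ)) := by rw [← Real.exp_nat_mul]; ring_nf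
      _ ≤ Real.exp (1 + -y) := Real.exp_le_exp.2 (by linarith)
      _ = _ := Real.exp_add _ _
  have ey : -(1 / (12 * C3)) * x * n ^ 2 / L ^ 2 = -y := by rw [hy]; ring
  rw [ey, mul_assoc]
  exact hP3.trans (mul_le_mul_of_nonneg_left hexp (by positivity))

theorem box_sub {n : ℝ} (hn : 1 ≤ n) {v : Site} (h : v ∈ box n) : sd v 0 ≤ ⌊2 * n⌋₊ := by
  obtain ⟨h1, h2⟩ := h
  rw [embed_re] at h1
  rw [embed_im] at h2
  have hs : (1.7 : ℝ) ≤ Real.sqrt 3 := by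
    rw [show (1.7 : ℝ) = Real.sqrt (1.7 ^ 2) by rw [Real.sqrt_sq (by norm_num)]]
    exact Real.sqrt_le_sqrt (by norm_num)
  rw [abs_mul, abs_of_nonneg (by positivity : 0 ≤ Real.sqrt 3 / 2)] at h2
  have hb : |(v.2 : ℝ)| ≤ 1.2 * n := by nlinarith [abs_nonneg (v.2 : ℝ)]
  have ha : |(v.1 : ℝ)| ≤ 2 * n := by
    have e : (v.1 : ℝ) = (v.1 + v.2 / 2) - v.2 / 2 := by ring
    have e2 : |(v.2 : ℝ) / 2| = |(v.2 : ℝ)| / 2 := by rw [abs_div]; norm_num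
    rw [e]
    refine (abs_sub _ _).trans ?_
    rw [e2]
    linarith
  refine Nat.le_floor ?_
  have c1 : ((v.1.natAbs : ℕ) : ℝ) = |(v.1 : ℝ)| := by rw [Nat.cast_natAbs]; simp
  have c2 : ((v.2.natAbs : ℕ) : ℝ) = |(v.2 : ℝ)| := by rw [Nat.cast_natAbs]; simp
  have : sd v 0 = max v.1.natAbs v.2.natAbs := by unfold sd; simp
  rw [this, Nat.cast_max, c1, c2]
  exact max_le ha (by linarith)

theorem box_event {p n t : ℝ} (hn : 1 ≤ n) {ω : Site → ℝ} {l : ℕ}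
    (h : t ≤ (maxClusterVol p ω (box n) : ℝ)) :
    ∃ C : Finset Site, C ⊆ bxF 0 ⌊2 * n⌋₊ ∧ bl p ω ∈ Con (Bx ((⌊2 * n⌋₊ + l : ℕ) : ℤ)) C ∧ t ≤ C.card := by
  have hbox : box n ⊆ (bxF 0 ⌊2 * n⌋₊ : Set Site) := fun v hv => by
    rw [Finset.mem_coe, mem_bxF]
    exact box_sub hn hv
  have hbf : (box n).Finite := (Finset.finite_toSet _).subset hbox
  have hcl : ∀ v, clusterIn p ω (box n) v ⊆ box n := fun v u hu => hu.2.1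
  have hne : {k : ℕ | ∃ v ∈ box n, k = (clusterIn p ω (box n) v).ncard}.Nonempty := by
    refine ⟨_, 0, ?_, rfl⟩
    refine ⟨?_, ?_⟩
    · rw [embed_re]; simp; linarith
    · rw [embed_im]; simp; linarith
  have hbd : BddAbove {k : ℕ | ∃ v ∈ box n, k = (clusterIn p ω (box n) v).ncard} := by
    refine ⟨(box n).ncard, ?_⟩
    rintro k ⟨v, _, rfl⟩
    exact Set.ncard_le_ncard (hcl v) hbf
  obtain ⟨v, hv, hk⟩ := Nat.sSup_mem hne hbd
  have hf : (clusterIn p ω (box n) v).Finite := hbf.subset (hcl v)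
  refine ⟨hf.toFinset, ?_, ?_, ?_⟩
  · intro u hu
    exact Finset.mem_coe.1 (hbox (hcl v (hf.mem_toFinset.1 hu)))
  · rw [hf.coe_toFinset]
    intro f hf' g hg
    have h1 := (ConnIn_iff p ω (box n) v f).1 hf'
    have h2 := (ConnIn_iff p ω (box n) v g).1 hg
    refine (h1.symm.trans h2).mono ?_
    refine Set.inter_subset_inter_right _ ?_
    intro u hu
    have h3 := box_sub hn hu
    have h4 : sd u 0 ≤ ⌊2 * n⌋₊ + l := by omega
    have := sd_le.1 h4
    rwa [sub_zero] at this
  · rw [← Set.ncard_eq_toFinset_card _ hf, ← hk]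
    exact h

theorem cluster_tail
    (μ : Measure (Site → ℝ)) (hμ : IsUniformCoupling μ) :
    ∃ c₁ c₂ X : ℝ, 0 < c₁ ∧ 0 < c₂ ∧ 0 < X ∧
      ∀ p : ℝ, pc < p → p ≤ 1 → ∀ n : ℝ, charL μ p ≤ n → ∀ x : ℝ, X ≤ x →
        prob μ {ω | x * n ^ 2 * theta μ p ≤ (maxClusterVol p ω (box n) : ℝ)} ≤
          c₁ * Real.exp (-c₂ * x * n ^ 2 / (charL μ p) ^ 2) := by
  have hprob := hμ.1
  obtain ⟨C1, hC1⟩ : ∃ C : ℝ, C = 2 ^ 446 * 2 ^ 255 := ⟨_, rfl⟩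
  have hC1p : 0 < C1 := by
    rw [hC1]; exact mul_pos (pow_pos (by norm_num) _) (pow_pos (by norm_num) _)
  obtain ⟨C2, hC2⟩ : ∃ C : ℝ, C = 9 * (2 ^ 255) ^ 2 := ⟨_, rfl⟩
  have hC2p : 0 < C2 := by
    rw [hC2]; exact mul_pos (by norm_num) (pow_pos (pow_pos (by norm_num) _) _)
  obtain ⟨c, hc⟩ : ∃ C : ℝ, C = (1 / 2) ^ 500 := ⟨_, rfl⟩
  have hcp : 0 < c := by
    rw [hc]; exact pow_pos (by norm_num) _
  obtain ⟨C3, hC3⟩ : ∃ C : ℝ, C = 40 * (10002 ^ 2) * C1 / c := ⟨_, rfl⟩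
  have hC3p : 0 < C3 := by rw [hC3]; positivity
  refine ⟨max 1 (1250 * C2 / c ^ 2 * Real.exp 1), 1 / (12 * C3), 24 * C3 + 1,
    lt_max_of_lt_left one_pos, by positivity, by positivity, ?_⟩
  intro p hp hp1 n hn x hx
  by_cases hL : Lnat μ p = 0
  · have : charL μ p = 0 := by unfold charL; rw [hL]; simp
    rw [this]
    have h0 : -(1 / (12 * C3)) * x * n ^ 2 / (0 : ℝ) ^ 2 = 0 := by simp
    rw [h0, Real.exp_zero, mul_one]
    exact le_trans (measureReal_le_one (μ := μ)) (le_max_left _ _)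
  have hp2 : (1 : ℝ) / 2 ≤ p := le_of_lt hp
  have hL1 : (1 : ℝ) ≤ charL μ p := by
    unfold charL
    exact_mod_cast Nat.one_le_iff_ne_zero.2 hL
  have hn1 : 1 ≤ n := hL1.trans hn
  obtain ⟨l, hl⟩ : ∃ l, l = Lnat μ p + 10000 := ⟨_, rfl⟩
  have hG := Good_of_L hμ hp hL (n0 := l) (by omega)
  have hth : c * ar μ p l ≤ theta μ p := by
    refine theta_ge hμ (fun m => ?_)
    rw [hc]
    exact ar_infinite hμ hp2 hp1 (by omega) hG m
  have ha : 0 < ar μ p l := by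
    refine lt_of_lt_of_le ?_ (ar_lower hμ hp2 hp1 l)
    positivity
  have hx0 : 0 ≤ x := by linarith
  have hV : ((bxF 0 ⌊2 * n⌋₊).card : ℝ) ≤ 25 * n ^ 2 := by
    rw [card_bxF]
    push_cast
    have := Nat.floor_le (by linarith : 0 ≤ 2 * n)
    have h0 : (0 : ℝ) ≤ (⌊2 * n⌋₊ : ℝ) := by positivity
    nlinarith
  have hM : ((l : ℝ) + 1) ^ 2 ≤ 10002 ^ 2 * charL μ p ^ 2 := by
    rw [← mul_pow]
    have : (l : ℝ) = charL μ p + 10000 := by rw [hl]; unfold charL; push_cast; rfl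
    refine pow_le_pow_left₀ (by positivity) ?_ 2
    linarith
  have hD : ∀ u ∈ bxF 0 ⌊2 * n⌋₊, ∀ v, sd v u ≤ l → v ∈ Bx ((⌊2 * n⌋₊ + l : ℕ) : ℤ) := by
    intro u hu v hv
    rw [mem_bxF] at hu
    have h1 := sd_tri v u 0
    have h2 : sd v 0 ≤ ⌊2 * n⌋₊ + l := by omega
    have := sd_le.1 h2
    rwa [sub_zero] at this
  have ht0 : 0 ≤ x * n ^ 2 * theta μ p :=
    mul_nonneg (by positivity) (le_trans (by positivity) hth)
  have hfin := final_num hC1p hC2p hcp (K := 10002 ^ 2) (by norm_num) hC3 ha hL1 hn hx (N := (bxF 0 ⌊2 * n⌋₊).card)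
    (by positivity) hV (M := ((l : ℝ) + 1) ^ 2) (by positivity) hM
    (t := x * n ^ 2 * theta μ p)
    (P := prob μ {ω | x * n ^ 2 * theta μ p ≤ (maxClusterVol p ω (box n) : ℝ)})
    ENNReal.toReal_nonneg (mul_le_mul_of_nonneg_left hth (by positivity)) (fun j hj => by
      rw [hC1, hC2]
      exact moment_bound' hμ hp2 hp1 (Bx_finite _) hD j hj ht0 (fun ω hω => box_event hn1 hω))
  refine hfin.trans ?_
  exact mul_le_mul_of_nonneg_right (le_max_right _ _) (Real.exp_pos _).le

/-- Lemma 4.4 (tail estimate on the volume of the largest cluster in a box). -/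
theorem largest_cluster_tail
    (μ : Measure (Site → ℝ)) (hμ : IsUniformCoupling μ) :
    ∃ c₁ c₂ X : ℝ, 0 < c₁ ∧ 0 < c₂ ∧ 0 < X ∧
      ∀ p : ℝ, pc < p → p ≤ 1 → ∀ n : ℝ, charL μ p ≤ n → ∀ x : ℝ, X ≤ x →
        prob μ {ω | x * n ^ 2 * theta μ p ≤ (maxClusterVol p ω (box n) : ℝ)} ≤
          c₁ * Real.exp (-c₂ * x * n ^ 2 / (charL μ p) ^ 2) := by
  exact cluster_tail μ hμ

end FrozenPercolation
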